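/- arXiv:1910.01322 — 2 statements merged into one kernel-verified Lean document; each statement's English description precedes it below -/
import Mathlib

section
/- Under the standing assumptions (k ≥ 2r+13 ≥ 18; n > N_{k,r}; H a connected n-vertex r-graph with no Berge-path of length k and with at least C(⌊(k-1)/2⌋, r-1)·(n − ⌊(k-1)/2⌋) + C(⌊(k-1)/2⌋, r) + [k even]·C(⌊(k-1)/2⌋, r-2) hyperedges; H' the sub-hypergraph obtained from H by repeatedly deleting vertices of degree less than C(⌊(k-1)/2⌋, r-1) together with their incident hyperedges), if l denotes the length of a longest Berge-path of H', then H' contains a Berge-cycle of length l or a Berge-cycle of length l+1. -/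
open scoped Classical

/-- A Berge-path of length `t` in the hypergraph `H` (a family of hyperedges):
an alternating sequence of `t+1` distinct vertices and `t` distinct hyperedges
`v₁, e₁, …, e_t, v_{t+1}` with `vᵢ, vᵢ₊₁ ∈ eᵢ`. -/
structure BergePath {V : Type*} (H : Finset (Finset V)) (t : ℕ) where
  verts : Fin (t + 1) → V
  edges : Fin t → Finset V
  verts_inj : Function.Injective verts
  edges_inj : Function.Injective edges
  edges_mem : ∀ i, edges i ∈ H
  fst_mem : ∀ i : Fin t, verts i.castSucc ∈ edges i
  snd_mem : ∀ i : Fin t, verts i.succ ∈ edges i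

/-- A Berge-cycle of length `t` in the hypergraph `H`: `t` distinct vertices and
`t` distinct hyperedges with `vᵢ, vᵢ₊₁ ∈ eᵢ`, indices mod `t`. -/
structure BergeCycle {V : Type*} (H : Finset (Finset V)) (t : ℕ) where
  verts : Fin t → V
  edges : Fin t → Finset V
  verts_inj : Function.Injective verts
  edges_inj : Function.Injective edges
  edges_mem : ∀ i, edges i ∈ H
  fst_mem : ∀ i, verts i ∈ edges i
  snd_mem : ∀ i : Fin t, verts ⟨(i.val + 1) % t, Nat.mod_lt _ i.pos⟩ ∈ edges i

/-- `u` and `v` are joined by a Berge-path of `H`. -/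
def BergeReachable {V : Type*} (H : Finset (Finset V)) (u v : V) : Prop :=
  ∃ t, ∃ P : BergePath H t, P.verts 0 = u ∧ P.verts (Fin.last t) = v

/-- A hypergraph on the vertex type `V` is connected if any two vertices are joined
by a Berge-path. -/
def HConnected {V : Type*} (H : Finset (Finset V)) : Prop :=
  ∀ u v : V, u ≠ v → BergeReachable H u v

/-- The degree of a vertex: the number of hyperedges containing it. -/
noncomputable def hdeg {V : Type*} (H : Finset (Finset V)) (v : V) : ℕ :=
  (H.filter (fun e => v ∈ e)).card

/-- The vertex neighborhood of `v` in `H`. -/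
noncomputable def nbhd {V : Type*} [Fintype V] (H : Finset (Finset V)) (v : V) : Finset V :=
  Finset.univ.filter (fun u => u ≠ v ∧ ∃ e ∈ H, v ∈ e ∧ u ∈ e)

/-- The sub-hypergraph induced by a set `S` of vertices: all hyperedges lying inside `S`. -/
noncomputable def restrictTo {V : Type*} (H : Finset (Finset V)) (S : Finset V) :
    Finset (Finset V) :=
  H.filter (fun e => e ⊆ S)

/-- `DelProcess H D S T` : starting from the vertex set `S`, the vertex set `T` can be
reached by repeatedly deleting a vertex whose degree in the current induced
sub-hypergraph is less than `D` (together with all hyperedges containing it). -/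
inductive DelProcess {V : Type*} (H : Finset (Finset V)) (D : ℕ) :
    Finset V → Finset V → Prop
  | refl (S : Finset V) : DelProcess H D S S
  | step (S T : Finset V) (v : V) (hv : v ∈ S)
      (hd : hdeg (restrictTo H S) v < D)
      (h : DelProcess H D (S.erase v) T) : DelProcess H D S T

/-- The edge family of `H_{n,k}` for odd `k`, on vertex set `S` with kernel `A`:
all `r`-subsets of `S` having at most one vertex outside `A`. -/
noncomputable def HnkFamilyOdd {V : Type*} (r : ℕ) (S A : Finset V) : Finset (Finset V) :=
  S.powerset.filter (fun s => s.card = r ∧ (s \ A).card ≤ 1)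

/-- The edge family of `H_{n,k}` for even `k`: additionally all `r`-subsets consisting of
`b1`, `b2` and `r-2` vertices of `A`. -/
noncomputable def HnkFamilyEven {V : Type*} (r : ℕ) (S A : Finset V) (b1 b2 : V) :
    Finset (Finset V) :=
  S.powerset.filter (fun s => s.card = r ∧ ((s \ A).card ≤ 1 ∨ s \ A = {b1, b2}))

/-- `H` is (a copy of) the extremal hypergraph `H_{m,k}` on the vertex set `S`
(where `m = |S|`). Note that `⌊(k-1)/2⌋` equals `(k-1)/2` in ℕ for odd `k`,
and `(k-2)/2` for even `k`. -/
def IsHnkOn {V : Type*} (r k : ℕ) (S : Finset V) (H : Finset (Finset V)) : Prop :=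
  ∃ A ⊆ S, A.card = (k - 1) / 2 ∧
    ((Odd k ∧ H = HnkFamilyOdd r S A) ∨
     (Even k ∧ ∃ b1 ∈ S \ A, ∃ b2 ∈ S \ A, b1 ≠ b2 ∧ H = HnkFamilyEven r S A b1 b2))

/-- The extremal number of hyperedges:
`C(⌊(k-1)/2⌋, r-1)·(n − ⌊(k-1)/2⌋) + C(⌊(k-1)/2⌋, r) + [2 ∣ k]·C(⌊(k-1)/2⌋, r-2)`. -/
def extremalCount (r k n : ℕ) : ℕ :=
  ((k - 1) / 2).choose (r - 1) * (n - (k - 1) / 2) + ((k - 1) / 2).choose r +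
    (if 2 ∣ k then ((k - 1) / 2).choose (r - 2) else 0)

/-- The threshold `N_{k,r}`. -/
def Nkr (r k : ℕ) : ℕ :=
  (r * (k - 1)).choose r + ((k - 1) / 2).choose (r - 1) * ((k - 1) / 2)
    - ((k - 1) / 2).choose r - (if 2 ∣ k then ((k - 1) / 2).choose (r - 2) else 0)
    + r * (k - 1)

/-- Adjacency in the bipartite incidence graph of the hypergraph `H`. -/
def Inc {V : Type*} (H : Finset (Finset V)) : V ⊕ Finset V → V ⊕ Finset V → Prop
  | .inl v, .inr e => e ∈ H ∧ v ∈ e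
  | .inr e, .inl v => e ∈ H ∧ v ∈ e
  | _, _ => False

section Basics

variable {V : Type*} {H : Finset (Finset V)}

@[simp] theorem inc_inl_inr {v : V} {e : Finset V} :
    Inc H (.inl v) (.inr e) ↔ e ∈ H ∧ v ∈ e := Iff.rfl

@[simp] theorem inc_inr_inl {v : V} {e : Finset V} :
    Inc H (.inr e) (.inl v) ↔ e ∈ H ∧ v ∈ e := Iff.rfl

@[simp] theorem not_inc_inl_inl {v w : V} : ¬ Inc H (.inl v) (.inl w) := id

@[simp] theorem not_inc_inr_inr {e f : Finset V} : ¬ Inc H (.inr e) (.inr f) := id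

theorem Inc.symm {a b : V ⊕ Finset V} (h : Inc H a b) : Inc H b a := by
  rcases a with a | a <;> rcases b with b | b <;> simp_all

theorem Inc.mono {H₂ : Finset (Finset V)} (hs : H ⊆ H₂) {a b : V ⊕ Finset V} (h : Inc H a b) :
    Inc H₂ a b := by
  rcases a with a | a <;> rcases b with b | b <;> simp at h ⊢
  · exact ⟨hs h.1, h.2⟩
  · exact ⟨hs h.1, h.2⟩

theorem isChain_inc_reverse {L : List (V ⊕ Finset V)} (h : L.IsChain (Inc H)) :
    L.reverse.IsChain (Inc H) :=
  List.isChain_reverse.2 (h.imp fun _ _ hab => hab.symm)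

/-- A cycle of the incidence graph, written as a list. -/
def CycList (H : Finset (Finset V)) (L : List (V ⊕ Finset V)) : Prop :=
  L.Nodup ∧ L.IsChain (Inc H) ∧ ∃ a ∈ L.head?, ∃ b ∈ L.getLast?, Inc H b a

theorem chain_parity {L : List (V ⊕ Finset V)} (h : L.IsChain (Inc H)) {v : V}
    (h0 : L.head? = some (.inl v)) :
    ∀ i (hi : i < L.length), (i % 2 = 0 → ∃ u, L[i] = .inl u) ∧ (i % 2 = 1 → ∃ e, L[i] = .inr e)
  | 0, hi => by
    refine ⟨fun _ => ⟨v, ?_⟩, by simp⟩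
    have := List.head?_eq_getElem? (l := L)
    rw [h0] at this
    simpa [List.getElem?_eq_getElem hi] using this.symm
  | i + 1, hi => by
    have ih := chain_parity h h0 i (by omega)
    have hR := List.isChain_iff_getElem.1 h i hi
    constructor
    · intro hp
      obtain ⟨e, he⟩ := ih.2 (by omega)
      rcases hx : L[i + 1] with u | f
      · exact ⟨u, rfl⟩
      · rw [he, hx] at hR; simp at hR
    · intro hp
      obtain ⟨e, he⟩ := ih.1 (by omega)
      rcases hx : L[i + 1] with u | f
      · rw [he, hx] at hR; simp at hR
      · exact ⟨f, rfl⟩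

theorem nonempty_bergePath_of_chain {L : List (V ⊕ Finset V)} (h : L.IsChain (Inc H))
    (hn : L.Nodup) {v : V} (h0 : L.head? = some (.inl v)) {t : ℕ} (ht : 2 * t + 1 ≤ L.length) :
    Nonempty (BergePath H t) := by
  have hv : ∀ i : Fin (t + 1), ∃ u, L[2 * i.val]'(by omega) = .inl u := fun i =>
    (chain_parity h h0 (2 * i.val) (by omega)).1 (by omega)
  have he : ∀ i : Fin t, ∃ u, L[2 * i.val + 1]'(by omega) = .inr u := fun i =>
    (chain_parity h h0 (2 * i.val + 1) (by omega)).2 (by omega)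
  choose x hx using hv
  choose e he using he
  have hR := List.isChain_iff_getElem.1 h
  have h1 : ∀ i : Fin t, e i ∈ H ∧ x i.castSucc ∈ e i := by
    intro i
    have := hR (2 * i.val) (by omega)
    rw [he i] at this
    rw [show L[2 * i.val]'(by omega) = .inl (x i.castSucc) from hx i.castSucc] at this
    simpa using this
  have h2 : ∀ i : Fin t, e i ∈ H ∧ x i.succ ∈ e i := by
    intro i
    have := hR (2 * i.val + 1) (by omega)
    rw [he i] at this
    rw [show L[2 * i.val + 1 + 1]'(by omega) = .inl (x i.succ) from hx i.succ] at this
    simpa using this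
  refine ⟨⟨x, e, ?_, ?_, fun i => (h1 i).1, fun i => (h1 i).2, fun i => (h2 i).2⟩⟩
  · intro i j hij
    have : L[2 * i.val]'(by omega) = L[2 * j.val]'(by omega) := by rw [hx, hx, hij]
    have := hn.getElem_inj_iff.1 this
    exact Fin.ext (by omega)
  · intro i j hij
    have : L[2 * i.val + 1]'(by omega) = L[2 * j.val + 1]'(by omega) := by rw [he, he, hij]
    have := hn.getElem_inj_iff.1 this
    exact Fin.ext (by omega)

/-- A path of the incidence graph ending in a vertex is short if there is no Berge-path of
length `k`. -/
theorem length_le_of_isEmpty_bergePath {L : List (V ⊕ Finset V)} (h : L.IsChain (Inc H))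
    (hn : L.Nodup) {v : V} (h0 : L.getLast? = some (.inl v)) {k : ℕ}
    (hk : IsEmpty (BergePath H k)) : L.length ≤ 2 * k := by
  by_contra hlt
  exact not_isEmpty_iff.2 (nonempty_bergePath_of_chain (isChain_inc_reverse h)
    (List.nodup_reverse.2 hn) (v := v) (by simpa using h0) (t := k) (by simp; omega)) hk

theorem CycList.exists_head_inl {L : List (V ⊕ Finset V)} (h : CycList H L) :
    ∃ L' v, CycList H L' ∧ L'.length = L.length ∧ L'.head? = some (.inl v) := by
  obtain ⟨hn, hc, a, ha, b, hb, hab⟩ := h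
  rcases a with a | a
  · exact ⟨L, a, ⟨hn, hc, _, ha, _, hb, hab⟩, rfl, ha⟩
  · rcases L with _ | ⟨y, L⟩
    · simp at ha
    · simp at ha
      subst ha
      rcases L with _ | ⟨y, L⟩
      · simp at hb; subst hb; simp at hab
      · have hy := (List.isChain_cons_cons.1 hc)
        rcases y with y | y
        · refine ⟨.inl y :: (L ++ [.inr a]), y, ⟨?_, ?_, .inl y, by simp, .inr a, ?_, ?_⟩, by simp,
            by simp⟩
          · have : List.Perm (.inl y :: (L ++ [.inr a])) (.inr a :: .inl y :: L) := by
              rw [← List.cons_append]; exact List.perm_append_singleton _ _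
            exact this.nodup_iff.2 hn
          · rw [← List.cons_append, List.isChain_append]
            refine ⟨hy.2, List.isChain_singleton _, ?_⟩
            intro z hz w hw
            simp only [List.getLast?_cons_cons] at hb
            have : z = b := by
              rw [Option.mem_def] at hz hb
              rw [hz] at hb; simpa using hb
            simp at hw
            subst hw this
            exact hab
          · rw [← List.cons_append]; exact List.getLast?_concat
          · exact hy.1
        · simp at hy

theorem CycList.nonempty_bergeCycle {L : List (V ⊕ Finset V)} (h : CycList H L) :
    ∃ t, L.length = 2 * t ∧ Nonempty (BergeCycle H t) := by
  obtain ⟨L', v, ⟨hn, hc, a, ha, b, hb, hab⟩, hlen, hv⟩ := h.exists_head_inl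
  rw [← hlen]
  clear hlen h
  have hpar := chain_parity hc hv
  have hne : 0 < L'.length := by
    rcases L' with _ | ⟨y, L'⟩
    · simp at hv
    · simp
  have hav : a = .inl v := by
    rw [Option.mem_def, hv] at ha; simpa using ha.symm
  have hbl : L'[L'.length - 1] = b := by
    rw [List.getLast?_eq_getElem?, Option.mem_def, List.getElem?_eq_getElem (by omega)] at hb
    simpa using hb
  have hv0 : L'[0] = .inl v := by
    rw [List.head?_eq_getElem?, List.getElem?_eq_getElem (by omega)] at hv
    simpa using hv
  have heven : L'.length % 2 = 0 := by
    by_contra hodd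
    obtain ⟨u, hu⟩ := (hpar (L'.length - 1) (by omega)).1 (by omega)
    rw [← hbl, hu, hav] at hab
    simp at hab
  obtain ⟨t, ht⟩ : ∃ t, L'.length = 2 * t := ⟨L'.length / 2, by omega⟩
  refine ⟨t, ht, ?_⟩
  have hx : ∀ i : Fin t, ∃ u, L'[2 * i.val]'(by omega) = .inl u := fun i =>
    (hpar (2 * i.val) (by omega)).1 (by omega)
  have he : ∀ i : Fin t, ∃ u, L'[2 * i.val + 1]'(by omega) = .inr u := fun i =>
    (hpar (2 * i.val + 1) (by omega)).2 (by omega)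
  choose x hx using hx
  choose e he using he
  have hR := List.isChain_iff_getElem.1 hc
  have h1 : ∀ i : Fin t, e i ∈ H ∧ x i ∈ e i := by
    intro i
    have := hR (2 * i.val) (by omega)
    rw [he i, hx i] at this
    simpa using this
  refine ⟨⟨x, e, ?_, ?_, fun i => (h1 i).1, fun i => (h1 i).2, ?_⟩⟩
  · intro i j hij
    have : L'[2 * i.val]'(by omega) = L'[2 * j.val]'(by omega) := by rw [hx, hx, hij]
    have := hn.getElem_inj_iff.1 this
    exact Fin.ext (by omega)
  · intro i j hij
    have : L'[2 * i.val + 1]'(by omega) = L'[2 * j.val + 1]'(by omega) := by rw [he, he, hij]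
    have := hn.getElem_inj_iff.1 this
    exact Fin.ext (by omega)
  · intro i
    by_cases hi : i.val + 1 = t
    · have h2 : L'[2 * ((i.val + 1) % t)]'(by simp [hi]; omega) = L'[0] := by simp [hi]
      have h3 := hx ⟨(i.val + 1) % t, Nat.mod_lt _ i.pos⟩
      simp only at h3
      rw [h2, hv0] at h3
      have h4 : L'[2 * i.val + 1]'(by omega) = b := by
        rw [← hbl]; congr 1; omega
      rw [he] at h4
      rw [← h4, hav, h3] at hab
      exact (inc_inr_inl.1 hab).2
    · have := hR (2 * i.val + 1) (by omega)
      have h3 := hx ⟨(i.val + 1) % t, Nat.mod_lt _ i.pos⟩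
      have hm : (i.val + 1) % t = i.val + 1 := Nat.mod_eq_of_lt (by omega)
      simp only [hm] at h3 ⊢
      rw [he, show L'[2 * i.val + 1 + 1]'(by omega) = L'[2 * (i.val + 1)]'(by omega) by
        congr 1] at this
      rw [h3] at this
      exact (inc_inr_inl.1 this).2

end Basics

/-- A Berge-cycle of length `c`, as a pair of `c`-periodic sequences. -/
structure IsCyc {V : Type*} (H : Finset (Finset V)) (c : ℕ) (x : ℕ → V) (e : ℕ → Finset V) :
    Prop where
  pos : 0 < c
  x_per : ∀ i, x (i + c) = x i
  e_per : ∀ i, e (i + c) = e i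
  x_inj : ∀ i j, i < c → j < c → x i = x j → i = j
  e_inj : ∀ i j, i < c → j < c → e i = e j → i = j
  mem : ∀ i, e i ∈ H
  fst : ∀ i, x i ∈ e i
  snd : ∀ i, x (i + 1) ∈ e i

/-- The closed walk `x 0, e 0, x 1, e 1, …` in the incidence graph. -/
def cyc {V : Type*} (x : ℕ → V) (e : ℕ → Finset V) (t : ℕ) : V ⊕ Finset V :=
  if t % 2 = 0 then .inl (x (t / 2)) else .inr (e (t / 2))

section Cycles

variable {V : Type*} {H : Finset (Finset V)} {c : ℕ} {x : ℕ → V} {e : ℕ → Finset V}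

theorem cyc_two_mul (i : ℕ) : cyc x e (2 * i) = .inl (x i) := by simp [cyc]

theorem cyc_two_mul_add_one (i : ℕ) : cyc x e (2 * i + 1) = .inr (e i) := by
  simp [cyc, Nat.add_mod, show (2 * i + 1) / 2 = i by omega]

theorem exists_isCyc_of_bergeCycle (hc : 0 < c) (C : BergeCycle H c) : ∃ x e, IsCyc H c x e := by
  refine ⟨fun i => C.verts ⟨i % c, Nat.mod_lt _ hc⟩, fun i => C.edges ⟨i % c, Nat.mod_lt _ hc⟩,
    hc, by simp, by simp, ?_, ?_, fun i => C.edges_mem _, fun i => C.fst_mem _, ?_⟩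
  · intro i j hi hj h
    have := C.verts_inj h
    simpa [Nat.mod_eq_of_lt hi, Nat.mod_eq_of_lt hj] using this
  · intro i j hi hj h
    have := C.edges_inj h
    simpa [Nat.mod_eq_of_lt hi, Nat.mod_eq_of_lt hj] using this
  · intro i
    have := C.snd_mem ⟨i % c, Nat.mod_lt _ hc⟩
    simpa using this

namespace IsCyc

theorem x_mod (h : IsCyc H c x e) (i : ℕ) : x (i % c) = x i :=
  Function.Periodic.map_mod_nat h.x_per i

theorem e_mod (h : IsCyc H c x e) (i : ℕ) : e (i % c) = e i :=
  Function.Periodic.map_mod_nat h.e_per i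

theorem x_eq_iff (h : IsCyc H c x e) {i j : ℕ} : x i = x j ↔ i % c = j % c := by
  constructor
  · intro hij
    rw [← h.x_mod i, ← h.x_mod j] at hij
    exact h.x_inj _ _ (Nat.mod_lt _ h.pos) (Nat.mod_lt _ h.pos) hij
  · intro hij
    rw [← h.x_mod i, ← h.x_mod j, hij]

theorem e_eq_iff (h : IsCyc H c x e) {i j : ℕ} : e i = e j ↔ i % c = j % c := by
  constructor
  · intro hij
    rw [← h.e_mod i, ← h.e_mod j] at hij
    exact h.e_inj _ _ (Nat.mod_lt _ h.pos) (Nat.mod_lt _ h.pos) hij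
  · intro hij
    rw [← h.e_mod i, ← h.e_mod j, hij]

theorem shift (h : IsCyc H c x e) (d : ℕ) :
    IsCyc H c (fun i => x (i + d)) (fun i => e (i + d)) where
  pos := h.pos
  x_per i := by rw [show i + c + d = (i + d) + c by omega, h.x_per]
  e_per i := by rw [show i + c + d = (i + d) + c by omega, h.e_per]
  x_inj i j hi hj hij := by
    have := h.x_eq_iff.1 hij
    have : i ≡ j [MOD c] := Nat.ModEq.add_right_cancel' d this
    rwa [Nat.ModEq, Nat.mod_eq_of_lt hi, Nat.mod_eq_of_lt hj] at this
  e_inj i j hi hj hij := by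
    have := h.e_eq_iff.1 hij
    have : i ≡ j [MOD c] := Nat.ModEq.add_right_cancel' d this
    rwa [Nat.ModEq, Nat.mod_eq_of_lt hi, Nat.mod_eq_of_lt hj] at this
  mem i := h.mem _
  fst i := h.fst _
  snd i := by rw [show i + 1 + d = (i + d) + 1 by omega]; exact h.snd _

theorem cyc_step (h : IsCyc H c x e) (t : ℕ) : Inc H (cyc x e t) (cyc x e (t + 1)) := by
  obtain ⟨i, rfl | rfl⟩ : ∃ i, t = 2 * i ∨ t = 2 * i + 1 := ⟨t / 2, by omega⟩
  · rw [cyc_two_mul, cyc_two_mul_add_one]; exact ⟨h.mem i, h.fst i⟩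
  · rw [show 2 * i + 1 + 1 = 2 * (i + 1) by omega, cyc_two_mul, cyc_two_mul_add_one]
    exact ⟨h.mem i, h.snd i⟩

theorem cyc_per (h : IsCyc H c x e) (t : ℕ) : cyc x e (t + 2 * c) = cyc x e t := by
  obtain ⟨i, rfl | rfl⟩ : ∃ i, t = 2 * i ∨ t = 2 * i + 1 := ⟨t / 2, by omega⟩
  · rw [show 2 * i + 2 * c = 2 * (i + c) by omega, cyc_two_mul, cyc_two_mul, h.x_per]
  · rw [show 2 * i + 1 + 2 * c = 2 * (i + c) + 1 by omega, cyc_two_mul_add_one,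
      cyc_two_mul_add_one, h.e_per]

theorem eq_of_mod_eq {i j : ℕ} (hij : i ≤ j) (hj : j < i + c) (hm : i % c = j % c) : i = j := by
  have h : i ≡ j [MOD c] := hm
  have h2 := (Nat.modEq_iff_dvd' hij).1 h
  have := Nat.eq_zero_of_dvd_of_lt h2 (by omega)
  omega

theorem cyc_ne (h : IsCyc H c x e) {t u : ℕ} (htu : t < u) (hu : u < t + 2 * c) :
    cyc x e t ≠ cyc x e u := by
  intro heq
  obtain ⟨i, rfl | rfl⟩ : ∃ i, t = 2 * i ∨ t = 2 * i + 1 := ⟨t / 2, by omega⟩ <;>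
  obtain ⟨j, rfl | rfl⟩ : ∃ i, u = 2 * i ∨ u = 2 * i + 1 := ⟨u / 2, by omega⟩ <;>
  simp only [cyc_two_mul, cyc_two_mul_add_one, Sum.inl.injEq, Sum.inr.injEq, reduceCtorEq] at heq
  · have := eq_of_mod_eq (by omega) (by omega) (h.x_eq_iff.1 heq)
    omega
  · have := eq_of_mod_eq (by omega) (by omega) (h.e_eq_iff.1 heq)
    omega

theorem isChain_arc (h : IsCyc H c x e) (a n : ℕ) :
    ((List.range' a n).map (cyc x e)).IsChain (Inc H) := by
  rw [List.isChain_iff_getElem]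
  intro i hi
  simpa [Nat.add_assoc] using h.cyc_step (a + i)

theorem nodup_arc (h : IsCyc H c x e) (a n : ℕ) (hn : n ≤ 2 * c) :
    ((List.range' a n).map (cyc x e)).Nodup := by
  refine List.Nodup.map_on ?_ List.nodup_range'
  intro t ht u hu htu
  simp only [List.mem_range'_1] at ht hu
  by_contra hne
  rcases Nat.lt_or_gt_of_ne hne with hlt | hlt
  · exact h.cyc_ne hlt (by omega) htu
  · exact h.cyc_ne hlt (by omega) htu.symm

/-- A path outside a longest cycle joining two of its elements is no longer than the arc it
bypasses. -/
theorem detour (h : IsCyc H c x e) (hmax : ∀ c', Nonempty (BergeCycle H c') → c' ≤ c)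
    {D : List (V ⊕ Finset V)} (hD : D.IsChain (Inc H)) (hDn : D.Nodup)
    (hext : ∀ a ∈ D, ∀ t, a ≠ cyc x e t) {i j : ℕ} (hij : i < j) (hji : j < i + 2 * c)
    {a b : V ⊕ Finset V} (ha : a ∈ D.head?) (hb : b ∈ D.getLast?)
    (hia : Inc H (cyc x e i) a) (hbj : Inc H b (cyc x e j)) : D.length + 1 ≤ j - i := by
  obtain ⟨n, hn⟩ : ∃ n, i + 2 * c = j + n := ⟨i + 2 * c - j, by omega⟩
  have hcl : CycList H ((List.range' j (n + 1)).map (cyc x e) ++ D) := by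
    refine ⟨?_, ?_, cyc x e j, ?_, b, ?_, hbj⟩
    · rw [List.nodup_append]
      refine ⟨h.nodup_arc _ _ (by omega), hDn, ?_⟩
      intro y hy z hz hyz
      obtain ⟨t, -, rfl⟩ := List.mem_map.1 hy
      exact hext z hz t hyz.symm
    · rw [List.isChain_append]
      refine ⟨h.isChain_arc _ _, hD, ?_⟩
      intro y hy z hz
      have hz' : z = a := by
        rw [Option.mem_def] at hz ha; rw [hz] at ha; simpa using ha
      have hy' : y = cyc x e i := by
        rw [List.range'_concat] at hy
        simp at hy
        rw [← hy, ← hn, h.cyc_per]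
      rw [hy', hz']; exact hia
    · simp [List.range'_succ]
    · have hne : D ≠ [] := by rintro rfl; simp at hb
      rw [Option.mem_def] at hb ⊢
      rw [List.getLast?_append, hb]; rfl
  obtain ⟨t, ht, hcy⟩ := hcl.nonempty_bergeCycle
  have := hmax t hcy
  simp at ht
  omega

/-- Going once around a cycle and then leaving it along an outer path. -/
theorem two_mul_add_length_le (h : IsCyc H c x e) {H₂ : Finset (Finset V)} (hs : H ⊆ H₂) {k : ℕ}
    (hk : IsEmpty (BergePath H₂ k))
    {D : List (V ⊕ Finset V)} (hD : D.IsChain (Inc H₂)) (hDn : D.Nodup)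
    (hext : ∀ a ∈ D, ∀ t, a ≠ cyc x e t) {i : ℕ}
    {a : V ⊕ Finset V} (ha : a ∈ D.head?) {z : V} (hz : D.getLast? = some (.inl z))
    (hia : Inc H₂ (cyc x e i) a) : 2 * c + D.length ≤ 2 * k := by
  have := length_le_of_isEmpty_bergePath (H := H₂) (k := k)
    (L := (List.range' (i + 1) (2 * c)).map (cyc x e) ++ D) (v := z) ?_ ?_ ?_ hk
  · simpa using this
  · rw [List.isChain_append]
    refine ⟨(h.isChain_arc _ _).imp fun _ _ => Inc.mono hs, hD, ?_⟩
    intro y hy w hw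
    have hw' : w = a := by
      rw [Option.mem_def] at hw ha; rw [hw] at ha; simpa using ha
    have hy' : y = cyc x e i := by
      obtain ⟨m, hm⟩ : ∃ m, 2 * c = m + 1 := ⟨2 * c - 1, by have := h.pos; omega⟩
      rw [hm, List.range'_concat] at hy
      simp at hy
      rw [← hy, ← h.cyc_per i]; congr 1; omega
    rw [hy', hw']; exact hia
  · rw [List.nodup_append]
    refine ⟨h.nodup_arc _ _ le_rfl, hDn, ?_⟩
    intro y hy z hz hyz
    obtain ⟨t, -, rfl⟩ := List.mem_map.1 hy
    exact hext z hz t hyz.symm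
  · rw [List.getLast?_append, hz]; rfl

theorem bergePath (h : IsCyc H c x e) : Nonempty (BergePath H (c - 1)) :=
  nonempty_bergePath_of_chain (h.isChain_arc 0 (2 * c)) (h.nodup_arc 0 _ le_rfl) (v := x 0)
    (by
      obtain ⟨m, hm⟩ : ∃ m, 2 * c = m + 1 := ⟨2 * c - 1, by have := h.pos; omega⟩
      rw [hm, List.range'_succ]; simp [cyc]) (by have := h.pos; simp; omega)

end IsCyc

end Cycles

section Counting

variable {V : Type*} {H : Finset (Finset V)} {c : ℕ} {x : ℕ → V} {e : ℕ → Finset V}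

/-- The number of `r`-sets containing `z` inside `{z} ∪ X`. -/
theorem card_le_choose_of_subset {F : Finset (Finset V)} {z : V} {X : Finset V} {r : ℕ}
    (hF : ∀ g ∈ F, g.card = r ∧ z ∈ g ∧ ∀ u ∈ g, u = z ∨ u ∈ X) :
    F.card ≤ X.card.choose (r - 1) := by
  rw [← Finset.card_powersetCard]
  refine Finset.card_le_card_of_injOn (fun g => g.erase z) ?_ ?_
  · intro g hg
    obtain ⟨h1, h2, h3⟩ := hF g hg
    refine Finset.mem_coe.2 (Finset.mem_powersetCard.2 ⟨fun u hu => ?_, by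
      rw [Finset.card_erase_of_mem h2, h1]⟩)
    rcases Finset.mem_erase.1 hu with ⟨h4, h5⟩
    exact (h3 u h5).resolve_left h4
  · intro g hg g' hg' h
    have h' : g.erase z = g'.erase z := h
    rw [← Finset.insert_erase (hF g hg).2.1, ← Finset.insert_erase (hF g' hg').2.1, h']

namespace IsCyc

variable {z : V}

theorem false_of_consecutive (h : IsCyc H c x e)
    (hmax : ∀ c', Nonempty (BergeCycle H c') → c' ≤ c) (hc : 2 ≤ c) (hz : ∀ i, x i ≠ z)
    {g g' : Finset V} (hg : g ∈ H ∧ z ∈ g ∧ ∀ i, e i ≠ g) (hg' : g' ∈ H ∧ z ∈ g' ∧ ∀ i, e i ≠ g')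
    (hne : g ≠ g') {i : ℕ} (hi : x i ∈ g) (hi' : x (i + 1) ∈ g') : False := by
  have := h.detour hmax (D := [.inr g, .inl z, .inr g']) (i := 2 * i) (j := 2 * (i + 1))
    (a := .inr g) (b := .inr g') ?_ ?_ ?_ (by omega) (by omega) (by simp) (by simp) ?_ ?_
  · simp at this; omega
  · simp [hg, hg']
  · simp [hne]
  · intro a ha t
    obtain ⟨i, rfl | rfl⟩ : ∃ i, t = 2 * i ∨ t = 2 * i + 1 := ⟨t / 2, by omega⟩ <;>
    simp only [cyc_two_mul, cyc_two_mul_add_one] <;>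
    simp only [List.mem_cons, List.not_mem_nil, or_false] at ha <;>
    rcases ha with rfl | rfl | rfl <;> simp [(hz _).symm, (hg.2.2 _).symm, (hg'.2.2 _).symm]
  · rw [cyc_two_mul]; exact ⟨hg.1, hi⟩
  · rw [cyc_two_mul]; exact ⟨hg'.1, hi'⟩

theorem false_of_mem_edge (h : IsCyc H c x e)
    (hmax : ∀ c', Nonempty (BergeCycle H c') → c' ≤ c) (hc : 2 ≤ c) (hz : ∀ i, x i ≠ z)
    {g : Finset V} (hg : g ∈ H ∧ z ∈ g ∧ ∀ i, e i ≠ g) {i : ℕ} (hze : z ∈ e i)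
    (hi : x i ∈ g ∨ x (i + 1) ∈ g) : False := by
  have hext : ∀ a : V ⊕ Finset V, a = .inr g ∨ a = .inl z → ∀ t, a ≠ cyc x e t := by
    intro a ha t
    obtain ⟨i, rfl | rfl⟩ : ∃ i, t = 2 * i ∨ t = 2 * i + 1 := ⟨t / 2, by omega⟩ <;>
    simp only [cyc_two_mul, cyc_two_mul_add_one] <;>
    rcases ha with rfl | rfl <;> simp [(hz _).symm, (hg.2.2 _).symm]
  rcases hi with hi | hi
  · have := h.detour hmax (D := [.inr g, .inl z]) (i := 2 * i) (j := 2 * i + 1)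
      (a := .inr g) (b := .inl z) ?_ ?_ ?_ (by omega) (by omega) (by simp) (by simp) ?_ ?_
    · simp at this
    · simp [hg]
    · simp
    · intro a ha; exact hext a (by simpa using ha)
    · rw [cyc_two_mul]; exact ⟨hg.1, hi⟩
    · rw [cyc_two_mul_add_one]; exact ⟨h.mem _, hze⟩
  · have := h.detour hmax (D := [.inl z, .inr g]) (i := 2 * i + 1) (j := 2 * (i + 1))
      (a := .inl z) (b := .inr g) ?_ ?_ ?_ (by omega) (by omega) (by simp) (by simp) ?_ ?_
    · simp at this; omega
    · simp [hg]
    · simp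
    · intro a ha; exact hext a (by simpa [or_comm] using ha)
    · rw [cyc_two_mul_add_one]; exact ⟨h.mem _, hze⟩
    · rw [cyc_two_mul]; exact ⟨hg.1, hi⟩

theorem add_one_mod_bij (hc : 0 < c) {j : ℕ} (hj : j < c) : ∃ i < c, (i + 1) % c = j := by
  rcases Nat.eq_zero_or_pos j with rfl | h0
  · exact ⟨c - 1, by omega, by rw [show c - 1 + 1 = c by omega, Nat.mod_self]⟩
  · exact ⟨j - 1, by omega, by rw [show j - 1 + 1 = j by omega, Nat.mod_eq_of_lt hj]⟩

/-- The attachments of an outer vertex `z` to a longest cycle, counted by the gaps they occupy. -/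
theorem attachment_packing (h : IsCyc H c x e)
    (hmax : ∀ c', Nonempty (BergeCycle H c') → c' ≤ c) (hc : 2 ≤ c) (hz : ∀ i, x i ≠ z)
    {F : Finset (Finset V)} (hF : ∀ g ∈ F, g ∈ H ∧ z ∈ g ∧ ∀ i, e i ≠ g)
    {I : Finset ℕ} (hI : I ⊆ Finset.range c) (hIz : ∀ i ∈ I, z ∈ e i)
    {X : Finset ℕ} (hX : X ⊆ Finset.range c)
    (hXF : ∀ i ∈ X, i ∉ I ∧ ∀ g ∈ F, x i ∉ g ∧ x (i + 1) ∉ g) :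
    ∃ F₀ ⊆ F, ∃ A ⊆ Finset.range c,
      (∀ g ∈ F \ F₀, ∀ i, x i ∈ g → i % c ∈ A) ∧
      (∀ j ∈ A, ∃ g ∈ F, x j ∈ g) ∧
      (∀ j ∈ A, (j + 1) % c ∉ A) ∧
      I.card + F₀.card + 2 * A.card + X.card ≤ c ∧
      (c ≤ 2 * A.card + X.card → ∀ i < c, i ∈ A ∨ (i + 1) % c ∈ A ∨ i ∈ X) := by
  set F₀ := F.filter (fun g => ∃ i, i < c ∧ x i ∈ g ∧ x (i + 1) ∈ g) with hF₀
  set A := (Finset.range c).filter (fun j => ∃ g ∈ F \ F₀, x j ∈ g) with hA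
  set B := (Finset.range c).filter (fun i => (i + 1) % c ∈ A) with hB
  have hA' : ∀ {j}, j ∈ A → ∃ g ∈ F, g ∉ F₀ ∧ x j ∈ g := by
    intro j hj
    obtain ⟨-, g, hg, hjg⟩ := Finset.mem_filter.1 hj
    exact ⟨g, (Finset.mem_sdiff.1 hg).1, (Finset.mem_sdiff.1 hg).2, hjg⟩
  have hB' : ∀ {i}, i ∈ B → ∃ g ∈ F, g ∉ F₀ ∧ x (i + 1) ∈ g := by
    intro i hi
    obtain ⟨g, h1, h2, h3⟩ := hA' (Finset.mem_filter.1 hi).2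
    rw [h.x_mod] at h3
    exact ⟨g, h1, h2, h3⟩
  have hslot : ∀ g : Finset V, ∃ i, g ∈ F₀ → i < c ∧ x i ∈ g ∧ x (i + 1) ∈ g := by
    intro g
    by_cases hg : g ∈ F₀
    · obtain ⟨-, i, hi⟩ := Finset.mem_filter.1 hg
      exact ⟨i, fun _ => hi⟩
    · exact ⟨0, fun h => absurd h hg⟩
  choose slot hslot using hslot
  have hFF : F₀ ⊆ F := Finset.filter_subset _ _
  have hAB : Disjoint A B := by
    rw [Finset.disjoint_left]
    intro i hi hi'
    obtain ⟨g, h1, h2, h3⟩ := hA' hi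
    obtain ⟨g', h1', h2', h3'⟩ := hB' hi'
    by_cases hgg : g = g'
    · subst hgg
      exact h2 (Finset.mem_filter.2 ⟨h1, i, Finset.mem_range.1 (Finset.mem_filter.1 hi).1, h3, h3'⟩)
    · exact h.false_of_consecutive hmax hc hz (hF g h1) (hF g' h1') hgg h3 h3'
  have hcardB : A.card ≤ B.card := by
    have : A ⊆ B.image (fun i => (i + 1) % c) := by
      intro j hj
      obtain ⟨i, hi, hij⟩ := add_one_mod_bij (c := c) (by omega)
        (Finset.mem_range.1 (Finset.mem_filter.1 hj).1)
      exact Finset.mem_image.2 ⟨i, Finset.mem_filter.2 ⟨Finset.mem_range.2 hi, hij ▸ hj⟩, hij⟩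
    exact (Finset.card_le_card this).trans Finset.card_image_le
  set S := F₀.image slot with hS
  have hScard : S.card = F₀.card := by
    refine Finset.card_image_of_injOn ?_
    intro g hg g' hg' hs
    by_contra hne
    have h1 := hslot g hg
    have h2 := hslot g' hg'
    rw [← hs] at h2
    exact h.false_of_consecutive hmax hc hz (hF g (hFF hg)) (hF g' (hFF hg')) hne h1.2.1 h2.2.2
  have hS' : ∀ {i}, i ∈ S → ∃ g ∈ F, g ∈ F₀ ∧ i < c ∧ x i ∈ g ∧ x (i + 1) ∈ g := by
    intro i hi
    obtain ⟨g, hg, rfl⟩ := Finset.mem_image.1 hi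
    exact ⟨g, hFF hg, hg, hslot g hg⟩
  have hSA : Disjoint S A := by
    rw [Finset.disjoint_left]
    intro i hi hi'
    obtain ⟨g, h1, h2, -, -, h3⟩ := hS' hi
    obtain ⟨g', h1', h2', h3'⟩ := hA' hi'
    exact h.false_of_consecutive hmax hc hz (hF g' h1') (hF g h1) (by rintro rfl; exact h2' h2)
      h3' h3
  have hSB : Disjoint S B := by
    rw [Finset.disjoint_left]
    intro i hi hi'
    obtain ⟨g, h1, h2, -, h3, -⟩ := hS' hi
    obtain ⟨g', h1', h2', h3'⟩ := hB' hi'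
    exact h.false_of_consecutive hmax hc hz (hF g h1) (hF g' h1') (by rintro rfl; exact h2' h2)
      h3 h3'
  have hIS : Disjoint I (S ∪ A ∪ B ∪ X) := by
    rw [Finset.disjoint_left]
    intro i hi hi'
    simp only [Finset.mem_union] at hi'
    rcases hi' with ((hi' | hi') | hi') | hi'
    · obtain ⟨g, h1, -, -, h3, -⟩ := hS' hi'
      exact h.false_of_mem_edge hmax hc hz (hF g h1) (hIz i hi) (.inl h3)
    · obtain ⟨g, h1, -, h3⟩ := hA' hi'
      exact h.false_of_mem_edge hmax hc hz (hF g h1) (hIz i hi) (.inl h3)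
    · obtain ⟨g, h1, -, h3⟩ := hB' hi'
      exact h.false_of_mem_edge hmax hc hz (hF g h1) (hIz i hi) (.inr h3)
    · exact (hXF i hi').1 hi
  have hXS : Disjoint (S ∪ A ∪ B) X := by
    rw [Finset.disjoint_left]
    intro i hi hi'
    simp only [Finset.mem_union] at hi
    rcases hi with (hi | hi) | hi
    · obtain ⟨g, h1, -, -, h3, -⟩ := hS' hi
      exact ((hXF i hi').2 g h1).1 h3
    · obtain ⟨g, h1, -, h3⟩ := hA' hi
      exact ((hXF i hi').2 g h1).1 h3
    · obtain ⟨g, h1, -, h3⟩ := hB' hi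
      exact ((hXF i hi').2 g h1).2 h3
  have hSub : I ∪ (S ∪ A ∪ B ∪ X) ⊆ Finset.range c := by
    refine Finset.union_subset hI (Finset.union_subset (Finset.union_subset
      (Finset.union_subset ?_ (Finset.filter_subset _ _)) (Finset.filter_subset _ _)) hX)
    intro i hi
    obtain ⟨-, -, -, h3, -⟩ := hS' hi
    exact Finset.mem_range.2 h3
  have hcard := Finset.card_le_card hSub
  rw [Finset.card_union_of_disjoint hIS, Finset.card_union_of_disjoint hXS,
    Finset.card_union_of_disjoint (Finset.disjoint_union_left.2 ⟨hSB, hAB⟩),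
    Finset.card_union_of_disjoint hSA, Finset.card_range] at hcard
  refine ⟨F₀, hFF, A, Finset.filter_subset _ _, ?_, ?_, ?_, by omega, ?_⟩
  · intro g hg i hi
    exact Finset.mem_filter.2 ⟨Finset.mem_range.2 (Nat.mod_lt _ h.pos), g, hg,
      by rwa [h.x_mod]⟩
  · intro j hj
    obtain ⟨g, h1, -, h3⟩ := hA' hj
    exact ⟨g, h1, h3⟩
  · intro j hj hj'
    exact Finset.disjoint_left.1 hAB hj (Finset.mem_filter.2 ⟨(Finset.mem_filter.1 hj).1, hj'⟩)
  · intro hle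
    have h5 : A ∪ B ∪ X = Finset.range c := by
      refine Finset.eq_of_subset_of_card_le (fun i hi => hSub ?_) ?_
      · simp only [Finset.mem_union] at hi ⊢; tauto
      · have hd : Disjoint (A ∪ B) X := by
          rw [Finset.disjoint_left] at hXS ⊢
          intro i hi
          exact hXS (by simp only [Finset.mem_union] at hi ⊢; tauto)
        rw [Finset.card_union_of_disjoint hd, Finset.card_union_of_disjoint hAB, Finset.card_range]
        omega
    intro i hi
    have := h5 ▸ Finset.mem_range.2 hi
    simp only [Finset.mem_union] at this
    rcases this with (h6 | h6) | h6
    · exact .inl h6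
    · exact .inr (.inl (Finset.mem_filter.1 h6).2)
    · exact .inr (.inr h6)

end IsCyc

end Counting

section Numeric

theorem le_choose : ∀ {n m : ℕ}, 1 ≤ m → m + 1 ≤ n → n ≤ n.choose m
  | 0, _, _, h => by omega
  | n + 1, 0, h, _ => by omega
  | n + 1, m + 1, _, h => by
    rw [Nat.choose_succ_succ']
    have h1 : 1 ≤ n.choose m := Nat.choose_pos (by omega)
    rcases Nat.lt_or_ge (m + 1) n with h2 | h2
    · have := le_choose (n := n) (m := m + 1) (by omega) (by omega)
      omega
    · obtain rfl : n = m + 1 := by omega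
      simp

theorem choose_two_le_choose : ∀ {n m : ℕ}, 2 ≤ m → m + 2 ≤ n → n.choose 2 ≤ n.choose m
  | 0, _, _, h => by omega
  | n + 1, m, hm, h => by
    rcases Nat.lt_or_ge (m + 1) n with h2 | h2
    · rcases Nat.eq_or_lt_of_le hm with rfl | h3
      · rfl
      obtain ⟨m, rfl⟩ : ∃ m', m = m' + 1 := ⟨m - 1, by omega⟩
      rw [Nat.choose_succ_succ n m, Nat.choose_succ_succ n 1, Nat.choose_one_right]
      exact Nat.add_le_add (le_choose (by omega) (by omega))
        (choose_two_le_choose (by omega) (by omega))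
    · rw [← Nat.choose_symm (n := n + 1) (k := m) (by omega), show n + 1 - m = 2 by omega]

theorem two_mul_le_choose {s m : ℕ} (hm : 2 ≤ m) (hms : m + 2 ≤ s) (hs : 5 ≤ s) :
    2 * s ≤ s.choose m := by
  refine le_trans ?_ (choose_two_le_choose hm hms)
  rw [Nat.choose_two_right, Nat.le_div_iff_mul_le two_pos, mul_assoc, mul_comm]
  obtain ⟨t, rfl⟩ : ∃ t, s = t + 5 := ⟨s - 5, by omega⟩
  rw [show t + 5 - 1 = t + 4 by omega]
  nlinarith

theorem choose_add_le_choose_of_le {m a d : ℕ} (hm : 2 ≤ m) (ha : m ≤ a) :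
    a.choose m + 2 * d ≤ (a + d).choose m := by
  obtain ⟨m, rfl⟩ : ∃ m', m = m' + 1 := ⟨m - 1, by omega⟩
  induction d with
  | zero => simp
  | succ d ih =>
    rw [← add_assoc, Nat.choose_succ_succ']
    have := le_choose (n := a + d) (m := m) (by omega) (by omega)
    omega

theorem choose_add_le_choose {s m b : ℕ} (hm : 2 ≤ m) (hms : m + 2 ≤ s) (hs : 5 ≤ s)
    (hb : b ≤ s) : b.choose m + 2 * (s - b) ≤ s.choose m := by
  rcases Nat.lt_or_ge b m with h | h
  · rw [Nat.choose_eq_zero_of_lt h]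
    have := two_mul_le_choose hm hms hs
    omega
  · have := choose_add_le_choose_of_le (d := s - b) hm h
    rwa [show b + (s - b) = s by omega] at this

theorem choose_add_lt_choose {s m b : ℕ} (hm : 2 ≤ m) (hms : m + 7 ≤ s) (hb : b + 1 ≤ s) :
    b.choose m + (2 * s + 3 - 2 * b) < s.choose m := by
  obtain ⟨t, rfl⟩ : ∃ t, s = t + 1 := ⟨s - 1, by omega⟩
  have h1 := choose_add_le_choose (s := t) hm (by omega) (by omega) (show b ≤ t by omega)
  obtain ⟨m, rfl⟩ : ∃ m', m = m' + 1 := ⟨m - 1, by omega⟩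
  have h2 := le_choose (n := t) (m := m) (by omega) (by omega)
  rw [Nat.choose_succ_succ']
  omega

end Numeric

section Tails

variable {V : Type*} {H : Finset (Finset V)} {c : ℕ} {x : ℕ → V} {e : ℕ → Finset V}

/-- The hypergraph vertices occurring in a list of elements of the incidence graph. -/
noncomputable def listVerts (L : List (V ⊕ Finset V)) : Finset V :=
  (L.filterMap Sum.getLeft?).toFinset

/-- The hyperedges occurring in a list of elements of the incidence graph. -/
noncomputable def listEdges (L : List (V ⊕ Finset V)) : Finset (Finset V) :=
  (L.filterMap Sum.getRight?).toFinset

@[simp] theorem mem_listVerts {L : List (V ⊕ Finset V)} {v : V} :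
    v ∈ listVerts L ↔ .inl v ∈ L := by
  simp [listVerts]

@[simp] theorem mem_listEdges {L : List (V ⊕ Finset V)} {g : Finset V} :
    g ∈ listEdges L ↔ .inr g ∈ L := by
  simp [listEdges]

theorem length_filterMap_of_chain {z : V} : ∀ {L : List (V ⊕ Finset V)}, L.IsChain (Inc H) →
    L.getLast? = some (.inl z) →
    ((∃ v, L.head? = some (.inl v)) ∧
      L.length + 1 = 2 * (L.filterMap Sum.getLeft?).length ∧
      L.length = 2 * (L.filterMap Sum.getRight?).length + 1) ∨
    ((∃ g, L.head? = some (.inr g)) ∧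
      L.length = 2 * (L.filterMap Sum.getLeft?).length ∧
      L.length = 2 * (L.filterMap Sum.getRight?).length)
  | [], _, h => by simp at h
  | [a], _, h => by
    obtain rfl : a = .inl z := by simpa using h
    simp
  | a :: b :: L, hc, h => by
    have ih := length_filterMap_of_chain (L := b :: L) hc.tail (by simpa using h)
    have hab : Inc H a b := by
      have := List.isChain_cons_cons.1 hc
      exact this.1
    rcases a with a | a <;> rcases b with b | b
    · simp at hab
    · left; simp [List.filterMap_cons] at ih ⊢; omega
    · right; simp [List.filterMap_cons] at ih ⊢; omega
    · simp at hab

theorem card_listVerts_listEdges {z : V} {L : List (V ⊕ Finset V)} (hL : L.IsChain (Inc H))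
    (hz : L.getLast? = some (.inl z)) :
    ∃ p, (listVerts L).card ≤ p ∧
      (((∃ v, L.head? = some (.inl v)) ∧ L.length + 1 = 2 * p ∧ (listEdges L).card + 1 ≤ p) ∨
      ((∃ g, L.head? = some (.inr g)) ∧ L.length = 2 * p ∧ (listEdges L).card ≤ p)) := by
  have h1 : (listVerts L).card ≤ _ := List.toFinset_card_le _
  have h2 : (listEdges L).card ≤ _ := List.toFinset_card_le _
  refine ⟨_, h1, ?_⟩
  rcases length_filterMap_of_chain hL hz with ⟨h3, h4, h5⟩ | ⟨h3, h4, h5⟩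
  · exact .inl ⟨h3, h4, by omega⟩
  · exact .inr ⟨h3, h4, by omega⟩

/-- A path of the incidence graph avoiding the cycle, attached to the cycle element `cyc x e t`
and ending in the vertex `z`. -/
structure IsTail (H : Finset (Finset V)) (x : ℕ → V) (e : ℕ → Finset V)
    (E : List (V ⊕ Finset V)) (t : ℕ) (z : V) : Prop where
  chain : E.IsChain (Inc H)
  nodup : E.Nodup
  ext : ∀ a ∈ E, ∀ t, a ≠ cyc x e t
  att : ∃ a ∈ E.head?, Inc H (cyc x e t) a
  last : E.getLast? = some (.inl z)

namespace IsTail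

variable {E : List (V ⊕ Finset V)} {t : ℕ} {z : V}

theorem last_mem (hE : IsTail H x e E t z) : .inl z ∈ E := List.mem_of_getLast? hE.last

theorem ne_nil (hE : IsTail H x e E t z) : E ≠ [] := List.ne_nil_of_mem hE.last_mem

theorem x_ne (hE : IsTail H x e E t z) (i : ℕ) : x i ≠ z := by
  have := hE.ext _ hE.last_mem (2 * i)
  rw [cyc_two_mul] at this
  exact fun h => this (by rw [h])

/-- Appending a new edge at the end. -/
theorem chain_append (hE : IsTail H x e E t z) {g : Finset V} (hg : g ∈ H ∧ z ∈ g) :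
    (E ++ [Sum.inr g]).IsChain (Inc H) := by
  rw [List.isChain_append]
  refine ⟨hE.chain, by simp, ?_⟩
  intro a ha b hb
  rw [hE.last] at ha
  simp at ha hb
  subst ha hb
  exact hg

theorem nodup_append (hE : IsTail H x e E t z) {g : Finset V} (hg : .inr g ∉ E) :
    (E ++ [Sum.inr g]).Nodup := by
  rw [List.nodup_append]
  refine ⟨hE.nodup, by simp, ?_⟩
  intro a ha b hb
  simp at hb
  subst hb
  rintro rfl
  exact hg ha

theorem ext_append (hE : IsTail H x e E t z) {g : Finset V} (hg : ∀ i, e i ≠ g) :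
    ∀ a ∈ E ++ [Sum.inr g], ∀ t, a ≠ cyc x e t := by
  intro a ha t
  rw [List.mem_append] at ha
  rcases ha with ha | ha
  · exact hE.ext a ha t
  · simp at ha
    subst ha
    obtain ⟨i, rfl | rfl⟩ : ∃ i, t = 2 * i ∨ t = 2 * i + 1 := ⟨t / 2, by omega⟩
    · simp [cyc_two_mul]
    · simp [cyc_two_mul_add_one, (hg i).symm]

theorem head_append (hE : IsTail H x e E t z) (g : Finset V) :
    ∃ a ∈ (E ++ [Sum.inr g]).head?, Inc H (cyc x e t) a := by
  obtain ⟨a, ha, hi⟩ := hE.att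
  exact ⟨a, by rw [List.head?_append, Option.mem_def.1 ha]; rfl, hi⟩

/-- Extending a tail by an edge and a vertex. -/
theorem extend (hE : IsTail H x e E t z) {g : Finset V} (hg : g ∈ H ∧ z ∈ g) (hgE : .inr g ∉ E)
    (hge : ∀ i, e i ≠ g) {u : V} (hu : u ∈ g) (huE : .inl u ∉ E) (hux : ∀ i, x i ≠ u) :
    IsTail H x e (E ++ [.inr g] ++ [.inl u]) t u where
  chain := by
    rw [List.isChain_append]
    refine ⟨hE.chain_append hg, by simp, ?_⟩
    intro a ha b hb
    simp at ha hb
    subst ha hb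
    exact ⟨hg.1, hu⟩
  nodup := by
    rw [List.nodup_append]
    refine ⟨hE.nodup_append hgE, by simp, ?_⟩
    intro a ha b hb
    simp at hb
    subst hb
    rintro rfl
    simp at ha
    exact huE ha
  ext := by
    intro a ha t
    rw [List.mem_append] at ha
    rcases ha with ha | ha
    · exact hE.ext_append hge a ha t
    · simp at ha
      subst ha
      obtain ⟨i, rfl | rfl⟩ : ∃ i, t = 2 * i ∨ t = 2 * i + 1 := ⟨t / 2, by omega⟩
      · simp [cyc_two_mul, (hux i).symm]
      · simp [cyc_two_mul_add_one]
  att := by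
    obtain ⟨a, ha, hi⟩ := hE.head_append g
    exact ⟨a, by rw [List.head?_append, Option.mem_def.1 ha]; rfl, hi⟩
  last := by simp

end IsTail

namespace IsCyc

/-- Two-sided form of the detour inequality. -/
theorem detour_both (h : IsCyc H c x e) (hmax : ∀ c', Nonempty (BergeCycle H c') → c' ≤ c)
    {D : List (V ⊕ Finset V)} (hD : D.IsChain (Inc H)) (hDn : D.Nodup)
    (hext : ∀ a ∈ D, ∀ t, a ≠ cyc x e t) {i j : ℕ} (hij : i < j) (hji : j < i + 2 * c)
    {a b : V ⊕ Finset V} (ha : a ∈ D.head?) (hb : b ∈ D.getLast?)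
    (hia : Inc H (cyc x e i) a) (hbj : Inc H b (cyc x e j)) :
    D.length + 1 ≤ j - i ∧ D.length + 1 ≤ i + 2 * c - j := by
  refine ⟨h.detour hmax hD hDn hext hij hji ha hb hia hbj, ?_⟩
  have := h.detour hmax (D := D.reverse) (isChain_inc_reverse hD) (List.nodup_reverse.2 hDn)
    (fun a ha => hext a (List.mem_reverse.1 ha)) (i := j) (j := i + 2 * c) (a := b) (b := a)
    (by omega) (by omega) (by rwa [List.head?_reverse]) (by rwa [List.getLast?_reverse])
    hbj.symm (by rw [h.cyc_per]; exact hia.symm)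
  simpa using this

end IsCyc

end Tails

/-- A longest cycle of a hypergraph of large minimum degree with no long path. -/
structure LongestCyc {V : Type*} (H : Finset (Finset V)) (r s c : ℕ) (x : ℕ → V)
    (e : ℕ → Finset V) : Prop where
  isCyc : IsCyc H c x e
  max : ∀ c', Nonempty (BergeCycle H c') → c' ≤ c
  unif : ∀ g ∈ H, g.card = r
  deg : ∀ g ∈ H, ∀ v ∈ g, s.choose (r - 1) ≤ hdeg H v
  path : IsEmpty (BergePath H (2 * s + 2))
  r_ge : 3 ≤ r
  s_ge : r + 6 ≤ s
  lo : s + 3 ≤ c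
  lo3 : r = 3 → s + 4 ≤ c
  hi : c ≤ 2 * s

namespace LongestCyc

variable {V : Type*} {H : Finset (Finset V)} {r s c : ℕ} {x : ℕ → V} {e : ℕ → Finset V}
  {E : List (V ⊕ Finset V)} {t : ℕ} {z : V}

theorem shift (h : LongestCyc H r s c x e) (d : ℕ) :
    LongestCyc H r s c (fun i => x (i + d)) (fun i => e (i + d)) :=
  ⟨h.isCyc.shift d, h.max, h.unif, h.deg, h.path, h.r_ge, h.s_ge, h.lo, h.lo3, h.hi⟩

theorem tail_length_le (h : LongestCyc H r s c x e) (hE : IsTail H x e E t z) :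
    2 * c + E.length ≤ 2 * (2 * s + 2) := by
  obtain ⟨a, ha, hi⟩ := hE.att
  exact h.isCyc.two_mul_add_length_le (H₂ := H) (fun _ => id) h.path hE.chain hE.nodup hE.ext ha
    hE.last hi

theorem tail_degree_count (h : LongestCyc H r s c x e) (hE : IsTail H x e E t z)
    (hEmax : ∀ E' t' z', IsTail H x e E' t' z' → E'.length ≤ E.length)
    {I : Finset ℕ} (hI : I ⊆ Finset.range c) (hIz : ∀ i ∈ I, z ∈ e i)
    {J : Finset (Finset V)} (hIJ : ∀ i < c, z ∈ e i → i ∈ I ∨ e i ∈ J)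
    {X : Finset ℕ} (hX : X ⊆ Finset.range c) (hXI : ∀ i ∈ X, i ∉ I)
    (hXF : ∀ i ∈ X, ∀ g ∈ H, z ∈ g → (∀ i, e i ≠ g) → .inr g ∉ E → x i ∉ g ∧ x (i + 1) ∉ g)
    (hdeg : s.choose (r - 1) ≤ hdeg H z) (g' : Finset V) :
    ∃ A ⊆ Finset.range c, ∃ f,
      (∀ j ∈ A, ∃ g ∈ H, z ∈ g ∧ (∀ i, e i ≠ g) ∧ .inr g ∉ E ∧ g ≠ g' ∧ x j ∈ g) ∧
      (∀ j ∈ A, (j + 1) % c ∉ A) ∧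
      I.card + f + 2 * A.card + X.card ≤ c ∧
      (c ≤ 2 * A.card + X.card → ∀ i < c, i ∈ A ∨ (i + 1) % c ∈ A ∨ i ∈ X) ∧
      s.choose (r - 1) ≤ (A.card + ((listVerts E).card - 1)).choose (r - 1) + f + I.card +
        (listEdges E ∪ J).card + 1 := by
  set F := H.filter (fun g => z ∈ g ∧ (∀ i, e i ≠ g) ∧ .inr g ∉ E ∧ g ≠ g') with hF
  have hF' : ∀ g ∈ F, g ∈ H ∧ z ∈ g ∧ (∀ i, e i ≠ g) ∧ .inr g ∉ E ∧ g ≠ g' :=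
    fun g hg => Finset.mem_filter.1 hg
  obtain ⟨F₀, hF₀, A, hA, h1, h2, h3, h4, h5⟩ := h.isCyc.attachment_packing h.max
    (by have := h.lo; have := h.s_ge; omega) hE.x_ne (F := F)
    (fun g hg => ⟨(hF' g hg).1, (hF' g hg).2.1, (hF' g hg).2.2.1⟩) hI hIz hX
    (fun i hi => ⟨hXI i hi, fun g hg =>
      hXF i hi g (hF' g hg).1 (hF' g hg).2.1 (hF' g hg).2.2.1 (hF' g hg).2.2.2.1⟩)
  refine ⟨A, hA, F₀.card, ?_, h3, h4, h5, ?_⟩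
  · intro j hj
    obtain ⟨g, hg, hj⟩ := h2 j hj
    obtain ⟨q1, q2, q3, q4, q5⟩ := hF' g hg
    exact ⟨g, q1, q2, q3, q4, q5, hj⟩
  · have hb : (F \ F₀).card ≤ (A.image x ∪ (listVerts E).erase z).card.choose (r - 1) := by
      refine card_le_choose_of_subset (z := z) ?_
      intro g hg
      obtain ⟨q1, q2, q3, q4, q5⟩ := hF' g (Finset.mem_sdiff.1 hg).1
      refine ⟨h.unif g q1, q2, fun u hu => ?_⟩
      by_contra hcon
      push Not at hcon
      obtain ⟨c1, c2⟩ := hcon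
      rw [Finset.mem_union, not_or, Finset.mem_erase, mem_listVerts] at c2
      have := hEmax _ _ _ (hE.extend ⟨q1, q2⟩ q4 q3 hu (fun hm => c2.2 ⟨c1, hm⟩) ?_)
      · simp at this
      · rintro i rfl
        exact c2.1 (Finset.mem_image.2 ⟨i % c, h1 g hg i hu, h.isCyc.x_mod i⟩)
    have hb2 : (A.image x ∪ (listVerts E).erase z).card ≤ A.card + ((listVerts E).card - 1) := by
      refine (Finset.card_union_le _ _).trans (Nat.add_le_add Finset.card_image_le ?_)
      rw [Finset.card_erase_of_mem (mem_listVerts.2 hE.last_mem)]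
    have hb3 := hb.trans (Nat.choose_le_choose (r - 1) hb2)
    have hsub : H.filter (fun g => z ∈ g) ⊆
        (F \ F₀) ∪ F₀ ∪ I.image e ∪ (listEdges E ∪ J) ∪ {g'} := by
      intro g hg
      obtain ⟨hgH, hgz⟩ := Finset.mem_filter.1 hg
      simp only [Finset.mem_union, Finset.mem_sdiff, Finset.mem_singleton, mem_listEdges,
        Finset.mem_image]
      by_contra hcon
      push Not at hcon
      obtain ⟨⟨⟨⟨c1, c2⟩, c3⟩, c4, c5⟩, c6⟩ := hcon
      refine c2 (c1 (Finset.mem_filter.2 ⟨hgH, hgz, ?_, c4, c6⟩))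
      rintro i rfl
      rcases hIJ (i % c) (Nat.mod_lt _ h.isCyc.pos) (by rwa [h.isCyc.e_mod]) with hi | hi
      · exact c3 _ hi (h.isCyc.e_mod i)
      · exact c5 (by rwa [h.isCyc.e_mod] at hi)
    have hc := Finset.card_le_card hsub
    have u1 := Finset.card_union_le ((F \ F₀) ∪ F₀ ∪ I.image e ∪ (listEdges E ∪ J)) {g'}
    have u2 := Finset.card_union_le ((F \ F₀) ∪ F₀ ∪ I.image e) (listEdges E ∪ J)
    have u3 := Finset.card_union_le ((F \ F₀) ∪ F₀) (I.image e)
    have u4 := Finset.card_union_le (F \ F₀) F₀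
    have u5 : (I.image e).card ≤ I.card := Finset.card_image_le
    rw [Finset.card_singleton] at u1
    unfold _root_.hdeg at hdeg
    omega

theorem deg_of_inl_mem (h : LongestCyc H r s c x e) (hE : IsTail H x e E t z) :
    s.choose (r - 1) ≤ hdeg H z := by
  rcases Nat.lt_or_ge 1 E.length with h1 | h1
  · have hlast := hE.last
    rw [List.getLast?_eq_getElem?, List.getElem?_eq_getElem (by omega)] at hlast
    have := List.isChain_iff_getElem.1 hE.chain (E.length - 2) (by omega)
    have heq : E[E.length - 2 + 1]'(by omega) = .inl z := by
      rw [← Option.some_inj, ← hlast]; congr 2; omega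
    rw [heq] at this
    rcases h3 : E[E.length - 2]'(by omega) with u | f
    · rw [h3] at this; simp at this
    · rw [h3] at this; exact h.deg f this.1 z this.2
  · obtain ⟨a, ha, hi⟩ := hE.att
    have : E.length = 1 := by
      have := List.length_pos_iff.2 hE.ne_nil
      omega
    obtain ⟨b, rfl⟩ := List.length_eq_one_iff.1 this
    have := hE.last
    simp at this ha
    subst this; subst ha
    rcases h3 : cyc x e t with u | f
    · rw [h3] at hi; simp at hi
    · rw [h3] at hi; exact h.deg f hi.1 z hi.2

/-- No longest tail with at least two vertices is attached at a cycle edge. -/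
theorem false_of_tail_edge (h : LongestCyc H r s c x e) (hE : IsTail H x e E 1 z)
    (hEmax : ∀ E' t' z', IsTail H x e E' t' z' → E'.length ≤ E.length)
    (hlen : 3 ≤ E.length) : False := by
  obtain ⟨a, ha, hi⟩ := hE.att
  have hcy1 : cyc x e 1 = .inr (e 0) := cyc_two_mul_add_one 0
  obtain ⟨p, hp, hp2⟩ := card_listVerts_listEdges hE.chain hE.last
  obtain ⟨-, hp2, hp3⟩ : (∃ v, E.head? = some (.inl v)) ∧ E.length + 1 = 2 * p ∧
      (listEdges E).card + 1 ≤ p := by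
    refine hp2.resolve_right ?_
    rintro ⟨⟨g, hg⟩, -⟩
    rw [hg] at ha
    simp at ha
    subst ha
    rw [hcy1] at hi
    simp at hi
  have htl := h.tail_length_le hE
  have hs := h.s_ge
  have hlo := h.lo
  have hhi := h.hi
  have hr := h.r_ge
  have touch : ∀ j, 1 ≤ j → j ≤ c → ∀ g ∈ H, z ∈ g → (∀ i, e i ≠ g) → .inr g ∉ E → x j ∈ g →
      p + 1 ≤ j ∧ j ≤ c - p := by
    intro j hj1 hj2 g hg hz hge hgE hxj
    obtain ⟨a, ha, hi⟩ := hE.head_append g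
    have := h.isCyc.detour_both h.max (hE.chain_append ⟨hg, hz⟩) (hE.nodup_append hgE)
      (hE.ext_append hge) (i := 1) (j := 2 * j) (a := a) (b := .inr g) (by omega) (by omega) ha
      (by simp) hi (by rw [cyc_two_mul]; exact ⟨hg, hxj⟩)
    simp only [List.length_append, List.length_singleton] at this
    omega
  have touchE : ∀ i, 1 ≤ i → i < c → z ∈ e i → p ≤ i ∧ i ≤ c - p := by
    intro i hi1 hi2 hz
    have := h.isCyc.detour_both h.max hE.chain hE.nodup hE.ext (i := 1) (j := 2 * i + 1)
      (a := a) (b := .inl z) (by omega) (by omega) ha hE.last hi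
      (by rw [cyc_two_mul_add_one]; exact ⟨h.isCyc.mem _, hz⟩)
    omega
  obtain ⟨A, -, f, -, -, h4, -, h5⟩ := h.tail_degree_count hE hEmax
    (I := (Finset.Ico 1 c).filter (fun i => z ∈ e i)) (J := {e 0})
    (X := (Finset.range c).filter (fun i => i < p ∨ c < i + p))
    (fun i hi => by simp at hi ⊢; omega) (fun i hi => by simp at hi; exact hi.2)
    (fun i hi hz => by
      rcases Nat.eq_zero_or_pos i with rfl | h0
      · right; simp
      · left; simp [hz]; omega) (Finset.filter_subset _ _)
    (fun i hi hi' => by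
      simp at hi hi'
      have := touchE i (by omega) (by omega) hi'.2
      omega)
    (fun i hi g hg hz hge hgE => by
      simp at hi
      constructor
      · intro hx
        rcases Nat.eq_zero_or_pos i with rfl | h0
        · have := touch c (by omega) le_rfl g hg hz hge hgE
            (by rw [← h.isCyc.x_mod, Nat.mod_self]; exact hx)
          omega
        · have := touch i (by omega) (by omega) g hg hz hge hgE hx
          omega
      · intro hx
        have := touch (i + 1) (by omega) (by omega) g hg hz hge hgE hx
        omega) (h.deg_of_inl_mem hE) ∅
  have h6 : (listEdges E ∪ {e 0}).card ≤ p :=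
    (Finset.card_union_le _ _).trans (by simpa using hp3)
  have h7 := Nat.choose_le_choose (r - 1)
    (show A.card + ((listVerts E).card - 1) ≤ A.card + (p - 1) by omega)
  rcases Nat.lt_or_ge (c + 1) (2 * p) with hcase | hcase
  · have hX : c ≤ ((Finset.range c).filter (fun i => i < p ∨ c < i + p)).card := by
      rw [Finset.filter_true_of_mem (fun i hi => by omega), Finset.card_range]
    have h9 := choose_add_le_choose (s := s - 2) (m := r - 1) (b := p - 1)
      (by omega) (by omega) (by omega) (by omega)
    have h11 := Nat.choose_succ_succ' (s - 1) (r - 2)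
    have h12 := Nat.choose_succ_succ' (s - 2) (r - 2)
    rw [show s - 1 + 1 = s by omega, show r - 2 + 1 = r - 1 by omega] at h11
    rw [show s - 2 + 1 = s - 1 by omega, show r - 2 + 1 = r - 1 by omega] at h12
    have h13 := le_choose (n := s - 1) (m := r - 2) (by omega) (by omega)
    have h14 := le_choose (n := s - 2) (m := r - 2) (by omega) (by omega)
    have hA : A.card = 0 := by omega
    simp only [hA, zero_add] at h5 h7
    omega
  · have hX : 2 * p - 1 ≤ ((Finset.range c).filter (fun i => i < p ∨ c < i + p)).card := by
      have hsub : Finset.range p ∪ Finset.Ico (c - p + 1) c ⊆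
          (Finset.range c).filter (fun i => i < p ∨ c < i + p) := by
        intro i hi; simp at hi ⊢; omega
      have := Finset.card_le_card hsub
      rw [Finset.card_union_of_disjoint (by
        rw [Finset.disjoint_left]; intro i hi hi'; simp at hi hi'; omega)] at this
      simp at this
      omega
    have := choose_add_lt_choose (s := s) (m := r - 1) (b := A.card + (p - 1))
      (by omega) (by omega) (by omega)
    omega

/-- A longest tail with at least two vertices, attached at the cycle vertex `x 0`, has exactly two
vertices, and its end is joined to `x 0`, `x 3` and `x 5` by several edges. -/
theorem tail_vertex (h : LongestCyc H r s c x e) (hE : IsTail H x e E 0 z)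
    (hEmax : ∀ E' t' z', IsTail H x e E' t' z' → E'.length ≤ E.length)
    (hlen : 3 ≤ E.length) :
    E.length = 4 ∧ ∀ g', ∀ j, j = 0 ∨ j = 3 ∨ j = 5 →
      ∃ g ∈ H, z ∈ g ∧ (∀ i, e i ≠ g) ∧ .inr g ∉ E ∧ g ≠ g' ∧ x j ∈ g := by
  obtain ⟨a, ha, hi⟩ := hE.att
  have hcy0 : cyc x e 0 = .inl (x 0) := cyc_two_mul 0
  obtain ⟨p, hp, hp2⟩ := card_listVerts_listEdges hE.chain hE.last
  obtain ⟨-, hp2, hp3⟩ : (∃ g, E.head? = some (.inr g)) ∧ E.length = 2 * p ∧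
      (listEdges E).card ≤ p := by
    refine hp2.resolve_left ?_
    rintro ⟨⟨g, hg⟩, -⟩
    rw [hg] at ha
    simp at ha
    subst ha
    rw [hcy0] at hi
    simp at hi
  have htl := h.tail_length_le hE
  have hs := h.s_ge
  have hlo := h.lo
  have hlo3 := h.lo3
  have hhi := h.hi
  have hr := h.r_ge
  have touch : ∀ j, 1 ≤ j → j < c → ∀ g ∈ H, z ∈ g → (∀ i, e i ≠ g) → .inr g ∉ E → x j ∈ g →
      p + 1 ≤ j ∧ j + p + 1 ≤ c := by
    intro j hj1 hj2 g hg hz hge hgE hxj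
    obtain ⟨a, ha, hi⟩ := hE.head_append g
    have := h.isCyc.detour_both h.max (hE.chain_append ⟨hg, hz⟩) (hE.nodup_append hgE)
      (hE.ext_append hge) (i := 0) (j := 2 * j) (a := a) (b := .inr g) (by omega) (by omega) ha
      (by simp) hi (by rw [cyc_two_mul]; exact ⟨hg, hxj⟩)
    simp only [List.length_append, List.length_singleton] at this
    omega
  have touchE : ∀ i, i < c → z ∈ e i → p ≤ i ∧ i + p + 1 ≤ c := by
    intro i hi2 hz
    have := h.isCyc.detour_both h.max hE.chain hE.nodup hE.ext (i := 0) (j := 2 * i + 1)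
      (a := a) (b := .inl z) (by omega) (by omega) ha hE.last hi
      (by rw [cyc_two_mul_add_one]; exact ⟨h.isCyc.mem _, hz⟩)
    omega
  have count := fun g' => h.tail_degree_count hE hEmax
    (I := (Finset.range c).filter (fun i => z ∈ e i)) (J := ∅)
    (X := (Finset.Ico 1 (c - 1)).filter (fun i => i < p ∨ c ≤ i + p))
    (Finset.filter_subset _ _) (fun i hi => by simp at hi; exact hi.2)
    (fun i hi hz => by left; simp [hz, hi])
    (fun i hi => by simp at hi ⊢; omega)
    (fun i hi hi' => by
      simp at hi hi'
      have := touchE i (by omega) hi'.2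
      omega)
    (fun i hi g hg hz hge hgE => by
      simp at hi
      constructor
      · intro hx
        have := touch i (by omega) (by omega) g hg hz hge hgE hx
        omega
      · intro hx
        have := touch (i + 1) (by omega) (by omega) g hg hz hge hgE hx
        omega) (h.deg_of_inl_mem hE) g'
  simp only [Finset.union_empty] at count
  have main : ∀ g', E.length = 4 ∧ ∀ j, j = 0 ∨ j = 3 ∨ j = 5 →
      ∃ g ∈ H, z ∈ g ∧ (∀ i, e i ≠ g) ∧ .inr g ∉ E ∧ g ≠ g' ∧ x j ∈ g := by
    intro g'
    obtain ⟨A, hA, f, h1, h3, h4, h6, h5⟩ := count g'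
    have h7 := Nat.choose_le_choose (r - 1)
      (show A.card + ((listVerts E).card - 1) ≤ A.card + (p - 1) by omega)
    rcases Nat.lt_or_ge c (2 * p) with hcase | hcase
    · exfalso
      have hX : c - 2 ≤ ((Finset.Ico 1 (c - 1)).filter (fun i => i < p ∨ c ≤ i + p)).card := by
        rw [Finset.filter_true_of_mem (fun i hi => by omega), Nat.card_Ico]
        omega
      have h11 := Nat.choose_succ_succ' (s - 1) (r - 2)
      have h12 := Nat.choose_succ_succ' (s - 2) (r - 2)
      rw [show s - 1 + 1 = s by omega, show r - 2 + 1 = r - 1 by omega] at h11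
      rw [show s - 2 + 1 = s - 1 by omega, show r - 2 + 1 = r - 1 by omega] at h12
      have h13 := le_choose (n := s - 1) (m := r - 2) (by omega) (by omega)
      have h14 := le_choose (n := s - 2) (m := r - 2) (by omega) (by omega)
      rcases (show A.card = 0 ∨ A.card = 1 by omega) with hA | hA
      · have h9 := choose_add_le_choose (s := s - 2) (m := r - 1) (b := p - 1)
          (by omega) (by omega) (by omega) (by omega)
        simp only [hA, zero_add] at h5 h7
        omega
      · simp only [hA] at h5 h7
        rw [show 1 + (p - 1) = p by omega] at h7
        rcases Nat.eq_or_lt_of_le hr with h3 | h3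
        · have h9 := choose_add_le_choose (s := s - 2) (m := r - 1) (b := p)
            (by omega) (by omega) (by omega) (by omega)
          omega
        · have h9 := choose_add_le_choose (s := s - 1) (m := r - 1) (b := p)
            (by omega) (by omega) (by omega) (by omega)
          have h15 := two_mul_le_choose (s := s - 1) (m := r - 2) (by omega) (by omega) (by omega)
          omega
    · have hX : 2 * p - 2 ≤
          ((Finset.Ico 1 (c - 1)).filter (fun i => i < p ∨ c ≤ i + p)).card := by
        have hsub : Finset.Ico 1 p ∪ Finset.Ico (c - p) (c - 1) ⊆
            (Finset.Ico 1 (c - 1)).filter (fun i => i < p ∨ c ≤ i + p) := by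
          intro i hi; simp at hi ⊢; omega
        have := Finset.card_le_card hsub
        rw [Finset.card_union_of_disjoint (by
          rw [Finset.disjoint_left]; intro i hi hi'; simp at hi hi'; omega)] at this
        simp at this
        omega
      have hb : s ≤ A.card + (p - 1) := by
        by_contra hb
        have := choose_add_lt_choose (s := s) (m := r - 1) (b := A.card + (p - 1))
          (by omega) (by omega) (by omega)
        omega
      refine ⟨by omega, fun j hj => h1 j ?_⟩
      have hA' : ∀ j ∈ A, j = 0 ∨ 3 ≤ j := by
        intro j hj
        obtain ⟨g, q1, q2, q3, q4, -, q5⟩ := h1 j hj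
        rcases Nat.eq_zero_or_pos j with h0 | h0
        · exact .inl h0
        · have := touch j h0 (Finset.mem_range.1 (hA hj)) g q1 q2 q3 q4 q5
          omega
      have hcov := h6 (by omega)
      have c0 : 0 ∈ A := by
        rcases hcov 0 (by omega) with h8 | h8 | h8
        · exact h8
        · rw [Nat.mod_eq_of_lt (by omega)] at h8
          have := hA' _ h8
          omega
        · simp at h8
      have c3 : 3 ∈ A := by
        rcases hcov 2 (by omega) with h8 | h8 | h8
        · have := hA' _ h8
          omega
        · rwa [Nat.mod_eq_of_lt (by omega)] at h8
        · simp at h8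
          omega
      have c5 : 5 ∈ A := by
        rcases hcov 4 (by omega) with h8 | h8 | h8
        · have := h3 3 c3
          rw [Nat.mod_eq_of_lt (by omega)] at this
          exact absurd h8 this
        · rwa [Nat.mod_eq_of_lt (by omega)] at h8
        · simp at h8
          omega
      rcases hj with rfl | rfl | rfl
      · exact c0
      · exact c3
      · exact c5
  exact ⟨(main ∅).1, fun g' => (main g').2⟩

end LongestCyc

namespace LongestCyc

variable {V : Type*} {H : Finset (Finset V)} {r s c : ℕ} {x : ℕ → V} {e : ℕ → Finset V}
  {E : List (V ⊕ Finset V)} {t : ℕ} {z : V}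

theorem cyc_shift (d t : ℕ) :
    cyc (fun i => x (i + d)) (fun i => e (i + d)) t = cyc x e (t + 2 * d) := by
  obtain ⟨i, rfl | rfl⟩ : ∃ i, t = 2 * i ∨ t = 2 * i + 1 := ⟨t / 2, by omega⟩
  · rw [show 2 * i + 2 * d = 2 * (i + d) by omega, cyc_two_mul, cyc_two_mul]
  · rw [show 2 * i + 1 + 2 * d = 2 * (i + d) + 1 by omega, cyc_two_mul_add_one,
      cyc_two_mul_add_one]

theorem isTail_shift (h : LongestCyc H r s c x e) (d : ℕ) :
    IsTail H (fun i => x (i + d)) (fun i => e (i + d)) E t z ↔ IsTail H x e E (t + 2 * d) z := by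
  have hper : ∀ m t, cyc x e (t + 2 * (c * m)) = cyc x e t := by
    intro m
    induction m with
    | zero => simp
    | succ m ih =>
      intro t
      rw [show t + 2 * (c * (m + 1)) = t + 2 * (c * m) + 2 * c by ring, h.isCyc.cyc_per, ih]
  have hd : d ≤ c * d := Nat.le_mul_of_pos_left d h.isCyc.pos
  constructor
  · rintro ⟨h1, h2, h3, h4, h5⟩
    refine ⟨h1, h2, fun a ha u => ?_, by simpa only [cyc_shift] using h4, h5⟩
    have := h3 a ha (u + 2 * (c * d - d))
    rw [cyc_shift, show u + 2 * (c * d - d) + 2 * d = u + 2 * (c * d) by omega, hper] at this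
    exact this
  · rintro ⟨h1, h2, h3, h4, h5⟩
    exact ⟨h1, h2, fun a ha u => by rw [cyc_shift]; exact h3 a ha _,
      by simpa only [cyc_shift] using h4, h5⟩

theorem false_of_tail_vertex (h : LongestCyc H r s c x e) (hE : IsTail H x e E 0 z)
    (hEmax : ∀ E' t' z', IsTail H x e E' t' z' → E'.length ≤ E.length)
    (hlen : 3 ≤ E.length) : False := by
  obtain ⟨h4, hg⟩ := h.tail_vertex hE hEmax hlen
  have hcy0 : cyc x e 0 = .inl (x 0) := cyc_two_mul 0
  obtain ⟨a, b, f, d, rfl⟩ : ∃ a b f d, E = [a, b, f, d] := by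
    match E, h4 with
    | [a, b, f, d], _ => exact ⟨a, b, f, d, rfl⟩
  obtain rfl : d = .inl z := by simpa using hE.last
  have hch := hE.chain
  simp only [List.isChain_cons_cons] at hch
  obtain ⟨a', ha', hatt⟩ := hE.att
  obtain rfl : a = a' := by simpa using ha'
  rw [hcy0] at hatt
  rcases f with u | f
  · simp at hch
  rcases b with y | b
  swap
  · simp at hch
  rcases a with u | f₀
  · simp at hatt
  simp at hch hatt
  obtain ⟨g₀, q1, q2, q3, q4, -, q5⟩ := hg ∅ 0 (by simp)
  have hyz : y ≠ z := by
    have := hE.nodup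
    simp at this
    tauto
  simp at q4
  have hext := hE.ext
  have hE2 : IsTail H x e [.inr g₀, .inl z, .inr f, .inl y] 0 y := by
    refine ⟨by simp; tauto, by simp; exact ⟨fun h => q4.2 h, hyz.symm⟩, ?_, ?_, by simp⟩
    · intro a ha t
      simp at ha
      rcases ha with rfl | rfl | rfl | rfl
      · obtain ⟨i, rfl | rfl⟩ : ∃ i, t = 2 * i ∨ t = 2 * i + 1 := ⟨t / 2, by omega⟩
        · simp [cyc_two_mul]
        · simp [cyc_two_mul_add_one, (q3 i).symm]
      all_goals exact hext _ (by simp) t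
    · exact ⟨.inr g₀, by simp, by rw [hcy0]; exact ⟨q1, q5⟩⟩
  obtain ⟨-, hg2⟩ := h.tail_vertex hE2 (fun E' t' z' hE' => (hEmax E' t' z' hE').trans (by simp))
    (by simp)
  obtain ⟨g₁, a1, a2, a3, a4, -, a5⟩ := hg2 ∅ 3 (by simp)
  obtain ⟨g₂, b1, b2, b3, b4, b5, b6⟩ := hg g₁ 5 (by simp)
  simp at a4 b4
  have := h.isCyc.detour h.max (D := [.inr g₁, .inl y, .inr f, .inl z, .inr g₂])
    (i := 2 * 3) (j := 2 * 5) (a := .inr g₁) (b := .inr g₂) (by simp; tauto)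
    (by
      simp
      exact ⟨⟨fun h => a4.2 h, fun h => b5 h.symm⟩, hyz, fun h => b4.2 h.symm⟩)
    (by
      intro a ha t
      simp at ha
      rcases ha with rfl | rfl | rfl | rfl | rfl
      · obtain ⟨i, rfl | rfl⟩ : ∃ i, t = 2 * i ∨ t = 2 * i + 1 := ⟨t / 2, by omega⟩
        · simp [cyc_two_mul]
        · simp [cyc_two_mul_add_one, (a3 i).symm]
      · exact hext _ (by simp) t
      · exact hext _ (by simp) t
      · exact hext _ (by simp) t
      · obtain ⟨i, rfl | rfl⟩ : ∃ i, t = 2 * i ∨ t = 2 * i + 1 := ⟨t / 2, by omega⟩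
        · simp [cyc_two_mul]
        · simp [cyc_two_mul_add_one, (b3 i).symm])
    (by omega) (by have := h.lo; have := h.s_ge; omega) (by simp) (by simp)
    (by rw [cyc_two_mul]; exact ⟨a1, a5⟩) (by rw [cyc_two_mul]; exact ⟨b1, b6⟩)
  simp at this

/-- Every tail has only one vertex. -/
theorem tail_length_le_two (h : LongestCyc H r s c x e) (hE : IsTail H x e E t z) :
    E.length ≤ 2 := by
  by_contra hcon
  push Not at hcon
  let P : ℕ → Prop := fun n => ∃ E t z, IsTail H x e E t z ∧ E.length = n
  have hP : P E.length := ⟨E, t, z, hE, rfl⟩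
  have hle : ∀ n, P n → n ≤ 4 * s + 4 := by
    rintro n ⟨E, t, z, hE, rfl⟩
    have := h.tail_length_le hE
    omega
  obtain ⟨E', t', z', hE', hlen⟩ := Nat.findGreatest_spec (P := P) (hle _ hP) hP
  have hmax : ∀ E'' t'' z'', IsTail H x e E'' t'' z'' → E''.length ≤ E'.length := by
    intro E'' t'' z'' hE''
    rw [hlen]
    exact Nat.le_findGreatest (hle _ ⟨_, _, _, hE'', rfl⟩) ⟨_, _, _, hE'', rfl⟩
  have h3 : 3 ≤ E'.length := Nat.lt_of_lt_of_le hcon (hmax _ _ _ hE)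
  obtain ⟨i, rfl | rfl⟩ : ∃ i, t' = 2 * i ∨ t' = 2 * i + 1 := ⟨t' / 2, by omega⟩
  · exact (h.shift i).false_of_tail_vertex ((h.isTail_shift i).2 (by simpa using hE'))
      (fun E'' t'' z'' hE'' => hmax _ _ _ ((h.isTail_shift i).1 hE'')) h3
  · exact (h.shift i).false_of_tail_edge
      ((h.isTail_shift i).2 (by simpa [Nat.add_comm] using hE'))
      (fun E'' t'' z'' hE'' => hmax _ _ _ ((h.isTail_shift i).1 hE'')) h3

end LongestCyc

/-- The edges at `w` are all sets consisting of `w` and `r - 1` vertices of `K`, where `K` is one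
of the two alternating classes of the cycle. -/
structure IsKernel {V : Type*} (H : Finset (Finset V)) (r s c : ℕ) (x : ℕ → V)
    (e : ℕ → Finset V) (w : V) (K : Finset V) : Prop where
  length_eq : c = 2 * s
  card_eq : K.card = s
  alt : ∀ i, x i ∈ K ↔ x (i + 1) ∉ K
  sub : ∀ v ∈ K, ∃ i, x i = v
  not_mem : ∀ i, w ∉ e i
  edge_iff : ∀ g, g ∈ H ∧ w ∈ g ↔ ∃ B ⊆ K, B.card = r - 1 ∧ g = insert w B

namespace LongestCyc

variable {V : Type*} {H : Finset (Finset V)} {r s c : ℕ} {x : ℕ → V} {e : ℕ → Finset V}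
  {E : List (V ⊕ Finset V)} {t : ℕ} {w : V} {K : Finset V}

theorem isTail_of_edge (hw : ∀ i, x i ≠ w) {g : Finset V} (hg : g ∈ H) (hwg : w ∈ g)
    (hge : ∀ i, e i ≠ g) {i : ℕ} (hi : x i ∈ g) :
    IsTail H x e [.inr g, .inl w] (2 * i) w := by
  refine ⟨by simp [hg, hwg], by simp, ?_, ⟨.inr g, by simp, by
    rw [cyc_two_mul]; exact ⟨hg, hi⟩⟩, by simp⟩
  intro a ha t
  obtain ⟨i, rfl | rfl⟩ : ∃ i, t = 2 * i ∨ t = 2 * i + 1 := ⟨t / 2, by omega⟩ <;>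
  simp only [cyc_two_mul, cyc_two_mul_add_one] <;>
  simp only [List.mem_cons, List.not_mem_nil, or_false] at ha <;>
  rcases ha with rfl | rfl <;> simp [(hw _).symm, (hge _).symm]

theorem isTail_of_cycle_edge (h : LongestCyc H r s c x e) (hw : ∀ i, x i ≠ w) {i : ℕ}
    (hi : w ∈ e i) : IsTail H x e [.inl w] (2 * i + 1) w := by
  refine ⟨by simp, by simp, ?_, ⟨.inl w, by simp, by
    rw [cyc_two_mul_add_one]; exact ⟨h.isCyc.mem i, hi⟩⟩, by simp⟩
  intro a ha t
  obtain ⟨i, rfl | rfl⟩ : ∃ i, t = 2 * i ∨ t = 2 * i + 1 := ⟨t / 2, by omega⟩ <;>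
  simp only [cyc_two_mul, cyc_two_mul_add_one] <;>
  simp only [List.mem_cons, List.not_mem_nil, or_false] at ha <;>
  subst ha <;> simp [(hw _).symm]

theorem edge_sub_of_tail (h : LongestCyc H r s c x e) (hE : IsTail H x e E t w) {g : Finset V}
    (hg : g ∈ H) (hwg : w ∈ g) (hge : ∀ i, e i ≠ g) : ∀ u ∈ g, u = w ∨ ∃ i, x i = u := by
  have key : ∀ E t, IsTail H x e E t w → ∀ g ∈ H, w ∈ g → (∀ i, e i ≠ g) → .inr g ∉ E →
      ∀ u ∈ g, u = w ∨ ∃ i, x i = u := by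
    intro E t hE g hg hwg hge hgE u hu
    by_contra hcon
    push Not at hcon
    by_cases huE : .inl u ∈ E
    · have h1 := h.tail_length_le_two hE
      have h2 : E.length ≠ 1 := by
        intro h1
        obtain ⟨b, rfl⟩ := List.length_eq_one_iff.1 h1
        have h3 := hE.last
        simp at h3 huE
        subst h3
        simp at huE
        exact hcon.1 huE
      have h2 : E.length = 2 := by
        have := List.length_pos_iff.2 hE.ne_nil
        omega
      obtain ⟨a, b, rfl⟩ := List.length_eq_two.1 h2
      have h3 := hE.last
      have h4 := hE.chain
      simp at h3
      subst h3
      simp [hcon.1] at huE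
      subst huE
      simp at h4
    · have := h.tail_length_le_two (hE.extend ⟨hg, hwg⟩ hgE hge hu huE hcon.2)
      have h5 := List.length_pos_iff.2 hE.ne_nil
      simp only [List.length_append, List.length_singleton] at this
      omega
  intro u hu
  by_cases hgE : .inr g ∈ E
  swap
  · exact key E t hE g hg hwg hge hgE u hu
  have hr := h.r_ge
  have hs := h.s_ge
  have hdeg : 1 < (H.filter (fun g => w ∈ g)).card := by
    have h1 := h.deg g hg w hwg
    unfold hdeg at h1
    have := le_choose (n := s) (m := r - 1) (by omega) (by omega)
    omega
  obtain ⟨g₁, hg₁, hne⟩ := Finset.exists_mem_ne hdeg g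
  obtain ⟨hg₁, hwg₁⟩ := Finset.mem_filter.1 hg₁
  by_cases hcy : ∃ i, e i = g₁
  · obtain ⟨i, rfl⟩ := hcy
    exact key _ _ (h.isTail_of_cycle_edge hE.x_ne hwg₁) g hg hwg hge (by simp) u hu
  push Not at hcy
  have h1 : 1 < g₁.card := by rw [h.unif g₁ hg₁]; omega
  obtain ⟨v, hv, hvw⟩ := Finset.exists_mem_ne h1 w
  have hg₁E : .inr g₁ ∉ E := by
    intro hmem
    have h1 := h.tail_length_le_two hE
    have h3 := hE.last_mem
    have h5 : ({Sum.inr g, Sum.inr g₁, Sum.inl w} : Finset (V ⊕ Finset V)) ⊆ E.toFinset := by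
      intro a ha
      simp at ha
      rcases ha with rfl | rfl | rfl <;> simpa
    have h6 := (Finset.card_le_card h5).trans (List.toFinset_card_le _)
    rw [Finset.card_insert_of_notMem (by simp [hne.symm]),
      Finset.card_insert_of_notMem (by simp), Finset.card_singleton] at h6
    omega
  obtain ⟨i, rfl⟩ := (key E t hE g₁ hg₁ hwg₁ hcy hg₁E v hv).resolve_left hvw
  exact key _ _ (isTail_of_edge hE.x_ne hg₁ hwg₁ hcy hv) g hg hwg hge (by simp [hne.symm]) u hu

theorem exists_isKernel (h : LongestCyc H r s c x e) (hE : IsTail H x e E t w) :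
    ∃ K, IsKernel H r s c x e w K := by
  have hr := h.r_ge
  have hs := h.s_ge
  have hlo := h.lo
  have hhi := h.hi
  set F := H.filter (fun g => w ∈ g ∧ ∀ i, e i ≠ g) with hF
  have hF' : ∀ g ∈ F, g ∈ H ∧ w ∈ g ∧ (∀ i, e i ≠ g) := fun g hg => Finset.mem_filter.1 hg
  set I := (Finset.range c).filter (fun i => w ∈ e i) with hI
  obtain ⟨F₀, hF₀, A, hA, h1, h2, h3, h4, h5⟩ := h.isCyc.attachment_packing h.max
    (by omega) hE.x_ne (F := F) hF' (I := I) (Finset.filter_subset _ _)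
    (fun i hi => (Finset.mem_filter.1 hi).2) (X := ∅) (by simp) (by simp)
  have hFA : ∀ g ∈ F \ F₀, g.card = r ∧ w ∈ g ∧ ∀ u ∈ g, u = w ∨ u ∈ A.image x := by
    intro g hg
    obtain ⟨q1, q2, q3⟩ := hF' g (Finset.mem_sdiff.1 hg).1
    refine ⟨h.unif g q1, q2, fun u hu => ?_⟩
    refine (h.edge_sub_of_tail hE q1 q2 q3 u hu).imp_right ?_
    rintro ⟨i, rfl⟩
    exact Finset.mem_image.2 ⟨i % c, h1 g hg i hu, h.isCyc.x_mod i⟩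
  have hAcard : (A.image x).card = A.card := by
    refine Finset.card_image_of_injOn fun i hi j hj hij => ?_
    exact h.isCyc.x_inj i j (Finset.mem_range.1 (hA hi)) (Finset.mem_range.1 (hA hj)) hij
  have hb := card_le_choose_of_subset hFA
  rw [hAcard] at hb
  have hsub : H.filter (fun g => w ∈ g) ⊆ (F \ F₀) ∪ F₀ ∪ I.image e := by
    intro g hg
    obtain ⟨hgH, hgz⟩ := Finset.mem_filter.1 hg
    simp only [Finset.mem_union, Finset.mem_sdiff, Finset.mem_image]
    by_contra hcon
    push Not at hcon
    obtain ⟨⟨c1, c2⟩, c3⟩ := hcon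
    refine c2 (c1 (Finset.mem_filter.2 ⟨hgH, hgz, ?_⟩))
    rintro i rfl
    exact c3 (i % c) (Finset.mem_filter.2 ⟨Finset.mem_range.2 (Nat.mod_lt _ h.isCyc.pos),
      by rwa [h.isCyc.e_mod]⟩) (h.isCyc.e_mod i)
  have hdeg := h.deg_of_inl_mem hE
  have hc := Finset.card_le_card hsub
  have u3 := Finset.card_union_le ((F \ F₀) ∪ F₀) (I.image e)
  have u4 := Finset.card_union_le (F \ F₀) F₀
  have u5 : (I.image e).card ≤ I.card := Finset.card_image_le
  unfold _root_.hdeg at hdeg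
  have hAs : s ≤ A.card := by
    by_contra hb
    have := choose_add_lt_choose (s := s) (m := r - 1) (b := A.card)
      (by omega) (by omega) (by omega)
    omega
  have hAs' : A.card = s := by omega
  have hI0 : I = ∅ := Finset.card_eq_zero.1 (by omega)
  have hF₀0 : F₀ = ∅ := Finset.card_eq_zero.1 (by omega)
  have hnot : ∀ i, w ∉ e i := by
    intro i hi
    have : i % c ∈ I := Finset.mem_filter.2 ⟨Finset.mem_range.2 (Nat.mod_lt _ h.isCyc.pos),
      by rwa [h.isCyc.e_mod]⟩
    rw [hI0] at this
    simp at this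
  have hmemA : ∀ i, x i ∈ A.image x ↔ i % c ∈ A := by
    intro i
    rw [Finset.mem_image]
    constructor
    · rintro ⟨j, hj, hji⟩
      rw [h.isCyc.x_eq_iff, Nat.mod_eq_of_lt (Finset.mem_range.1 (hA hj))] at hji
      exact hji ▸ hj
    · exact fun hi => ⟨i % c, hi, h.isCyc.x_mod i⟩
  rw [hF₀0, Finset.sdiff_empty] at hFA
  have hwA : w ∉ A.image x := by
    intro hw
    obtain ⟨i, -, hi⟩ := Finset.mem_image.1 hw
    exact hE.x_ne i hi
  have himg : F.image (fun g => g.erase w) = (A.image x).powersetCard (r - 1) := by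
    refine Finset.eq_of_subset_of_card_le ?_ ?_
    · intro B hB
      obtain ⟨g, hg, rfl⟩ := Finset.mem_image.1 hB
      obtain ⟨q1, q2, q3⟩ := hFA g hg
      refine Finset.mem_powersetCard.2 ⟨fun u hu => ?_, by rw [Finset.card_erase_of_mem q2, q1]⟩
      obtain ⟨a1, a2⟩ := Finset.mem_erase.1 hu
      exact (q3 u a2).resolve_left a1
    · rw [Finset.card_powersetCard, hAcard, hAs', Finset.card_image_of_injOn]
      · have : (F \ F₀).card = F.card := by rw [hF₀0, Finset.sdiff_empty]
        omega
      · intro g hg g' hg' hgg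
        have h' : g.erase w = g'.erase w := hgg
        rw [← Finset.insert_erase (hFA g hg).2.1, ← Finset.insert_erase (hFA g' hg').2.1, h']
  refine ⟨A.image x, by omega, by omega, fun i => ?_, fun v hv => ?_, hnot, fun g => ?_⟩
  · rw [hmemA, hmemA]
    have hsucc : (i % c + 1) % c = (i + 1) % c := by rw [Nat.mod_add_mod]
    constructor
    · intro hi
      have := h3 _ hi
      rwa [hsucc] at this
    · intro hi
      rcases h5 (by simp; omega) (i % c) (Nat.mod_lt _ h.isCyc.pos) with h6 | h6 | h6
      · exact h6
      · rw [hsucc] at h6; exact absurd h6 hi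
      · simp at h6
  · obtain ⟨i, -, hi⟩ := Finset.mem_image.1 hv
    exact ⟨i, hi⟩
  · constructor
    · rintro ⟨hg, hwg⟩
      have hgF : g ∈ F := Finset.mem_filter.2 ⟨hg, hwg, by rintro i rfl; exact hnot i hwg⟩
      have := himg ▸ Finset.mem_image_of_mem (fun g : Finset V => g.erase w) hgF
      obtain ⟨q1, q2⟩ := Finset.mem_powersetCard.1 this
      exact ⟨g.erase w, q1, q2, (Finset.insert_erase hwg).symm⟩
    · rintro ⟨B, hB, hBc, rfl⟩
      have := himg ▸ Finset.mem_powersetCard.2 ⟨hB, hBc⟩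
      obtain ⟨g, hg, rfl⟩ := Finset.mem_image.1 this
      rw [Finset.insert_erase (hFA g hg).2.1]
      exact ⟨(hF' g hg).1, (hF' g hg).2.1⟩

theorem isKernel_shift (hK : IsKernel H r s c x e w K) (d : ℕ) (h : LongestCyc H r s c x e) :
    IsKernel H r s c (fun i => x (i + d)) (fun i => e (i + d)) w K where
  length_eq := hK.length_eq
  card_eq := hK.card_eq
  alt i := by
    rw [hK.alt, show i + 1 + d = i + d + 1 by omega]
  sub v hv := by
    obtain ⟨i, hi⟩ := hK.sub v hv
    have hd : d ≤ c * d := Nat.le_mul_of_pos_left d h.isCyc.pos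
    refine ⟨i + (c * d - d), ?_⟩
    rw [← hi, h.isCyc.x_eq_iff, show i + (c * d - d) + d = i + c * d by omega,
      Nat.add_mul_mod_self_left]
  not_mem i := hK.not_mem _
  edge_iff := hK.edge_iff

/-- Replacing a cycle vertex outside the kernel by `w` yields a cycle. -/
theorem isCyc_swap (h : LongestCyc H r s c x e) (hw : ∀ i, x i ≠ w)
    (hnot : ∀ i, w ∉ e i) {g g' : Finset V} (hg : g ∈ H) (hg' : g' ∈ H) (hwg : w ∈ g)
    (hwg' : w ∈ g') (hne : g ≠ g') (hxg : x (c - 1) ∈ g) (hxg' : x 1 ∈ g') :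
    IsCyc H c (fun i => if i % c = 0 then w else x i)
      (fun i => if i % c = 0 then g' else if i % c = c - 1 then g else e i) := by
  have hc : 3 ≤ c := by have := h.lo; have := h.s_ge; omega
  have h1 : ∀ i, e i ≠ g := by rintro i rfl; exact hnot i hwg
  have h2 : ∀ i, e i ≠ g' := by rintro i rfl; exact hnot i hwg'
  refine ⟨h.isCyc.pos, fun i => ?_, fun i => ?_, fun i j hi hj => ?_, fun i j hi hj => ?_,
    fun i => ?_, fun i => ?_, fun i => ?_⟩
  · simp only [Nat.add_mod_right, h.isCyc.x_per]
  · simp only [Nat.add_mod_right, h.isCyc.e_per]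
  · simp only [Nat.mod_eq_of_lt hi, Nat.mod_eq_of_lt hj]
    split_ifs with a b b
    · omega
    · exact fun h => absurd h.symm (hw j)
    · exact fun h => absurd h (hw i)
    · exact h.isCyc.x_inj i j hi hj
  · simp only [Nat.mod_eq_of_lt hi, Nat.mod_eq_of_lt hj]
    have := h.isCyc.e_inj i j hi hj
    have h1' := fun i => (h1 i).symm
    have h2' := fun i => (h2 i).symm
    split_ifs <;> first | omega | simp [hne, hne.symm, h1, h2, h1', h2']
  · split_ifs
    · exact hg'
    · exact hg
    · exact h.isCyc.mem i
  · split_ifs with a b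
    · exact hwg'
    · rwa [← h.isCyc.x_mod i, b]
    · exact h.isCyc.fst i
  · have hsucc : (i + 1) % c = (i % c + 1) % c := by rw [Nat.mod_add_mod]
    have hlt := Nat.mod_lt i h.isCyc.pos
    by_cases a : i % c = 0
    · have h3 : (i + 1) % c = 1 := by rw [hsucc, a, Nat.mod_eq_of_lt (by omega)]
      rw [if_pos a, if_neg (by omega), ← h.isCyc.x_mod, h3]
      exact hxg'
    by_cases b : i % c = c - 1
    · have h3 : (i + 1) % c = 0 := by
        rw [hsucc, b, show c - 1 + 1 = c by omega, Nat.mod_self]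
      rw [if_pos h3, if_neg a, if_pos b]
      exact hwg
    · have h3 : (i + 1) % c = i % c + 1 := by rw [hsucc, Nat.mod_eq_of_lt (by omega)]
      rw [if_neg a, if_neg b, if_neg (by omega)]
      exact h.isCyc.snd i

theorem edge_sub_of_swap_zero (h : LongestCyc H r s c x e) (hw : ∀ i, x i ≠ w)
    (hK : IsKernel H r s c x e w K) (h0 : x 0 ∉ K) {g : Finset V} (hg : g ∈ H) (hxg : x 0 ∈ g) :
    ∀ u ∈ g, u = x 0 ∨ u ∈ K := by
  have hr := h.r_ge
  have hs := h.s_ge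
  have hlo := h.lo
  have hx1 : x 1 ∈ K := by
    by_contra h1
    exact h0 ((hK.alt 0).2 h1)
  have hxc : x (c - 1) ∈ K := by
    rw [hK.alt, show c - 1 + 1 = 0 + c by omega, h.isCyc.x_per]
    exact h0
  have hne : x (c - 1) ≠ x 1 := by
    intro heq
    have := h.isCyc.x_inj _ _ (by omega) (by omega) heq
    omega
  have hKc := hK.card_eq
  have hwK : w ∉ K := fun hm => by
    obtain ⟨i, hi⟩ := hK.sub w hm
    exact hw i hi
  obtain ⟨B, hB1, hB2, hB3⟩ := Finset.exists_subsuperset_card_eq (s := {x (c - 1)})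
    (t := K.erase (x 1)) (n := r - 1) (by simp [hne, hxc]) (by simp; omega)
    (by rw [Finset.card_erase_of_mem hx1]; omega)
  obtain ⟨B', hB1', hB2', hB3'⟩ := Finset.exists_subsuperset_card_eq (s := {x 1})
    (t := K) (n := r - 1) (by simp [hx1]) (by simp; omega) (by omega)
  have hg1 := (hK.edge_iff _).2 ⟨B, hB2.trans (Finset.erase_subset _ _), hB3, rfl⟩
  have hg2 := (hK.edge_iff _).2 ⟨B', hB2', hB3', rfl⟩
  have hx1w := hw 1
  have hgne : insert w B ≠ insert w B' := by
    intro heq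
    have : x 1 ∈ insert w B := by rw [heq]; simp at hB1' ⊢; exact .inr hB1'
    rcases Finset.mem_insert.1 this with h3 | h3
    · exact hw 1 h3
    · have := hB2 h3
      simp at this
  have hcyc := h.isCyc_swap hw hK.not_mem hg1.1 hg2.1 hg1.2 hg2.2 hgne
    (by simp at hB1 ⊢; exact .inr hB1) (by simp at hB1' ⊢; exact .inr hB1')
  have hL : LongestCyc H r s c _ _ := ⟨hcyc, h.max, h.unif, h.deg, h.path, h.r_ge, h.s_ge, h.lo,
    h.lo3, h.hi⟩
  have hx0 : ∀ i, (if i % c = 0 then w else x i) ≠ x 0 := by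
    intro i
    split_ifs with a
    · exact (hw 0).symm
    · intro heq
      rw [h.isCyc.x_eq_iff] at heq
      simp [a] at heq
  have htail := isTail_of_edge (H := H) (w := x 0) hx0 (h.isCyc.mem 0) (h.isCyc.fst 0)
    (e := fun i => if i % c = 0 then insert w B' else if i % c = c - 1 then insert w B else e i)
    (by
      intro i heq
      split_ifs at heq with a b
      · exact hK.not_mem 0 (heq ▸ hg2.2)
      · exact hK.not_mem 0 (heq ▸ hg1.2)
      · rw [h.isCyc.e_eq_iff] at heq
        simp [a] at heq)
    (i := 1) (by rw [if_neg (by rw [Nat.mod_eq_of_lt (by omega)]; omega)]; exact h.isCyc.snd 0)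
  obtain ⟨K', hK'⟩ := hL.exists_isKernel htail
  have hwK' : w ∉ K' := by
    intro hw'
    obtain ⟨C, hC1, hC2, hC3⟩ := Finset.exists_subsuperset_card_eq (s := {w})
      (t := K') (n := r - 1) (by simp [hw']) (by simp; omega) (by rw [hK'.card_eq]; omega)
    have hg3 := (hK'.edge_iff _).2 ⟨C, hC2, hC3, rfl⟩
    obtain ⟨B₀, hB₀, -, heq⟩ := (hK.edge_iff _).1 ⟨hg3.1,
      Finset.mem_insert_of_mem (by simpa using hC1)⟩
    have : x 0 ∈ insert w B₀ := heq ▸ hg3.2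
    rcases Finset.mem_insert.1 this with h3 | h3
    · exact hw 0 h3
    · exact h0 (hB₀ h3)
  have halt := hK'.alt
  have hsame : ∀ i, i + 1 < c → (x (i + 1) ∈ K' ↔ x (i + 1) ∈ K) := by
    intro i
    induction i with
    | zero =>
      intro _
      have := halt 0
      simp only [Nat.zero_mod, if_true, zero_add] at this
      rw [if_neg (by rw [Nat.mod_eq_of_lt (by omega)]; omega)] at this
      simp only [zero_add, hx1, iff_true]
      by_contra h4
      exact hwK' (this.2 h4)
    | succ i ih =>
      intro hi
      have := halt (i + 1)
      rw [if_neg (by rw [Nat.mod_eq_of_lt (by omega)]; omega),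
        if_neg (by rw [Nat.mod_eq_of_lt (by omega)]; omega)] at this
      have h5 := hK.alt (i + 1)
      have h6 := ih (by omega)
      tauto
  obtain ⟨B₀, hB₀, -, rfl⟩ := (hK'.edge_iff _).1 ⟨hg, hxg⟩
  intro u hu
  refine (Finset.mem_insert.1 hu).imp_right fun hu => ?_
  have huK := hB₀ hu
  obtain ⟨i, hi⟩ := hK'.sub u huK
  split_ifs at hi with a
  · exact absurd (hi ▸ huK) hwK'
  · rw [← h.isCyc.x_mod] at hi
    have hlt := Nat.mod_lt i h.isCyc.pos
    obtain ⟨j, hj⟩ : ∃ j, i % c = j + 1 := ⟨i % c - 1, by omega⟩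
    rw [hj] at hi
    rw [← hi] at huK ⊢
    exact (hsame j (by omega)).1 huK

theorem edge_sub_of_cycle (h : LongestCyc H r s c x e) (hw : ∀ i, x i ≠ w)
    (hK : IsKernel H r s c x e w K) {j : ℕ} (hj : x j ∉ K) {g : Finset V} (hg : g ∈ H)
    (hxg : x j ∈ g) : ∀ u ∈ g, u = x j ∨ u ∈ K := by
  have := (h.shift j).edge_sub_of_swap_zero (fun i => hw _) (isKernel_shift hK j h)
    (by simpa using hj) hg (by simpa using hxg)
  simpa using this

theorem edge_sub_of_not_mem (h : LongestCyc H r s c x e) (hw : ∀ i, x i ≠ w)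
    (hK : IsKernel H r s c x e w K)
    (hatt : ∀ g ∈ H, ∀ v ∈ g, (∃ i, x i = v) ∨ ∃ E t, IsTail H x e E t v)
    {g : Finset V} (hg : g ∈ H) {v : V} (hv : v ∈ g) (hvK : v ∉ K) : ∀ u ∈ g, u = v ∨ u ∈ K := by
  rcases hatt g hg v hv with ⟨i, rfl⟩ | ⟨E, t, hE⟩
  · exact h.edge_sub_of_cycle hw hK hvK hg hv
  have hr := h.r_ge
  have hs := h.s_ge
  obtain ⟨K', hK'⟩ := h.exists_isKernel hE
  have hsub : K' ⊆ K := by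
    intro y hy
    by_contra hyK
    obtain ⟨i, rfl⟩ := hK'.sub y hy
    obtain ⟨C, hC1, hC2, hC3⟩ := Finset.exists_subsuperset_card_eq (s := {x i})
      (t := K') (n := r - 1) (by simp [hy]) (by simp; omega) (by rw [hK'.card_eq]; omega)
    have hg3 := (hK'.edge_iff _).2 ⟨C, hC2, hC3, rfl⟩
    rcases h.edge_sub_of_cycle hw hK hyK hg3.1 (Finset.mem_insert_of_mem (by simpa using hC1)) v
      hg3.2 with h1 | h1
    · exact hE.x_ne i h1.symm
    · exact hvK h1
  obtain ⟨B₀, hB₀, -, rfl⟩ := (hK'.edge_iff _).1 ⟨hg, hv⟩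
  intro u hu
  exact (Finset.mem_insert.1 hu).imp_right fun hu => hsub (hB₀ hu)

/-- If every vertex outside the cycle is attached to it, there is no path with
`2 * s + 2` vertices. -/
theorem isEmpty_bergePath (h : LongestCyc H r s c x e) (hw : ∀ i, x i ≠ w)
    (hK : IsKernel H r s c x e w K)
    (hatt : ∀ g ∈ H, ∀ v ∈ g, (∃ i, x i = v) ∨ ∃ E t, IsTail H x e E t v) :
    IsEmpty (BergePath H (2 * s + 1)) := by
  refine ⟨fun P => ?_⟩
  have hpick : ∀ i : Fin (s + 1), ∃ j : Fin (2 * s + 1 + 1), j.val / 2 = i.val ∧ P.verts j ∈ K := by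
    intro i
    let a : Fin (2 * s + 1) := ⟨2 * i, by omega⟩
    by_cases h1 : P.verts a.castSucc ∈ K
    · exact ⟨a.castSucc, by simp [a], h1⟩
    · refine ⟨a.succ, by simp [a]; omega, ?_⟩
      refine (h.edge_sub_of_not_mem hw hK hatt (P.edges_mem a) (P.fst_mem a) h1 _
        (P.snd_mem a)).resolve_left fun heq => ?_
      have := P.verts_inj heq
      simp [Fin.ext_iff] at this
  choose f hf hfK using hpick
  have hinj : Function.Injective (fun i => P.verts (f i)) := by
    intro i j hij
    have h1 := hf i
    rw [P.verts_inj hij, hf j] at h1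
    exact Fin.ext h1.symm
  have := Finset.card_le_card_of_injOn (s := Finset.univ) (t := K) (fun i => P.verts (f i))
    (fun i _ => hfK i) hinj.injOn
  rw [hK.card_eq] at this
  simp at this

end LongestCyc

section Reach

variable {V : Type*} {H G : Finset (Finset V)} {r s c : ℕ} {x : ℕ → V} {e : ℕ → Finset V}

theorem reflTransGen_of_bergeReachable {u v : V} (h : BergeReachable H u v) :
    Relation.ReflTransGen (Inc H) (.inl u) (.inl v) := by
  obtain ⟨t, P, rfl, rfl⟩ := h
  have : ∀ i : Fin (t + 1),
      Relation.ReflTransGen (Inc H) (.inl (P.verts 0)) (.inl (P.verts i)) := by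
    intro i
    induction i using Fin.induction with
    | zero => exact .refl
    | succ i ih =>
      have h1 : Inc H (.inl (P.verts i.castSucc)) (.inr (P.edges i)) :=
        ⟨P.edges_mem i, P.fst_mem i⟩
      have h2 : Inc H (.inr (P.edges i)) (.inl (P.verts i.succ)) := ⟨P.edges_mem i, P.snd_mem i⟩
      exact (ih.tail h1).tail h2
  exact this _

theorem choose_add_lt_choose_of_two_le {m n : ℕ} (hm : 2 ≤ m) (hn : m + 2 ≤ n) :
    (n - 2).choose m + (2 * n - 4) < n.choose m := by
  obtain ⟨m, rfl⟩ : ∃ m', m = m' + 1 := ⟨m - 1, by omega⟩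
  obtain ⟨n, rfl⟩ : ∃ n', n = n' + 2 := ⟨n - 2, by omega⟩
  have h1 : (n + 2).choose (m + 1) = (n + 1).choose m + (n + 1).choose (m + 1) :=
    Nat.choose_succ_succ' _ _
  have h2 : (n + 1).choose (m + 1) = n.choose m + n.choose (m + 1) := Nat.choose_succ_succ' _ _
  have h3 := le_choose (m := m) (n := n) (by omega) (by omega)
  have h4 := le_choose (m := m) (n := n + 1) (by omega) (by omega)
  simp only [Nat.add_sub_cancel]
  omega

/-- A list leading from the cycle to an edge that meets `K`, and avoiding both the cycle and `K`. -/
theorem exists_list_to_of_reflTransGen {K : Set V} (heK : ∀ i, ∀ u ∈ e i, u ∉ K)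
    {b : V ⊕ Finset V} (h : Relation.ReflTransGen (Inc H) (.inl (x 0)) b) :
    (∃ t, b = cyc x e t) ∨
    (∃ (E : List (V ⊕ Finset V)) (t : ℕ), E.IsChain (Inc H) ∧ E.Nodup ∧
      (∀ a ∈ E, ∀ t, a ≠ cyc x e t) ∧
      (∃ a ∈ E.head?, Inc H (cyc x e t) a) ∧ E.getLast? = some b ∧ ∀ v, .inl v ∈ E → v ∉ K) ∨
    ∃ w ∈ K, ∃ g ∈ H, w ∈ g ∧
    (∃ (E : List (V ⊕ Finset V)) (t : ℕ), E.IsChain (Inc H) ∧ E.Nodup ∧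
      (∀ a ∈ E, ∀ t, a ≠ cyc x e t) ∧
      (∃ a ∈ E.head?, Inc H (cyc x e t) a) ∧ E.getLast? = some (.inr g) ∧
      ∀ v, .inl v ∈ E → v ∉ K) := by
  induction h with
  | refl => exact .inl ⟨0, by simp [cyc]⟩
  | @tail a b hab hb ih =>
    by_cases hbc : ∃ t, b = cyc x e t
    · exact .inl hbc
    push Not at hbc
    right
    rcases ih with ⟨t, rfl⟩ | ⟨E, t, h1, h2, h3, h4, h5, h6⟩ | h
    · left
      refine ⟨[b], t, by simp, by simp, by simpa using hbc, ⟨b, by simp, hb⟩, by simp, ?_⟩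
      intro v hv
      simp only [List.mem_singleton] at hv
      subst hv
      obtain ⟨i, rfl | rfl⟩ : ∃ i, t = 2 * i ∨ t = 2 * i + 1 := ⟨t / 2, by omega⟩
      · rw [cyc_two_mul] at hb; simp at hb
      · rw [cyc_two_mul_add_one] at hb; exact heK i v hb.2
    · by_cases hbE : b ∈ E
      · left
        obtain ⟨E₁, E₂, rfl⟩ := List.append_of_mem hbE
        have hsplit : E₁ ++ b :: E₂ = (E₁ ++ [b]) ++ E₂ := by simp
        rw [hsplit] at h1 h2 h3 h4 h6
        refine ⟨E₁ ++ [b], t, h1.left_of_append, h2.of_append_left,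
          fun a ha => h3 a (List.mem_append_left _ ha), ?_, by simp,
          fun v hv => h6 v (List.mem_append_left _ hv)⟩
        rwa [List.head?_append_of_ne_nil _ (by simp)] at h4
      · have hE : ∀ hbK : (∀ v, b = .inl v → v ∉ K),
            (∃ (E : List (V ⊕ Finset V)) (t : ℕ), E.IsChain (Inc H) ∧ E.Nodup ∧
            (∀ a ∈ E, ∀ t, a ≠ cyc x e t) ∧ (∃ a ∈ E.head?, Inc H (cyc x e t) a) ∧
            E.getLast? = some b ∧ ∀ v, .inl v ∈ E → v ∉ K) := by
          intro hbK
          refine ⟨E ++ [b], t, ?_, ?_, ?_, ?_, by simp, ?_⟩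
          · rw [List.isChain_append]
            refine ⟨h1, by simp, ?_⟩
            intro y hy z hz
            rw [h5] at hy
            simp only [Option.mem_def, Option.some.injEq, List.head?_cons] at hy hz
            subst hy hz
            exact hb
          · rw [List.nodup_append]
            exact ⟨h2, by simp, fun y hy z hz => by
              rw [List.mem_singleton] at hz; rintro rfl; exact hbE (hz ▸ hy)⟩
          · intro y hy
            rw [List.mem_append, List.mem_singleton] at hy
            rcases hy with hy | rfl
            · exact h3 y hy
            · exact hbc
          · obtain ⟨y, hy, hi⟩ := h4
            exact ⟨y, by rw [List.head?_append, Option.mem_def.1 hy]; rfl, hi⟩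
          · intro v hv
            rw [List.mem_append, List.mem_singleton] at hv
            rcases hv with hv | hv
            · exact h6 v hv
            · exact hbK v hv.symm
        rcases b with w | g
        · by_cases hwK : w ∈ K
          · right
            rcases a with u | g
            · simp at hb
            · exact ⟨w, hwK, g, hb.1, hb.2, E, t, h1, h2, h3, h4, h5, h6⟩
          · exact .inl (hE (by rintro v ⟨⟩; exact hwK))
        · exact .inl (hE (by simp))
    · exact .inr h

/-- The vertices of a chain starting in a closed set stay in that set. -/
theorem chain_in_closed {K : Set V} (hcl : ∀ g ∈ G, ∀ v ∈ g, v ∈ K → ∀ u ∈ g, u ∈ K) :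
    ∀ {L : List (V ⊕ Finset V)} {a : V ⊕ Finset V}, (a :: L).IsChain (Inc G) →
    (Sum.elim (· ∈ K) (fun g => g ∈ G ∧ ∀ u ∈ g, u ∈ K) a) →
    ∀ b ∈ a :: L, Sum.elim (· ∈ K) (fun g => g ∈ G ∧ ∀ u ∈ g, u ∈ K) b
  | [], a, _, ha, b, hb => by simp at hb; exact hb ▸ ha
  | a' :: L, a, h, ha, b, hb => by
    rw [List.isChain_cons_cons] at h
    rcases List.mem_cons.1 hb with rfl | hb
    · exact ha
    refine chain_in_closed hcl h.2 ?_ b hb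
    rcases a with a | a <;> rcases a' with a' | a' <;> simp_all
    exact hcl a' h.1.1 a h.1.2 ha

end Reach

namespace LongestCyc

variable {V : Type*} {H G : Finset (Finset V)} {r s c : ℕ} {x : ℕ → V} {e : ℕ → Finset V}

theorem false_of_closed (h : LongestCyc G r s c x e) (hs : G ⊆ H) (hconn : HConnected H)
    (hk : IsEmpty (BergePath H (2 * s + 2))) {K : Set V} {w : V} (hw : w ∈ K)
    (hdeg : ∀ v ∈ K, s.choose (r - 1) ≤ hdeg G v)
    (hcl : ∀ g ∈ G, ∀ v ∈ g, v ∈ K → ∀ u ∈ g, u ∈ K) (hK : ∀ i, x i ∉ K) : False := by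
  have heK : ∀ i, ∀ u ∈ e i, u ∉ K := fun i u hu huK =>
    hK i (hcl _ (h.isCyc.mem i) u hu huK _ (h.isCyc.fst i))
  have hreach := reflTransGen_of_bergeReachable (hconn (x 0) w (by rintro rfl; exact hK 0 hw))
  have : ∃ w ∈ K, ∃ g ∈ H, w ∈ g ∧
    (∃ (E : List (V ⊕ Finset V)) (t : ℕ), E.IsChain (Inc H) ∧ E.Nodup ∧
      (∀ a ∈ E, ∀ t, a ≠ cyc x e t) ∧
      (∃ a ∈ E.head?, Inc H (cyc x e t) a) ∧ E.getLast? = some (.inr g) ∧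
      ∀ v, .inl v ∈ E → v ∉ K) := by
    rcases exists_list_to_of_reflTransGen heK hreach with ⟨t, ht⟩ | ⟨E, t, -, -, -, -, h5, h6⟩ | h
    · exfalso
      obtain ⟨i, rfl | rfl⟩ : ∃ i, t = 2 * i ∨ t = 2 * i + 1 := ⟨t / 2, by omega⟩
      · rw [cyc_two_mul] at ht; exact hK i (by cases ht; exact hw)
      · rw [cyc_two_mul_add_one] at ht; cases ht
    · exact absurd hw (h6 w (List.mem_of_getLast? h5))
    · exact h
  clear hreach hw w
  obtain ⟨w, hw, g₀, hg₀, hwg₀, E, t, h1, h2, h3, ⟨a, ha, hai⟩, h5, h6⟩ := this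
  -- a longest path of `G` starting at `w`
  have hbound : ∀ n, (∃ (L : List (V ⊕ Finset V)) (z : V), L.length = n ∧
      L.IsChain (Inc G) ∧ L.Nodup ∧ L.head? = some (.inl w) ∧ L.getLast? = some (.inl z)) →
      n ≤ 2 * (2 * s + 2) := by
    rintro n ⟨L, z, rfl, hL, hLn, -, hz⟩
    exact length_le_of_isEmpty_bergePath hL hLn hz h.path
  obtain ⟨n, ⟨⟨Q, z, hQlen, hQ, hQn, hQw, hQz⟩, hQmax⟩⟩ : ∃ n,
      (∃ (L : List (V ⊕ Finset V)) (z : V), L.length = n ∧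
      L.IsChain (Inc G) ∧ L.Nodup ∧ L.head? = some (.inl w) ∧ L.getLast? = some (.inl z)) ∧
      ∀ n', (∃ (L : List (V ⊕ Finset V)) (z : V), L.length = n' ∧ L.IsChain (Inc G) ∧ L.Nodup ∧
        L.head? = some (.inl w) ∧ L.getLast? = some (.inl z)) → n' ≤ n :=
    ⟨_, Nat.findGreatest_spec (P := fun n => ∃ (L : List (V ⊕ Finset V)) (z : V), L.length = n ∧
      L.IsChain (Inc G) ∧ L.Nodup ∧ L.head? = some (.inl w) ∧ L.getLast? = some (.inl z))
      (hbound _ ⟨[.inl w], w, rfl, by simp, by simp, by simp, by simp⟩)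
      ⟨[.inl w], w, rfl, by simp, by simp, by simp, by simp⟩,
      fun n' hn' => Nat.le_findGreatest (hbound n' hn') hn'⟩
  have hQK : ∀ b ∈ Q, Sum.elim (· ∈ K) (fun g => g ∈ G ∧ ∀ u ∈ g, u ∈ K) b := by
    rcases Q with _ | ⟨q, Q⟩
    · simp
    · simp only [List.head?_cons, Option.some.injEq] at hQw
      subst hQw
      exact chain_in_closed hcl hQ hw
  have hzK : z ∈ K := hQK _ (List.mem_of_getLast? hQz)
  -- every further edge at the end of the path lies inside the path
  have hend : ∀ g ∈ G, z ∈ g → .inr g ∉ Q → ∀ u ∈ g, .inl u ∈ Q := by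
    intro g hg hzg hgQ u hu
    by_contra huQ
    have := hQmax (Q ++ [Sum.inr g, Sum.inl u]).length ⟨_, u, rfl, ?_, ?_, ?_, by simp⟩
    · simp at this; omega
    · rw [List.isChain_append]
      refine ⟨hQ, by simp [hg, hu], ?_⟩
      intro y hy b hb
      rw [hQz] at hy
      simp only [Option.mem_def, Option.some.injEq, List.head?_cons] at hy hb
      subst hy hb
      exact ⟨hg, hzg⟩
    · rw [List.nodup_append]
      refine ⟨hQn, by simp, ?_⟩
      intro y hy b hb
      simp only [List.mem_cons, List.not_mem_nil, or_false] at hb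
      rintro rfl
      rcases hb with rfl | rfl
      · exact hgQ hy
      · exact huQ hy
    · rw [List.head?_append, hQw]; rfl
  have hr := h.r_ge
  have hsg := h.s_ge
  have hlo := h.lo
  obtain ⟨q, hq, ⟨-, hq2, hq3⟩ | ⟨⟨g, hg⟩, -⟩⟩ := card_listVerts_listEdges hQ hQz
  swap
  · rw [hQw] at hg; simp at hg
  have hz_mem : z ∈ listVerts Q := by simpa using List.mem_of_getLast? hQz
  have hcount : s.choose (r - 1) ≤ (q - 1).choose (r - 1) + (q - 1) := by
    refine (hdeg z hzK).trans ?_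
    have hsub : G.filter (fun g => z ∈ g) ⊆
        G.filter (fun g => z ∈ g ∧ .inr g ∉ Q) ∪ listEdges Q := by
      intro g hg
      rw [Finset.mem_filter] at hg
      by_cases hgQ : .inr g ∈ Q <;> simp [hg, hgQ]
    refine (Finset.card_le_card hsub).trans ((Finset.card_union_le _ _).trans ?_)
    refine Nat.add_le_add ?_ (by omega)
    refine (card_le_choose_of_subset (z := z) (X := (listVerts Q).erase z) (r := r) ?_).trans ?_
    · intro g hg
      rw [Finset.mem_filter] at hg
      refine ⟨h.unif g hg.1, hg.2.1, fun u hu => ?_⟩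
      have := hend g hg.1 hg.2.1 hg.2.2 u hu
      by_cases huz : u = z <;> simp [huz, this]
    · rw [Finset.card_erase_of_mem hz_mem]
      exact Nat.choose_le_choose _ (by omega)
  have hqs : s ≤ q := by
    by_contra hlt
    have h7 := choose_add_lt_choose_of_two_le (m := r - 1) (n := s) (by omega) (by omega)
    have h8 : (q - 1).choose (r - 1) ≤ (s - 2).choose (r - 1) := Nat.choose_le_choose _ (by omega)
    omega
  have hElen : 0 < E.length := List.length_pos_of_mem (List.mem_of_getLast? h5)
  -- no edge of the leading list can be an edge of `G` inside `K`
  have hedge : ∀ g, .inr g ∈ E → g ∈ G → ¬ ∀ u ∈ g, u ∈ K := by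
    intro g hgE hgG hgK
    obtain ⟨E₁, E₂, rfl⟩ := List.append_of_mem hgE
    rcases List.eq_nil_or_concat E₁ with rfl | ⟨E₁, y, rfl⟩
    · simp only [List.nil_append, List.head?_cons, Option.mem_def, Option.some.injEq] at ha
      subst ha
      obtain ⟨i, rfl | rfl⟩ : ∃ i, t = 2 * i ∨ t = 2 * i + 1 := ⟨t / 2, by omega⟩
      · rw [cyc_two_mul] at hai; exact hK i (hgK _ hai.2)
      · rw [cyc_two_mul_add_one] at hai; simp at hai
    · have hy : Inc H y (.inr g) := by
        rw [List.isChain_append] at h1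
        exact h1.2.2 y (by simp) _ (by simp)
      rcases y with y | y
      · exact h6 y (by simp) (hgK y hy.2)
      · simp at hy
  have := h.isCyc.two_mul_add_length_le hs hk (D := E ++ Q) (i := t) (a := a) (z := z)
    (by
      rw [List.isChain_append]
      refine ⟨h1, hQ.imp fun _ _ => Inc.mono hs, ?_⟩
      intro y hy b hb
      rw [h5] at hy
      rw [hQw] at hb
      simp only [Option.mem_def, Option.some.injEq] at hy hb
      subst hy hb
      exact ⟨hg₀, hwg₀⟩)
    (by
      rw [List.nodup_append]
      refine ⟨h2, hQn, ?_⟩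
      rintro (y | y) hy b hb rfl
      · exact h6 y hy (hQK _ hb)
      · exact hedge y hy (hQK _ hb).1 (hQK _ hb).2)
    (by
      intro b hb
      rw [List.mem_append] at hb
      rcases hb with hb | hb
      · exact h3 b hb
      · rintro t rfl
        have := hQK _ hb
        obtain ⟨i, rfl | rfl⟩ : ∃ i, t = 2 * i ∨ t = 2 * i + 1 := ⟨t / 2, by omega⟩
        · rw [cyc_two_mul] at this; exact hK i this
        · rw [cyc_two_mul_add_one] at this
          exact heK i _ (h.isCyc.fst i) (this.2 _ (h.isCyc.fst i)))
    (by rw [List.head?_append, Option.mem_def.1 ha]; rfl)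
    (by rw [List.getLast?_append, hQz]; rfl) hai
  rw [List.length_append] at this
  omega

/-- In a connected host hypergraph, every vertex outside the cycle is attached to it. -/
theorem exists_isTail (h : LongestCyc G r s c x e) (hs : G ⊆ H) (hconn : HConnected H)
    (hk : IsEmpty (BergePath H (2 * s + 2))) {w : V} (hw : ∀ i, x i ≠ w)
    (hdegw : s.choose (r - 1) ≤ hdeg G w) :
    ∃ E t, IsTail G x e E t w := by
  by_contra hcon
  refine h.false_of_closed hs hconn hk (w := w)
    (K := {v | s.choose (r - 1) ≤ hdeg G v ∧ (∀ i, x i ≠ v) ∧ ¬ ∃ E t, IsTail G x e E t v})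
    ⟨hdegw, hw, hcon⟩ (fun v hv => hv.1) ?_ (fun i hi => hi.2.1 i rfl)
  rintro g hg v hv ⟨hv1, hv2, hv3⟩ u hu
  have hge : ∀ i, e i ≠ g := by
    rintro i rfl
    exact hv3 ⟨_, _, h.isTail_of_cycle_edge hv2 hv⟩
  have hux : ∀ i, x i ≠ u := by
    rintro i rfl
    exact hv3 ⟨_, _, isTail_of_edge hv2 hg hv hge hu⟩
  refine ⟨h.deg g hg u hu, hux, ?_⟩
  rintro ⟨E, t, hE⟩
  rcases h.edge_sub_of_tail hE hg hu hge v hv with rfl | ⟨i, hi⟩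
  · exact hv3 ⟨E, t, hE⟩
  · exact hv2 i hi

end LongestCyc

section Numeric

theorem choose_add_two_add_le {r s : ℕ} (hr : 3 ≤ r) (hs : r + 6 ≤ s) :
    (s + 2).choose r + (s + 2) ≤ (s.choose (r - 1) - 1) * (s - 1) := by
  obtain ⟨m, rfl⟩ : ∃ m, r = m + 2 := ⟨r - 2, by omega⟩
  have h0 : (s + 2).choose (m + 2) = s.choose m + 2 * s.choose (m + 1) + s.choose (m + 2) := by
    rw [Nat.choose_succ_succ' (s + 1) (m + 1), Nat.choose_succ_succ' s m,
      Nat.choose_succ_succ' s (m + 1)]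
    ring
  have h1 := Nat.choose_succ_right_eq s (m + 1)
  have h2 := Nat.choose_succ_right_eq s m
  have h3 := two_mul_le_choose (m := m + 1) (s := s) (by omega) (by omega) (by omega)
  rw [show m + 2 - 1 = m + 1 by omega, h0]
  rw [show m + 1 + 1 = m + 2 by omega] at h1
  generalize s.choose (m + 1) = D at *
  generalize s.choose (m + 2) = A at *
  generalize s.choose m = B at *
  have h4 : 3 * A ≤ D * (s - 2) := by
    calc 3 * A ≤ A * (m + 2) := by rw [mul_comm]; exact Nat.mul_le_mul_left _ (by omega)
      _ = D * (s - (m + 1)) := h1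
      _ ≤ _ := Nat.mul_le_mul_left _ (by omega)
  have h5 : 8 * B ≤ D * (s - 7) := by
    calc 8 * B ≤ B * (s - m) := by rw [mul_comm]; exact Nat.mul_le_mul_left _ (by omega)
      _ = D * (m + 1) := h2.symm
      _ ≤ _ := Nat.mul_le_mul_left _ (by omega)
  obtain ⟨s, rfl⟩ : ∃ s', s = s' + 9 := ⟨s - 9, by omega⟩
  obtain ⟨D, rfl⟩ : ∃ D', D = D' + 1 := ⟨D - 1, by omega⟩
  simp only [show s + 9 - 2 = s + 7 by omega, show s + 9 - 7 = s + 2 by omega,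
    show s + 9 - 1 = s + 8 by omega, Nat.add_sub_cancel] at *
  nlinarith

theorem choose_add_three_add_le {s : ℕ} (hs : 9 ≤ s) :
    (s + 3).choose 3 + (s + 3) ≤ (s.choose 2 - 1) * (s - 1) := by
  have h1 := Nat.choose_succ_right_eq s 1
  have h2 := Nat.choose_succ_right_eq (s + 3) 2
  have h3 := Nat.choose_succ_right_eq (s + 3) 1
  simp only [Nat.choose_one_right, Nat.reduceAdd] at h1 h2 h3
  generalize (s + 3).choose 3 = A at *
  generalize (s + 3).choose 2 = B at *
  generalize s.choose 2 = D at *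
  obtain ⟨s, rfl⟩ : ∃ s', s = s' + 9 := ⟨s - 9, by omega⟩
  simp only [show s + 9 + 3 - 2 = s + 10 by omega, show s + 9 + 3 - 1 = s + 11 by omega,
    show s + 9 - 1 = s + 8 by omega, show s + 9 + 3 = s + 12 by omega] at *
  obtain ⟨D, rfl⟩ : ∃ D', D = D' + 1 := ⟨D - 1, by
    rcases D with _ | D
    · nlinarith
    · omega⟩
  simp only [Nat.add_sub_cancel]
  have h4 : 6 * A = (s + 12) * (s + 11) * (s + 10) := by rw [← h3, mul_right_comm, ← h2]; ring
  have h5 : 2 * D + 2 = (s + 9) * (s + 8) := by rw [← h1]; ring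
  nlinarith [sq_nonneg s, mul_nonneg (Nat.zero_le s) (sq_nonneg s)]

end Numeric

section Dense

variable {V : Type*} {H : Finset (Finset V)}

theorem restrictTo_subset_restrictTo {S T : Finset V} (h : S ⊆ T) :
    restrictTo H S ⊆ restrictTo H T := by
  intro g hg
  rw [restrictTo, Finset.mem_filter] at hg ⊢
  exact ⟨hg.1, hg.2.trans h⟩

theorem hdeg_mono {G : Finset (Finset V)} (h : G ⊆ H) (v : V) : hdeg G v ≤ hdeg H v :=
  Finset.card_le_card (Finset.filter_subset_filter _ h)

theorem DelProcess.subset_of_hdeg {D : ℕ} {A S T : Finset V} (h : DelProcess H D A S) (hT : T ⊆ A)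
    (hdeg : ∀ v ∈ T, D ≤ hdeg (restrictTo H T) v) : T ⊆ S := by
  induction h with
  | refl => exact hT
  | step A S v hv hd _ ih =>
    refine ih fun u hu => Finset.mem_erase.2 ⟨?_, hT hu⟩
    rintro rfl
    exact absurd ((hdeg u hu).trans (hdeg_mono (restrictTo_subset_restrictTo hT) u)) (by omega)

/-- A smallest vertex set on which the number of edges minus `d` times the number of vertices is
at least its value on the whole vertex set: every set of vertices in it meets many edges. -/
theorem exists_dense_subset [Fintype V] (H : Finset (Finset V)) (d : ℕ) :
    ∃ T : Finset V, H.card + d * T.card ≤ (restrictTo H T).card + d * Fintype.card V ∧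
      ∀ U ⊆ T, U.Nonempty →
        d * U.card < ((restrictTo H T).filter (fun g => ∃ u ∈ U, u ∈ g)).card := by
  obtain ⟨T, hT, hmin⟩ := Finset.exists_min_image
    ((Finset.univ : Finset (Finset V)).filter fun T =>
      H.card + d * T.card ≤ (restrictTo H T).card + d * Fintype.card V) Finset.card
    ⟨Finset.univ, Finset.mem_filter.2 ⟨Finset.mem_univ _, by simp [restrictTo]⟩⟩
  rw [Finset.mem_filter] at hT
  refine ⟨T, hT.2, fun U hU hne => ?_⟩
  by_contra hcon
  have hsplit : (restrictTo H T).card ≤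
      ((restrictTo H T).filter (fun g => ∃ u ∈ U, u ∈ g)).card + (restrictTo H (T \ U)).card := by
    refine (Finset.card_le_card ?_).trans (Finset.card_union_le _ _)
    intro g hg
    have hg' := hg
    rw [restrictTo, Finset.mem_filter] at hg'
    by_cases hgU : ∃ u ∈ U, u ∈ g
    · exact Finset.mem_union_left _ (Finset.mem_filter.2 ⟨hg, hgU⟩)
    · refine Finset.mem_union_right _ (Finset.mem_filter.2 ⟨hg'.1, fun v hv => ?_⟩)
      exact Finset.mem_sdiff.2 ⟨hg'.2 hv, fun hvU => hgU ⟨v, hvU, hv⟩⟩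
  have hc := Finset.card_sdiff_add_card_eq_card hU
  have hpos := hne.card_pos
  have hd : d * T.card = d * (T \ U).card + d * U.card := by rw [← mul_add, hc]
  have := hmin (T \ U) (Finset.mem_filter.2 ⟨Finset.mem_univ _, by omega⟩)
  omega

end Dense

section LongCycle

variable {V : Type*} {G : Finset (Finset V)}

/-- `L` is a path with end vertex `v ∈ T`, of the largest possible length. -/
structure IsLongest (G : Finset (Finset V)) (T : Finset V) (L : List (V ⊕ Finset V)) (v : V) :
    Prop where
  chain : L.IsChain (Inc G)
  nodup : L.Nodup
  head : L.head? = some (.inl v)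
  last : ∃ z, L.getLast? = some (.inl z)
  mem : v ∈ T
  max : ∀ (L' : List (V ⊕ Finset V)) (v' z' : V), L'.IsChain (Inc G) → L'.Nodup →
    L'.head? = some (.inl v') → L'.getLast? = some (.inl z') → v' ∈ T → L'.length ≤ L.length

theorem exists_isLongest {T : Finset V} (hT : T.Nonempty) {k : ℕ} (hk : IsEmpty (BergePath G k)) :
    ∃ L v, IsLongest G T L v := by
  obtain ⟨v₀, hv₀⟩ := hT
  let P : ℕ → Prop := fun n => ∃ (L : List (V ⊕ Finset V)) (v z : V), L.length = n ∧
    L.IsChain (Inc G) ∧ L.Nodup ∧ L.head? = some (.inl v) ∧ L.getLast? = some (.inl z) ∧ v ∈ T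
  have hbound : ∀ n, P n → n ≤ 2 * k := by
    rintro n ⟨L, v, z, rfl, hL, hLn, -, hz, -⟩
    exact length_le_of_isEmpty_bergePath hL hLn hz hk
  have h1 : P 1 := ⟨[.inl v₀], v₀, v₀, rfl, by simp, by simp, by simp, by simp, hv₀⟩
  obtain ⟨L, v, z, hlen, hL, hLn, hv, hz, hvT⟩ := Nat.findGreatest_spec (hbound 1 h1) h1
  refine ⟨L, v, hL, hLn, hv, ⟨z, hz⟩, hvT, fun L' v' z' a b c d f => ?_⟩
  have hP : P L'.length := ⟨L', v', z', rfl, a, b, c, d, f⟩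
  rw [hlen]
  exact Nat.le_findGreatest (hbound _ hP) hP

namespace IsLongest

variable {T : Finset V} {L : List (V ⊕ Finset V)} {v : V}

theorem cons_eq (h : IsLongest G T L v) : ∃ L', L = .inl v :: L' := by
  have := h.head
  rcases L with _ | ⟨a, L'⟩
  · simp at this
  · simp only [List.head?_cons, Option.some.injEq] at this
    exact ⟨L', by rw [this]⟩

theorem edge_cases (h : IsLongest G T L v) (hT : ∀ g ∈ G, g ⊆ T) {t : ℕ}
    (ht : ∀ c, Nonempty (BergeCycle G c) → c ≤ t) {g : Finset V} (hg : g ∈ G) (hvg : v ∈ g) :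
    .inr g ∈ L.take (2 * t) ∨ (.inr g ∉ L ∧ ∀ u ∈ g, .inl u ∈ L.take (2 * t)) := by
  by_cases hgL : .inr g ∈ L
  · left
    obtain ⟨L₁, L₂, rfl⟩ := List.append_of_mem hgL
    have hsplit : L₁ ++ .inr g :: L₂ = (L₁ ++ [.inr g]) ++ L₂ := by simp
    have hchain := h.chain
    have hnodup := h.nodup
    have hhead := h.head
    rw [hsplit] at hchain hnodup hhead
    rw [List.head?_append_of_ne_nil _ (by simp)] at hhead
    obtain ⟨c, hc, hcyc⟩ := CycList.nonempty_bergeCycle (H := G) (L := L₁ ++ [.inr g])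
      ⟨hnodup.of_append_left, hchain.left_of_append, .inl v, hhead, .inr g, by simp, ⟨hg, hvg⟩⟩
    have := ht c hcyc
    rw [hsplit, List.take_append, List.take_of_length_le (by omega)]
    simp
  · right
    refine ⟨hgL, fun u hu => ?_⟩
    have huL : .inl u ∈ L := by
      by_contra huL
      obtain ⟨z, hz⟩ := h.last
      obtain ⟨L', rfl⟩ := h.cons_eq
      have := h.max (.inl u :: .inr g :: .inl v :: L') u z
        (by
          rw [List.isChain_cons_cons, List.isChain_cons_cons]
          exact ⟨⟨hg, hu⟩, ⟨hg, hvg⟩, h.chain⟩)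
        (by
          rw [List.nodup_cons, List.nodup_cons]
          exact ⟨by simpa using huL, hgL, h.nodup⟩)
        rfl (by simpa using hz) (hT g hg hu)
      simp at this
    obtain ⟨L₁, L₂, rfl⟩ := List.append_of_mem huL
    have hsplit : L₁ ++ .inl u :: L₂ = (L₁ ++ [.inl u]) ++ L₂ := by simp
    have hchain := h.chain
    have hnodup := h.nodup
    have hhead := h.head
    rw [hsplit] at hchain hnodup hhead hgL
    rw [List.head?_append_of_ne_nil _ (by simp)] at hhead
    obtain ⟨c, hc, hcyc⟩ := CycList.nonempty_bergeCycle (H := G) (L := L₁ ++ [.inl u] ++ [.inr g])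
      ⟨by
        rw [List.nodup_append]
        refine ⟨hnodup.of_append_left, by simp, fun a ha b hb => ?_⟩
        rw [List.mem_singleton] at hb
        rintro rfl
        exact hgL (List.mem_append_left _ (hb ▸ ha)), by
        rw [List.isChain_append]
        refine ⟨hchain.left_of_append, by simp, fun a ha b hb => ?_⟩
        simp only [List.getLast?_append_cons, List.getLast?_singleton, Option.mem_def,
          Option.some.injEq, List.head?_cons] at ha hb
        subst ha hb
        exact ⟨hg, hu⟩, .inl v, by rw [List.head?_append, hhead]; rfl, .inr g, by simp, ⟨hg, hvg⟩⟩
    have := ht c hcyc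
    rw [List.length_append] at hc
    rw [hsplit, List.take_append, List.take_of_length_le (by omega)]
    simp

/-- Closing up an edge at the first end of a longest path and opening the path at another vertex. -/
theorem rotate (h : IsLongest G T L v) (hT : ∀ g ∈ G, g ⊆ T) {g : Finset V} (hg : g ∈ G)
    (hvg : v ∈ g) (hgL : .inr g ∉ L) {L₁ L₂ : List (V ⊕ Finset V)} {y u : V} {f : Finset V}
    (hL : L = L₁ ++ .inl y :: .inr f :: .inl u :: L₂) (hu : u ∈ g) :
    IsLongest G T ((L₁ ++ [Sum.inl y]).reverse ++ .inr g :: .inl u :: L₂) y := by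
  have hsplit : L = (L₁ ++ [.inl y]) ++ .inr f :: .inl u :: L₂ := by simp [hL]
  have hchain := h.chain
  have hnodup := h.nodup
  have hhead := h.head
  obtain ⟨z, hz⟩ := h.last
  rw [hsplit] at hchain hnodup hhead hz
  rw [List.head?_append_of_ne_nil _ (by simp)] at hhead
  rw [List.isChain_append, List.isChain_cons_cons] at hchain
  rw [List.nodup_append, List.nodup_cons] at hnodup
  refine ⟨?_, ?_, by simp, ⟨z, ?_⟩, ?_, ?_⟩
  · rw [List.isChain_append, List.isChain_cons_cons]
    refine ⟨isChain_inc_reverse hchain.1, ⟨⟨hg, hu⟩, hchain.2.1.2⟩, fun a ha b hb => ?_⟩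
    rw [List.getLast?_reverse, hhead] at ha
    simp only [Option.mem_def, Option.some.injEq, List.head?_cons] at ha hb
    subst ha hb
    exact ⟨hg, hvg⟩
  · rw [List.nodup_append, List.nodup_cons, List.nodup_reverse]
    rw [hsplit] at hgL
    simp only [List.mem_append, List.mem_cons, not_or] at hgL
    refine ⟨hnodup.1, ⟨by simp [hgL], hnodup.2.1.2⟩, fun a ha b hb => ?_⟩
    rw [List.mem_reverse] at ha
    rw [List.mem_cons] at hb
    rcases hb with rfl | hb
    · rintro rfl
      simp [hgL] at ha
    · exact hnodup.2.2 a ha b (List.mem_cons_of_mem _ hb)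
  · rw [List.getLast?_append_cons, List.getLast?_cons_cons] at hz ⊢
    exact hz
  · have : Inc G (.inl y) (.inr f) := hchain.2.2 _ (by simp) _ (by simp)
    exact hT f this.1 this.2
  · intro L' v' z' a b c d f
    refine (h.max L' v' z' a b c d f).trans ?_
    simp [hL]
    omega

end IsLongest

theorem length_filterMap_le_of_chain : ∀ {M : List (V ⊕ Finset V)} {t : ℕ}, M.IsChain (Inc G) →
    M.length ≤ 2 * t →
    (M.filterMap Sum.getLeft?).length ≤ t ∧ (M.filterMap Sum.getRight?).length ≤ t
  | [], t, _, _ => by simp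
  | [a], t, _, h => by
    simp only [List.length_singleton] at h
    exact ⟨(List.length_filterMap_le _ _).trans (by simp; omega),
      (List.length_filterMap_le _ _).trans (by simp; omega)⟩
  | a :: b :: M, 0, _, h => by simp at h
  | a :: b :: M, t + 1, hM, h => by
    have ih := length_filterMap_le_of_chain (M := M) (t := t) hM.tail.tail
      (by simp only [List.length_cons] at h; omega)
    rw [List.isChain_cons_cons] at hM
    rcases a with a | a <;> rcases b with b | b
    · simp at hM
    · simpa [List.filterMap_cons] using ih
    · simpa [List.filterMap_cons] using ih
    · simp at hM

/-- If every set of vertices meets many edges, then there is a long cycle. -/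
theorem exists_bergeCycle_gt {T : Finset V} {r s t k : ℕ} (hr : 3 ≤ r) (hs : r + 6 ≤ s)
    (hG : ∀ g ∈ G, g.card = r) (hGT : ∀ g ∈ G, g ⊆ T) (hT : T.Nonempty)
    (hU : ∀ U ⊆ T, U.Nonempty →
      (s.choose (r - 1) - 1) * U.card < (G.filter (fun g => ∃ u ∈ U, u ∈ g)).card)
    (hk : IsEmpty (BergePath G k)) (hts : t + 4 ≤ 2 * s)
    (htr : t.choose r + t ≤ (s.choose (r - 1) - 1) * (s - 1)) :
    ∃ c, t < c ∧ Nonempty (BergeCycle G c) := by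
  by_contra! hcon
  have ht : ∀ c, Nonempty (BergeCycle G c) → c ≤ t := by
    intro c hc
    by_contra hlt
    exact not_isEmpty_iff.2 hc (hcon c (by omega))
  obtain ⟨L, v, hL⟩ := exists_isLongest hT hk
  set XV := listVerts (L.take (2 * t)) with hXV
  set XE := listEdges (L.take (2 * t)) with hXE
  obtain ⟨hXVc, hXEc⟩ : XV.card ≤ t ∧ XE.card ≤ t := by
    have hlen : (L.take (2 * t)).length ≤ 2 * t := by simp
    have := length_filterMap_le_of_chain (hL.chain.take _) hlen
    exact ⟨(List.toFinset_card_le _).trans this.1, (List.toFinset_card_le _).trans this.2⟩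
  set N := XV.filter (fun u => u ≠ v ∧ ∃ g ∈ G, v ∈ g ∧ .inr g ∉ L ∧ u ∈ g) with hN
  have hdeg : s.choose (r - 1) ≤ (G.filter (fun g => v ∈ g)).card := by
    have := hU {v} (by simpa using hL.mem) (by simp)
    simp only [Finset.card_singleton, Finset.mem_singleton, exists_eq_left, mul_one] at this
    omega
  have hNc : s - 1 ≤ N.card := by
    by_contra hlt
    have h1 : (G.filter (fun g => v ∈ g)).card ≤ N.card.choose (r - 1) + t := by
      have hsub : G.filter (fun g => v ∈ g) ⊆ G.filter (fun g => v ∈ g ∧ .inr g ∉ L) ∪ XE := by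
        intro g hg
        rw [Finset.mem_filter] at hg
        rcases hL.edge_cases hGT ht hg.1 hg.2 with h | h
        · exact Finset.mem_union_right _ (by simpa [hXE] using h)
        · exact Finset.mem_union_left _ (Finset.mem_filter.2 ⟨hg.1, hg.2, h.1⟩)
      refine (Finset.card_le_card hsub).trans ((Finset.card_union_le _ _).trans ?_)
      refine Nat.add_le_add (card_le_choose_of_subset (z := v) fun g hg => ?_) hXEc
      rw [Finset.mem_filter] at hg
      refine ⟨hG g hg.1, hg.2.1, fun u hu => or_iff_not_imp_left.2 fun huv => ?_⟩
      rcases hL.edge_cases hGT ht hg.1 hg.2.1 with h | h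
      · exact absurd (List.mem_of_mem_take h) hg.2.2
      · exact Finset.mem_filter.2 ⟨by simpa [hXV] using h.2 u hu, huv, g, hg.1, hg.2.1, hg.2.2, hu⟩
    have h2 := choose_add_lt_choose_of_two_le (m := r - 1) (n := s) (by omega) (by omega)
    have h3 : N.card.choose (r - 1) ≤ (s - 2).choose (r - 1) := Nat.choose_le_choose _ (by omega)
    omega
  have hpred : ∀ u ∈ N, ∃ y, (∃ L₁ f L₂, L = L₁ ++ .inl y :: .inr f :: .inl u :: L₂ ∧
      L₁.length + 2 < 2 * t) := by
    intro u hu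
    obtain ⟨hu1, huv, -⟩ := Finset.mem_filter.1 hu
    rw [hXV, mem_listVerts] at hu1
    obtain ⟨A, B, hAB⟩ := List.append_of_mem hu1
    have hLeq : L = A ++ .inl u :: (B ++ L.drop (2 * t)) := by
      conv_lhs => rw [← List.take_append_drop (2 * t) L, hAB]
      simp
    have hlen : A.length + 1 ≤ 2 * t := by
      have := congrArg List.length hAB
      simp only [List.length_append, List.length_cons, List.length_take] at this
      omega
    have hchain := hL.chain
    have hhead := hL.head
    rw [hLeq] at hchain hhead
    rcases List.eq_nil_or_concat A with rfl | ⟨A, a, rfl⟩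
    · simp at hhead; exact absurd hhead huv
    have ha : Inc G a (.inl u) := by
      rw [List.isChain_append] at hchain
      exact hchain.2.2 _ (by simp) _ (by simp)
    rcases a with a | f
    · simp at ha
    rcases List.eq_nil_or_concat A with rfl | ⟨A, b, rfl⟩
    · simp at hhead
    have hb : Inc G b (.inr f) := by
      simp only [List.concat_eq_append] at hchain
      rw [List.append_assoc, List.isChain_append] at hchain
      exact hchain.2.2 _ (by simp) _ (by simp)
    rcases b with y | b
    · refine ⟨y, A, f, _, hLeq.trans (by simp; rfl), ?_⟩
      simp at hlen
      omega
    · simp at hb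
  choose! p hp using hpred
  have hinj : Set.InjOn p N := by
    intro u hu u' hu' heq
    obtain ⟨L₁, f, L₂, hL₁, -⟩ := hp u hu
    obtain ⟨L₁', f', L₂', hL₁', -⟩ := hp u' hu'
    have hnodup := hL.nodup
    rw [hL₁, List.nodup_append, List.nodup_cons] at hnodup
    rw [← heq, hL₁] at hL₁'
    have h := ((List.append_cons_inj_of_notMem
      (fun h => hnodup.2.2 _ h _ List.mem_cons_self rfl) hnodup.2.1.1).1 hL₁').2.2
    simp only [List.cons.injEq, Sum.inl.injEq] at h
    exact h.2.1
  have hrot : ∀ u ∈ N, ∃ g L', g ∈ G ∧ .inr g ∉ L ∧ v ∈ g ∧ IsLongest G T L' (p u) ∧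
      ∀ a ∈ L'.take (2 * t), a = .inr g ∨ a ∈ L.take (2 * t) := by
    intro u hu
    obtain ⟨-, -, g, hg, hvg, hgL, hug⟩ := Finset.mem_filter.1 hu
    obtain ⟨L₁, f, L₂, hL₁, hlen⟩ := hp u hu
    refine ⟨g, _, hg, hgL, hvg, hL.rotate hGT hg hvg hgL hL₁ hug, fun a ha => ?_⟩
    have h2 : 2 * t - (L₁.length + 1) = 2 * t - (L₁.length + 2) + 1 := by omega
    have hLt : L.take (2 * t) = (L₁ ++ [.inl (p u)]) ++
        .inr f :: (.inl u :: L₂).take (2 * t - (L₁.length + 2)) := by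
      rw [hL₁, show L₁ ++ .inl (p u) :: .inr f :: .inl u :: L₂ =
        (L₁ ++ [.inl (p u)]) ++ .inr f :: .inl u :: L₂ by simp, List.take_append,
        List.take_of_length_le (by simp; omega), List.length_append, List.length_singleton, h2,
        List.take_succ_cons]
    rw [List.take_append, List.take_of_length_le (by simp; omega), List.length_reverse,
      List.length_append, List.length_singleton, h2, List.take_succ_cons, List.mem_append,
      List.mem_reverse, List.mem_cons] at ha
    rw [hLt, List.mem_append, List.mem_cons]
    tauto
  have hpT : N.image p ⊆ T := by
    intro y hy
    obtain ⟨u, hu, rfl⟩ := Finset.mem_image.1 hy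
    obtain ⟨g, L', -, -, -, hL', -⟩ := hrot u hu
    exact hL'.mem
  have hNne : N.Nonempty := Finset.card_pos.1 (by omega)
  have hcount := hU (N.image p) hpT (hNne.image _)
  rw [Finset.card_image_of_injOn hinj] at hcount
  have htouch : G.filter (fun g => ∃ u ∈ N.image p, u ∈ g) ⊆ XV.powersetCard r ∪ XE := by
    intro f hf
    obtain ⟨hfG, y, hy, hyf⟩ := Finset.mem_filter.1 hf
    obtain ⟨u, hu, rfl⟩ := Finset.mem_image.1 hy
    obtain ⟨g, L', hg, hgL, hvg, hL', htake⟩ := hrot u hu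
    rw [Finset.mem_union, Finset.mem_powersetCard, hXE, mem_listEdges]
    rcases hL'.edge_cases hGT ht hfG hyf with h | h
    · rcases htake _ h with hfg | hfL
      · obtain rfl : f = g := Sum.inr_injective hfg
        rcases hL.edge_cases hGT ht hg hvg with h' | h'
        · exact .inr h'
        · exact .inl ⟨fun a ha => by simpa [hXV] using h'.2 a ha, hG f hfG⟩
      · exact .inr hfL
    · refine .inl ⟨fun a ha => ?_, hG f hfG⟩
      rcases htake _ (h.2 a ha) with hag | haL
      · simp at hag
      · simpa [hXV] using haL
  have h1 := (Finset.card_le_card htouch).trans (Finset.card_union_le _ _)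
  rw [Finset.card_powersetCard] at h1
  have h2 : XV.card.choose r ≤ t.choose r := Nat.choose_le_choose _ hXVc
  have h3 := Nat.mul_le_mul_left (s.choose (r - 1) - 1) hNc
  omega


end LongCycle

section Paths

variable {V : Type*} {H G : Finset (Finset V)} {t t' : ℕ}

theorem isEmpty_bergePath_mono (hs : G ⊆ H) (ht : t' ≤ t) (h : IsEmpty (BergePath H t')) :
    IsEmpty (BergePath G t) := by
  refine ⟨fun P => h.false ⟨fun i => P.verts (i.castLE (by omega)), fun i => P.edges (i.castLE ht),
    fun i j hij => ?_, fun i j hij => ?_, fun i => hs (P.edges_mem _),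
    fun i => P.fst_mem (i.castLE ht),
    fun i => P.snd_mem (i.castLE ht)⟩⟩
  · simpa using P.verts_inj hij
  · simpa using P.edges_inj hij

theorem nonempty_bergeCycle_mono (hs : G ⊆ H) (h : Nonempty (BergeCycle G t)) :
    Nonempty (BergeCycle H t) :=
  h.map fun C => ⟨C.verts, C.edges, C.verts_inj, C.edges_inj, fun i => hs (C.edges_mem i),
    C.fst_mem, C.snd_mem⟩

end Paths

/-- Many edges force a vertex set with more than `r * (k - 1)` vertices in which every set of
vertices meets many edges. -/
theorem exists_large_dense_subset {V : Type*} [Fintype V] {r k n : ℕ} (hV : Fintype.card V = n)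
    (hD : 0 < ((k - 1) / 2).choose (r - 1)) (hr : 0 < r)
    (hn : Nkr r k < n) {H : Finset (Finset V)} (huni : ∀ e ∈ H, e.card = r)
    (hcard : extremalCount r k n ≤ H.card) :
    ∃ T : Finset V, r * (k - 1) < T.card ∧ ∀ U ⊆ T, U.Nonempty →
      (((k - 1) / 2).choose (r - 1) - 1) * U.card <
        ((restrictTo H T).filter (fun g => ∃ u ∈ U, u ∈ g)).card := by
  obtain ⟨T, hT, hU⟩ := exists_dense_subset H (((k - 1) / 2).choose (r - 1) - 1)
  refine ⟨T, ?_, hU⟩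
  have hle : k - 1 ≤ r * (k - 1) := Nat.le_mul_of_pos_left _ hr
  have hTc : (restrictTo H T).card ≤ T.card.choose r := by
    rw [← Finset.card_powersetCard]
    refine Finset.card_le_card fun g hg => ?_
    rw [restrictTo, Finset.mem_filter] at hg
    exact Finset.mem_powersetCard.2 ⟨hg.2, huni g hg.1⟩
  have hlt : (r * (k - 1)).choose r < T.card.choose r := by
    refine lt_of_lt_of_le ?_ hTc
    unfold Nkr at hn
    unfold extremalCount at hcard
    rw [hV] at hT
    have hs : (k - 1) / 2 ≤ k - 1 := Nat.div_le_self _ _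
    generalize (if 2 ∣ k then ((k - 1) / 2).choose (r - 2) else 0) = ε at *
    generalize (r * (k - 1)).choose r = M at *
    generalize ((k - 1) / 2).choose r = A at *
    generalize (k - 1) / 2 = s at *
    generalize s.choose (r - 1) = D at *
    generalize r * (k - 1) = R at *
    obtain ⟨D, rfl⟩ : ∃ D', D = D' + 1 := ⟨D - 1, by omega⟩
    obtain ⟨m, rfl⟩ : ∃ m, n = s + m := ⟨n - s, by omega⟩
    simp only [Nat.add_sub_cancel, Nat.add_sub_cancel_left] at *
    have h1 : (D + 1) * m = D * m + m := by ring
    have h2 : (D + 1) * s = D * s + s := by ring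
    have h3 : D * (s + m) = D * s + D * m := by ring
    omega
  by_contra hcon
  exact absurd (Nat.choose_le_choose r (not_lt.1 hcon)) (by omega)

/-- The main result over an arbitrary finite vertex type. -/
theorem nonempty_bergeCycle_of_delProcess {V : Type*} [Fintype V]
    {r k n : ℕ} (hV : Fintype.card V = n) (hk : 2 * r + 13 ≤ k) (hr : 18 ≤ 2 * r + 13)
    (hn : Nkr r k < n) {H : Finset (Finset V)} (huni : ∀ e ∈ H, e.card = r)
    (hconn : HConnected H) (hpath : IsEmpty (BergePath H k))
    (hcard : extremalCount r k n ≤ H.card)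
    {S : Finset V}
    (hS : DelProcess H (((k - 1) / 2).choose (r - 1)) Finset.univ S)
    (hterm : ∀ v ∈ S, ((k - 1) / 2).choose (r - 1) ≤ hdeg (restrictTo H S) v)
    {l : ℕ} (hl : Nonempty (BergePath (restrictTo H S) l))
    (hlmax : ∀ t, Nonempty (BergePath (restrictTo H S) t) → t ≤ l) :
    Nonempty (BergeCycle (restrictTo H S) l) ∨
      Nonempty (BergeCycle (restrictTo H S) (l + 1)) := by
  have hsub : ∀ A : Finset V, restrictTo H A ⊆ H := fun A => Finset.filter_subset _ _
  have hsubA : ∀ A : Finset V, ∀ g ∈ restrictTo H A, g ⊆ A := fun A g hg =>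
    (Finset.mem_filter.1 hg).2
  have hkr : k - 1 ≤ r * (k - 1) := Nat.le_mul_of_pos_left _ (by omega)
  obtain ⟨T, hTcard, hU⟩ := exists_large_dense_subset hV (Nat.choose_pos (by omega)) (by omega) hn
    huni hcard
  obtain ⟨s, hs⟩ : ∃ s, s = (k - 1) / 2 := ⟨_, rfl⟩
  rw [← hs] at hS hterm hU
  have hTne : T.Nonempty := Finset.card_pos.1 (by omega)
  have hTS : T ⊆ S := by
    refine hS.subset_of_hdeg (Finset.subset_univ _) fun v hv => ?_
    have := hU {v} (by simpa using hv) (by simp)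
    simp only [Finset.card_singleton, Finset.mem_singleton, exists_eq_left, mul_one] at this
    unfold hdeg
    omega
  have hTG := restrictTo_subset_restrictTo (H := H) hTS
  set G := restrictTo H S with hG
  have hpathH : IsEmpty (BergePath H (2 * s + 2)) :=
    isEmpty_bergePath_mono (fun _ => id) (by omega) hpath
  have hlong : ∀ t, t + 4 ≤ 2 * s → t.choose r + t ≤ (s.choose (r - 1) - 1) * (s - 1) →
      ∃ c, t < c ∧ Nonempty (BergeCycle G c) := by
    intro t h1 h2
    obtain ⟨c, hc, hC⟩ := exists_bergeCycle_gt (by omega) (by omega)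
      (fun g hg => huni g (hsub T hg))
      (hsubA T) hTne hU (isEmpty_bergePath_mono (hsub T) le_rfl hpath) h1 h2
    exact ⟨c, hc, nonempty_bergeCycle_mono hTG hC⟩
  have hbound : ∀ c, Nonempty (BergeCycle G c) → c ≤ n := by
    rintro c ⟨C⟩
    simpa [hV] using Fintype.card_le_of_injective _ C.verts_inj
  obtain ⟨c₀, hc₀, hC₀⟩ := hlong (s + 2) (by omega) (choose_add_two_add_le (by omega) (by omega))
  obtain ⟨c, hC, hmax⟩ : ∃ c, Nonempty (BergeCycle G c) ∧
      ∀ c', Nonempty (BergeCycle G c') → c' ≤ c :=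
    ⟨_, Nat.findGreatest_spec (P := fun c => Nonempty (BergeCycle G c)) (hbound _ hC₀) hC₀,
      fun c' hc' => Nat.le_findGreatest (hbound _ hc') hc'⟩
  have hlo : s + 3 ≤ c := (Nat.succ_le_of_lt hc₀).trans (hmax _ hC₀)
  obtain ⟨x, e, hcyc⟩ := exists_isCyc_of_bergeCycle (by omega) hC.some
  have hl1 := hlmax _ hcyc.bergePath
  have hl2 : l < 2 * s + 2 := by
    by_contra hlt
    exact not_isEmpty_iff.2 hl (isEmpty_bergePath_mono (hsub S) (by omega) hpathH)
  have hfin : l = c ∨ l + 1 = c → Nonempty (BergeCycle G l) ∨ Nonempty (BergeCycle G (l + 1)) := by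
    rintro (rfl | rfl)
    · exact .inl hC
    · exact .inr hC
  refine hfin ?_
  by_cases hhi : c ≤ 2 * s
  swap
  · omega
  have hL : LongestCyc G r s c x e :=
    { isCyc := hcyc
      max := hmax
      unif := fun g hg => huni g (hsub S hg)
      deg := fun g hg v hv => hterm v (hsubA S g hg hv)
      path := isEmpty_bergePath_mono (hsub S) le_rfl hpathH
      r_ge := by omega
      s_ge := by omega
      lo := hlo
      lo3 := by
        rintro rfl
        obtain ⟨c', hc', hC'⟩ := hlong (s + 3) (by omega) (choose_add_three_add_le (by omega))
        exact (Nat.succ_le_of_lt hc').trans (hmax _ hC')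
      hi := hhi }
  have htail : ∀ v ∈ S, (∀ i, x i ≠ v) → ∃ E t, IsTail G x e E t v := fun v hv hxv =>
    hL.exists_isTail (hsub S) hconn hpathH hxv (hterm v hv)
  obtain ⟨w, hwT, hw⟩ : ∃ w ∈ T, ∀ i, x i ≠ w := by
    obtain ⟨w, hwT, hw⟩ := Finset.exists_mem_notMem_of_card_lt_card
      (s := (Finset.range c).image x) (t := T)
      (Finset.card_image_le.trans_lt (by rw [Finset.card_range]; omega))
    refine ⟨w, hwT, fun i hi => hw ?_⟩
    exact Finset.mem_image.2 ⟨i % c, by simpa using Nat.mod_lt _ hcyc.pos, by rw [hcyc.x_mod, hi]⟩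
  obtain ⟨E, t, hE⟩ := htail w (hTS hwT) hw
  obtain ⟨K, hK⟩ := hL.exists_isKernel hE
  have hempty := hL.isEmpty_bergePath hw hK fun g hg v hv => by
    by_cases hv' : ∃ i, x i = v
    · exact .inl hv'
    · exact .inr (htail v (hsubA S g hg hv) (by simpa using hv'))
  have hl3 : l < 2 * s + 1 := by
    by_contra hlt
    exact not_isEmpty_iff.2 hl (isEmpty_bergePath_mono (fun _ => id) (by omega) hempty)
  have := hK.length_eq
  omega

/-- Under the standing assumptions, if `l` is the length of a longest
Berge-path of `H'`, then `H'` contains a Berge-cycle of length `l` or `l+1`. -/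
theorem residual_contains_long_berge_cycle
    (r k n : ℕ) (hk : 2 * r + 13 ≤ k) (hr : 18 ≤ 2 * r + 13) (hn : Nkr r k < n)
    (H : Finset (Finset (Fin n))) (huni : ∀ e ∈ H, e.card = r)
    (hconn : HConnected H) (hpath : IsEmpty (BergePath H k))
    (hcard : extremalCount r k n ≤ H.card)
    (S : Finset (Fin n))
    (hS : DelProcess H (((k - 1) / 2).choose (r - 1)) Finset.univ S)
    (hterm : ∀ v ∈ S, ((k - 1) / 2).choose (r - 1) ≤ hdeg (restrictTo H S) v)
    (l : ℕ) (hl : Nonempty (BergePath (restrictTo H S) l))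
    (hlmax : ∀ t, Nonempty (BergePath (restrictTo H S) t) → t ≤ l) :
    Nonempty (BergeCycle (restrictTo H S) l) ∨
      Nonempty (BergeCycle (restrictTo H S) (l + 1)) := by
  exact nonempty_bergeCycle_of_delProcess (Fintype.card_fin n) hk hr hn huni hconn hpath hcard
    hS hterm hl hlmax
end

section
/- Under the standing assumptions (k ≥ 2r+13 ≥ 18; n > N_{k,r}; H a connected n-vertex r-graph with no Berge-path of length k and with at least C(⌊(k-1)/2⌋, r-1)·(n − ⌊(k-1)/2⌋) + C(⌊(k-1)/2⌋, r) + [k even]·C(⌊(k-1)/2⌋, r-2) hyperedges; H' the sub-hypergraph obtained from H by repeatedly deleting vertices of degree less than C(⌊(k-1)/2⌋, r-1) together with their incident hyperedges), if l denotes the length of a longest Berge-path of H', then H' contains no Berge-cycle of length greater than l; in particular H' contains no Berge-cycle of length l+1. -/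
open scoped Classical

/-- The data `v 0, e 0, v 1, …, e (t - 1), v t` of a Berge-path of length `t`, with vertices and
hyperedges given by functions on `ℕ`. -/
structure IsBergeSeq {V : Type*} (H : Finset (Finset V)) (t : ℕ) (v : ℕ → V)
    (e : ℕ → Finset V) : Prop where
  verts_inj : ∀ i ≤ t, ∀ j ≤ t, v i = v j → i = j
  edges_inj : ∀ i < t, ∀ j < t, e i = e j → i = j
  edges_mem : ∀ i < t, e i ∈ H
  fst_mem : ∀ i < t, v i ∈ e i
  snd_mem : ∀ i < t, v (i + 1) ∈ e i

namespace IsBergeSeq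

variable {V : Type*} {H G : Finset (Finset V)} {s t : ℕ} {v v' : ℕ → V} {e e' : ℕ → Finset V}

theorem nonempty_bergePath (h : IsBergeSeq H t v e) : Nonempty (BergePath H t) :=
  ⟨{ verts := fun i => v i
     edges := fun i => e i
     verts_inj := fun i j hij => Fin.ext (h.verts_inj i (by omega) j (by omega) hij)
     edges_inj := fun i j hij => Fin.ext (h.edges_inj i i.2 j j.2 hij)
     edges_mem := fun i => h.edges_mem i i.2
     fst_mem := fun i => h.fst_mem i i.2
     snd_mem := fun i => h.snd_mem i i.2 }⟩

theorem of_bergePath (P : BergePath H t) :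
    ∃ v e, IsBergeSeq H t v e ∧ v 0 = P.verts 0 ∧ v t = P.verts (Fin.last t) := by
  refine ⟨fun i => if h : i < t + 1 then P.verts ⟨i, h⟩ else P.verts 0,
    fun i => if h : i < t then P.edges ⟨i, h⟩ else ∅, ⟨?_, ?_, ?_, ?_, ?_⟩, ?_, ?_⟩
  · intro i hi j hj hij
    simp only [Nat.lt_succ_of_le hi, Nat.lt_succ_of_le hj, dite_true] at hij
    exact congrArg Fin.val (P.verts_inj hij)
  · intro i hi j hj hij
    simp only [hi, hj, dite_true] at hij
    exact congrArg Fin.val (P.edges_inj hij)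
  · intro i hi
    simpa only [hi, dite_true] using P.edges_mem ⟨i, hi⟩
  · intro i hi
    simp only [hi, Nat.lt_succ_of_lt hi, dite_true]
    exact P.fst_mem ⟨i, hi⟩
  · intro i hi
    simp only [hi, Nat.succ_lt_succ hi, dite_true]
    exact P.snd_mem ⟨i, hi⟩
  · simp
  · simp [Fin.last]

theorem mono (h : IsBergeSeq G t v e) (hGH : G ⊆ H) : IsBergeSeq H t v e :=
  ⟨h.verts_inj, h.edges_inj, fun i hi => hGH (h.edges_mem i hi), h.fst_mem, h.snd_mem⟩

theorem take (h : IsBergeSeq H t v e) (hst : s ≤ t) : IsBergeSeq H s v e :=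
  ⟨fun i hi j hj => h.verts_inj i (hi.trans hst) j (hj.trans hst),
    fun i hi j hj => h.edges_inj i (by omega) j (by omega),
    fun i hi => h.edges_mem i (by omega), fun i hi => h.fst_mem i (by omega),
    fun i hi => h.snd_mem i (by omega)⟩

theorem drop (h : IsBergeSeq H t v e) (hst : s ≤ t) :
    IsBergeSeq H (t - s) (fun i => v (s + i)) (fun i => e (s + i)) :=
  ⟨fun i hi j hj hij => by have := h.verts_inj _ (by omega) _ (by omega) hij; omega,
    fun i hi j hj hij => by have := h.edges_inj _ (by omega) _ (by omega) hij; omega,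
    fun i hi => h.edges_mem _ (by omega), fun i hi => h.fst_mem _ (by omega),
    fun i hi => h.snd_mem (s + i) (by omega)⟩

theorem reverse (h : IsBergeSeq H t v e) :
    IsBergeSeq H t (fun i => v (t - i)) (fun i => e (t - 1 - i)) := by
  refine ⟨fun i hi j hj hij => ?_, fun i hi j hj hij => ?_, fun i hi => ?_, fun i hi => ?_,
    fun i hi => ?_⟩
  · have := h.verts_inj _ (by omega) _ (by omega) hij
    omega
  · have := h.edges_inj _ (by omega) _ (by omega) hij
    omega
  · exact h.edges_mem _ (by omega)
  · have := h.snd_mem (t - 1 - i) (by omega)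
    rwa [show t - 1 - i + 1 = t - i by omega] at this
  · have := h.fst_mem (t - 1 - i) (by omega)
    rwa [show t - 1 - i = t - (i + 1) by omega] at this ⊢

/-- Two Berge-paths that share only the end of the first, which is the start of the second, can
be concatenated. -/
theorem append (h : IsBergeSeq H s v e) (h' : IsBergeSeq H t v' e') (hj : v s = v' 0)
    (hv : ∀ i ≤ s, ∀ j ≤ t, j ≠ 0 → v i ≠ v' j) (he : ∀ i < s, ∀ j < t, e i ≠ e' j) :
    IsBergeSeq H (s + t) (fun i => if i ≤ s then v i else v' (i - s))
      (fun i => if i < s then e i else e' (i - s)) := by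
  refine ⟨fun i hi j hj hij => ?_, fun i hi j hj hij => ?_, fun i hi => ?_, fun i hi => ?_,
    fun i hi => ?_⟩
  · split_ifs at hij with h1 h2 h2
    · exact h.verts_inj i h1 j h2 hij
    · exact absurd hij (hv i h1 (j - s) (by omega) (by omega))
    · exact absurd hij.symm (hv j h2 (i - s) (by omega) (by omega))
    · have := h'.verts_inj (i - s) (by omega) (j - s) (by omega) hij
      omega
  · split_ifs at hij with h1 h2 h2
    · exact h.edges_inj i h1 j h2 hij
    · exact absurd hij (he i h1 (j - s) (by omega))
    · exact absurd hij.symm (he j h2 (i - s) (by omega))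
    · have := h'.edges_inj (i - s) (by omega) (j - s) (by omega) hij
      omega
  · split_ifs with h1
    · exact h.edges_mem i h1
    · exact h'.edges_mem _ (by omega)
  · rcases lt_trichotomy i s with h1 | rfl | h1
    · simpa [h1, h1.le] using h.fst_mem i h1
    · simpa [hj] using h'.fst_mem 0 (by omega)
    · simpa [not_le.2 h1, not_lt.2 h1.le] using h'.fst_mem (i - s) (by omega)
  · rcases lt_or_ge i s with h1 | h1
    · simpa [h1, Nat.succ_le_of_lt h1] using h.snd_mem i h1
    · have := h'.snd_mem (i - s) (by omega)
      rw [show i - s + 1 = i + 1 - s by omega] at this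
      simpa [not_lt.2 h1, show ¬ i + 1 ≤ s by omega] using this

/-- A Berge-path can be prolonged by a new hyperedge through its end and a new vertex. -/
theorem snoc (h : IsBergeSeq H t v e) {f : Finset V} (hf : f ∈ H) (hvf : v t ∈ f)
    (hfe : ∀ i < t, e i ≠ f) {x : V} (hxf : x ∈ f) (hx : ∀ i ≤ t, v i ≠ x) :
    ∃ v' e', IsBergeSeq H (t + 1) v' e' ∧ v' 0 = v 0 := by
  have hone : IsBergeSeq H 1 (fun i => if i = 0 then v t else x) (fun _ => f) := by
    refine ⟨fun i hi j hj hij => ?_, fun i hi j hj _ => by omega, fun _ _ => hf,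
      fun i hi => ?_, fun i hi => ?_⟩
    · have := hx t le_rfl
      interval_cases i <;> interval_cases j <;> simp_all [eq_comm]
    · simpa [show i = 0 by omega] using hvf
    · simpa using hxf
  refine ⟨_, _, h.append hone (by simp) (fun i hi j hj hj0 => ?_) (fun i hi j hj => hfe i hi),
    by simp⟩
  simpa [hj0] using hx i hi

/-- If a Berge-path of an `r`-graph cannot be prolonged at its end, then the degree of its end is
bounded in terms of its length. -/
theorem hdeg_le (h : IsBergeSeq H t v e) {r : ℕ} (hr : ∀ f ∈ H, f.card = r)
    (hmax : ∀ v' e', IsBergeSeq H (t + 1) v' e' → v' 0 ≠ v 0) :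
    hdeg H (v t) ≤ t.choose (r - 1) + t ∧
      (r = 3 → hdeg H (v t) ≤ t.choose (r - 1) + 1) := by
  set W := (Finset.range (t + 1)).image v with hW
  have hWcard : W.card = t + 1 := by
    rw [hW, Finset.card_image_of_injOn, Finset.card_range]
    intro i hi j hj hij
    simp only [Finset.coe_range, Set.mem_Iio] at hi hj
    exact h.verts_inj i (by omega) j (by omega) hij
  have hmemW : ∀ i ≤ t, v i ∈ W := fun i hi =>
    Finset.mem_image_of_mem v (Finset.mem_range.2 (by omega))
  have hinner : (H.filter fun f => v t ∈ f ∧ f ⊆ W).card ≤ t.choose (r - 1) := by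
    have hcard : ((W.erase (v t)).powersetCard (r - 1)).card = t.choose (r - 1) := by
      rw [Finset.card_powersetCard, Finset.card_erase_of_mem (hmemW t le_rfl), hWcard,
        Nat.add_sub_cancel]
    rw [← hcard]
    refine Finset.card_le_card_of_injOn (fun f => f.erase (v t)) (fun f hf => ?_)
      (fun f hf g hg hfg => ?_)
    · simp only [Finset.coe_filter, Set.mem_ofPred_eq] at hf
      simp only [Finset.mem_coe, Finset.mem_powersetCard]
      exact ⟨Finset.erase_subset_erase _ hf.2.2, by
        rw [Finset.card_erase_of_mem hf.2.1, hr f hf.1]⟩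
    · simp only [Finset.coe_filter, Set.mem_ofPred_eq] at hf hg
      rw [← Finset.insert_erase hf.2.1, ← Finset.insert_erase hg.2.1]
      exact congrArg _ hfg
  have houter : ∀ f ∈ H, v t ∈ f → ¬ f ⊆ W → ∃ i < t, e i = f := by
    intro f hf hvf hfW
    by_contra! hne
    obtain ⟨x, hxf, hxW⟩ := Finset.not_subset.1 hfW
    obtain ⟨v', e', h', h0⟩ := h.snoc hf hvf hne hxf
      (fun i hi hix => hxW (hix ▸ hmemW i hi))
    exact hmax v' e' h' h0
  have hsplit : ∀ B : Finset (Finset V), (∀ f ∈ H, v t ∈ f → ¬ f ⊆ W → f ∈ B) →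
      hdeg H (v t) ≤ t.choose (r - 1) + B.card := by
    intro B hB
    refine (Finset.card_le_card (t := (H.filter fun f => v t ∈ f ∧ f ⊆ W) ∪ B) ?_).trans
      ((Finset.card_union_le _ _).trans (Nat.add_le_add_right hinner _))
    intro f hf
    rw [Finset.mem_filter] at hf
    by_cases hfW : f ⊆ W
    · exact Finset.mem_union_left _ (Finset.mem_filter.2 ⟨hf.1, hf.2, hfW⟩)
    · exact Finset.mem_union_right _ (hB f hf.1 hf.2 hfW)
  constructor
  · refine (hsplit ((Finset.range t).image e) fun f hf hvf hfW => ?_).trans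
      (Nat.add_le_add_left (Finset.card_image_le.trans (Finset.card_range t).le) _)
    obtain ⟨i, hi, rfl⟩ := houter f hf hvf hfW
    exact Finset.mem_image_of_mem e (Finset.mem_range.2 hi)
  · intro hr3
    refine (hsplit {e (t - 1)} fun f hf hvf hfW => ?_).trans (by simp)
    obtain ⟨i, hi, rfl⟩ := houter f hf hvf hfW
    by_cases hit : i = t - 1
    · simp [hit]
    refine absurd ?_ hfW
    have hne : ∀ a ≤ t, ∀ b ≤ t, a ≠ b → v a ≠ v b := fun a ha b hb hab hv =>
      hab (h.verts_inj a ha b hb hv)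
    have hthree : ({v i, v (i + 1), v t} : Finset V).card = 3 :=
      Finset.card_eq_three.2 ⟨_, _, _, hne _ (by omega) _ (by omega) (by omega),
        hne _ (by omega) _ (by omega) (by omega), hne _ (by omega) _ (by omega) (by omega), rfl⟩
    have hsub : ({v i, v (i + 1), v t} : Finset V) ⊆ e i := by
      simp [Finset.insert_subset_iff, h.fst_mem i hi, h.snd_mem i hi, hvf]
    rw [← Finset.eq_of_subset_of_card_le hsub (by rw [hr _ hf, hr3, hthree])]
    simp [Finset.insert_subset_iff, hmemW i (by omega), hmemW (i + 1) (by omega), hmemW t le_rfl]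

end IsBergeSeq

theorem le_choose_of_pos_of_lt {n j : ℕ} (hj : 0 < j) (hjn : j < n) : n ≤ n.choose j := by
  induction n generalizing j with
  | zero => omega
  | succ n ih =>
    obtain ⟨i, rfl⟩ : ∃ i, j = i + 1 := ⟨j - 1, by omega⟩
    rw [Nat.choose_succ_succ']
    have hi : 0 < n.choose i := Nat.choose_pos (by omega)
    rcases Nat.lt_or_ge (i + 1) n with h | h
    · have := ih hj h
      omega
    · obtain rfl : n = i + 1 := by omega
      simp

theorem lt_choose_of_one_lt_of_add_one_lt {n j : ℕ} (hj : 1 < j) (hjn : j + 1 < n) :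
    n < n.choose j := by
  obtain ⟨m, rfl⟩ : ∃ m, n = m + 1 := ⟨n - 1, by omega⟩
  obtain ⟨i, rfl⟩ : ∃ i, j = i + 1 := ⟨j - 1, by omega⟩
  rw [Nat.choose_succ_succ']
  have h1 := le_choose_of_pos_of_lt (n := m) (j := i) (by omega) (by omega)
  have h2 := le_choose_of_pos_of_lt (n := m) (j := i + 1) (by omega) (by omega)
  omega

section Residual

variable {V : Type*} {H G : Finset (Finset V)} {S T : Finset V} {r K D : ℕ}

theorem restrictTo_subset : restrictTo H S ⊆ H :=
  Finset.filter_subset _ _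

theorem subset_of_mem_restrictTo {f : Finset V} (hf : f ∈ restrictTo H S) : f ⊆ S :=
  (Finset.mem_filter.1 hf).2

theorem restrictTo_univ [Fintype V] : restrictTo H Finset.univ = H := by
  simp [restrictTo]

/-- In an `r`-graph of minimum degree at least `C(K, r - 1)`, every vertex is the start of a
Berge-path of length `K`. -/
theorem exists_isBergeSeq_of_le_hdeg (hr3 : 3 ≤ r) (hrK : r + 2 ≤ K)
    (hr : ∀ f ∈ G, f.card = r) (hGS : ∀ f ∈ G, f ⊆ S)
    (hdeg_ge : ∀ v ∈ S, K.choose (r - 1) ≤ hdeg G v) {w : V} (hw : w ∈ S) :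
    ∃ v e, IsBergeSeq G K v e ∧ v 0 = w := by
  suffices h : ∀ m ≤ K, ∃ v e, IsBergeSeq G m v e ∧ v 0 = w from h K le_rfl
  intro m
  induction m with
  | zero =>
    intro _
    exact ⟨fun _ => w, fun _ => ∅, ⟨fun i hi j hj _ => by omega, by simp, by simp, by simp,
      by simp⟩, rfl⟩
  | succ m ih =>
    intro hm
    obtain ⟨v, e, h, h0⟩ := ih (by omega)
    by_contra! hcon
    obtain ⟨hbound, hbound3⟩ := h.hdeg_le hr (fun v' e' h' => h0 ▸ hcon v' e' h')
    have hmS : v m ∈ S := by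
      rcases Nat.eq_zero_or_pos m with rfl | hpos
      · exact h0 ▸ hw
      · have := h.snd_mem (m - 1) (by omega)
        rw [Nat.sub_add_cancel hpos] at this
        exact hGS _ (h.edges_mem (m - 1) (by omega)) this
    have hD := hdeg_ge _ hmS
    obtain ⟨L, rfl⟩ : ∃ L, K = L + 1 := ⟨K - 1, by omega⟩
    obtain ⟨q, rfl⟩ : ∃ q, r = q + 2 := ⟨r - 2, by omega⟩
    rw [show q + 2 - 1 = q + 1 by omega] at *
    have hmono : m.choose (q + 1) ≤ L.choose (q + 1) := Nat.choose_le_choose _ (by omega)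
    rw [Nat.choose_succ_succ'] at hD
    rcases Nat.lt_or_ge 1 q with hq | hq
    · have := lt_choose_of_one_lt_of_add_one_lt (n := L) hq (by omega)
      omega
    · obtain rfl : q = 1 := by omega
      have := hbound3 rfl
      rw [Nat.choose_one_right] at hD
      omega

theorem sum_hdeg_eq (hr : ∀ f ∈ G, f.card = r) (hGS : ∀ f ∈ G, f ⊆ S) :
    ∑ v ∈ S, hdeg G v = G.card * r := by
  unfold hdeg
  have := Finset.sum_card_bipartiteAbove_eq_sum_card_bipartiteBelow (s := S) (t := G)
    (fun v f => v ∈ f)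
  unfold Finset.bipartiteAbove Finset.bipartiteBelow at this
  rw [this, Finset.sum_const_nat]
  intro f hf
  rw [← hr f hf, Finset.filter_mem_eq_inter, Finset.inter_eq_right.2 (hGS f hf)]

/-- The edge count along the deletion process: each deleted vertex destroys fewer than `D`
hyperedges. -/
theorem DelProcess.card_restrictTo_le (h : DelProcess H D T S) :
    (restrictTo H T).card + T.card + D * S.card ≤
      (restrictTo H S).card + S.card + D * T.card := by
  induction h with
  | refl S => exact le_rfl
  | step S T v hv hd h ih =>
    have hsplit : (restrictTo H S).card ≤
        hdeg (restrictTo H S) v + (restrictTo H (S.erase v)).card := by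
      refine (Finset.card_le_card fun f hf => ?_).trans (Finset.card_union_le _ _)
      by_cases hvf : v ∈ f
      · exact Finset.mem_union_left _ (Finset.mem_filter.2 ⟨hf, hvf⟩)
      · have hf' := Finset.mem_filter.1 hf
        exact Finset.mem_union_right _ (Finset.mem_filter.2
          ⟨hf'.1, Finset.subset_erase.2 ⟨hf'.2, hvf⟩⟩)
    have hcard := Finset.card_erase_add_one hv
    rw [← hcard, Nat.mul_add]
    omega

theorem card_restrictTo_le_choose (hr : ∀ f ∈ H, f.card = r) :
    (restrictTo H S).card ≤ S.card.choose r := by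
  rw [← Finset.card_powersetCard]
  refine Finset.card_le_card fun f hf => ?_
  have hf' := Finset.mem_filter.1 hf
  exact Finset.mem_powersetCard.2 ⟨hf'.2, hr f hf'.1⟩

/-- If the longest Berge-paths have length `K`, then the degree bound at their ends makes the
number of hyperedges small. -/
theorem card_mul_le_of_not_isBergeSeq (hr3 : 3 ≤ r) (hrK : r + 2 ≤ K)
    (hr : ∀ f ∈ G, f.card = r) (hGS : ∀ f ∈ G, f ⊆ S)
    (hdeg_ge : ∀ v ∈ S, K.choose (r - 1) ≤ hdeg G v)
    (hno : ∀ v e, ¬ IsBergeSeq G (K + 1) v e) :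
    G.card * r ≤ S.card * (K.choose (r - 1) + K) := by
  rw [← sum_hdeg_eq hr hGS, ← smul_eq_mul]
  refine Finset.sum_le_card_nsmul _ _ _ fun w hw => ?_
  obtain ⟨v, e, h, rfl⟩ := exists_isBergeSeq_of_le_hdeg hr3 hrK hr hGS hdeg_ge hw
  have hend := h.reverse.hdeg_le hr fun v' e' hlong => absurd hlong (hno v' e')
  simpa using hend.1

/-- Opening a Berge-cycle at its `j`-th hyperedge. -/
theorem BergeCycle.exists_isBergeSeq {l : ℕ} (C : BergeCycle G (l + 1)) (j : Fin (l + 1)) :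
    ∃ v e, IsBergeSeq G l v e ∧ v l = C.verts j ∧ (∀ i, v i ∈ Set.range C.verts) ∧
      ∀ i < l, e i ∈ Set.range C.edges ∧ e i ≠ C.edges j := by
  have hlt : ∀ i, (j + 1 + i) % (l + 1) < l + 1 := fun i => Nat.mod_lt _ (Nat.succ_pos l)
  have hinj : ∀ a ≤ l, ∀ b ≤ l, (j + 1 + a) % (l + 1) = (j + 1 + b) % (l + 1) → a = b := by
    intro a ha b hb hab
    have : a ≡ b [MOD (l + 1)] := Nat.ModEq.add_left_cancel' _ hab
    exact Nat.ModEq.eq_of_lt_of_lt this (by omega) (by omega)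
  have hlast : (j + 1 + l) % (l + 1) = j := by
    rw [show (j : ℕ) + 1 + l = j + (l + 1) by omega, Nat.add_mod_right, Nat.mod_eq_of_lt j.2]
  refine ⟨fun i => C.verts ⟨_, hlt i⟩, fun i => C.edges ⟨_, hlt i⟩, ⟨?_, ?_, ?_, ?_, ?_⟩, ?_,
    fun i => ⟨_, rfl⟩, fun i hi => ⟨⟨_, rfl⟩, fun hij => ?_⟩⟩
  · exact fun a ha b hb hab => hinj a ha b hb (congrArg Fin.val (C.verts_inj hab))
  · exact fun a ha b hb hab => hinj a ha.le b hb.le (congrArg Fin.val (C.edges_inj hab))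
  · exact fun i _ => C.edges_mem _
  · exact fun i _ => C.fst_mem _
  · intro i hi
    have := C.snd_mem ⟨_, hlt i⟩
    simpa only [Nat.mod_add_mod, Nat.add_assoc] using this
  · exact congrArg C.verts (Fin.ext hlast)
  · have := congrArg Fin.val (C.edges_inj hij)
    have := hinj i hi.le l le_rfl (this.trans hlast.symm)
    omega

/-- If no Berge-path is longer than `l`, then every hyperedge that meets a Berge-cycle of length
`l + 1` is contained in its vertex set. -/
theorem BergeCycle.subset_range_of_mem {l : ℕ} (C : BergeCycle G (l + 1))
    (hno : ∀ v e, ¬ IsBergeSeq G (l + 1) v e) {f : Finset V} (hf : f ∈ G) {c x : V}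
    (hc : c ∈ Set.range C.verts) (hcf : c ∈ f) (hxf : x ∈ f) : x ∈ Set.range C.verts := by
  by_contra hx
  obtain ⟨j, hjf, hj⟩ : ∃ j, C.verts j ∈ f ∧ ∀ i, C.edges i = f → i = j := by
    by_cases h : ∃ j, C.edges j = f
    · obtain ⟨j, rfl⟩ := h
      exact ⟨j, C.fst_mem j, fun i hi => C.edges_inj hi⟩
    · obtain ⟨j, rfl⟩ := hc
      exact ⟨j, hcf, fun i hi => absurd ⟨i, hi⟩ h⟩
  obtain ⟨v, e, h, hl, hv, he⟩ := C.exists_isBergeSeq j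
  obtain ⟨v', e', hlong, -⟩ := h.snoc hf (hl ▸ hjf) (fun i hi hif => by
    obtain ⟨⟨a, ha⟩, hne⟩ := he i hi
    exact hne (by rw [← ha, hj a (ha.trans hif)])) hxf
    (fun i _ hix => hx (hix ▸ hv i))
  exact hno v' e' hlong

/-- In a connected hypergraph, two disjoint nonempty sets `A`, `B` are joined by a Berge-path with
no inner vertex in `A ∪ B`. -/
theorem HConnected.exists_isBergeSeq_between (hconn : HConnected H) {A B : Set V}
    (hAB : Disjoint A B) (hA : A.Nonempty) (hB : B.Nonempty) :
    ∃ t v e, IsBergeSeq H t v e ∧ 0 < t ∧ v 0 ∈ A ∧ v t ∈ B ∧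
      ∀ i, 0 < i → i < t → v i ∉ A ∧ v i ∉ B := by
  obtain ⟨a, ha⟩ := hA
  obtain ⟨b, hb⟩ := hB
  have hex : ∃ t v e, IsBergeSeq H t v e ∧ v 0 ∈ A ∧ v t ∈ B := by
    obtain ⟨t, P, h0, ht⟩ := hconn a b (fun hab => Set.disjoint_left.1 hAB ha (hab ▸ hb))
    obtain ⟨v, e, h, hv0, hvt⟩ := IsBergeSeq.of_bergePath P
    exact ⟨t, v, e, h, by rwa [hv0, h0], by rwa [hvt, ht]⟩
  obtain ⟨v, e, h, hv0, hvt⟩ := Nat.find_spec hex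
  have hmin := fun m (hm : m < Nat.find hex) => Nat.find_min hex hm
  generalize Nat.find hex = t at *
  refine ⟨t, v, e, h, ?_, hv0, hvt, fun i hi hit => ⟨fun hiA => ?_, fun hiB => ?_⟩⟩
  · rcases Nat.eq_zero_or_pos t with rfl | hpos
    · exact absurd hvt (Set.disjoint_left.1 hAB hv0)
    · exact hpos
  · refine hmin (t - i) (by omega) ⟨_, _, h.drop hit.le, hiA, ?_⟩
    rwa [show i + (t - i) = t by omega]
  · exact hmin i hit ⟨v, e, h.take hit.le, hv0, hiB⟩

end Residual

/-- Under the standing assumptions, if `l` is the length of a longest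
Berge-path of `H'`, then `H'` contains no Berge-cycle of length greater than `l`; in
particular none of length `l+1`. -/
theorem residual_no_longer_berge_cycle
    (r k n : ℕ) (hk : 2 * r + 13 ≤ k) (hr : 18 ≤ 2 * r + 13) (hn : Nkr r k < n)
    (H : Finset (Finset (Fin n))) (huni : ∀ e ∈ H, e.card = r)
    (hconn : HConnected H) (hpath : IsEmpty (BergePath H k))
    (hcard : extremalCount r k n ≤ H.card)
    (S : Finset (Fin n))
    (hS : DelProcess H (((k - 1) / 2).choose (r - 1)) Finset.univ S)
    (hterm : ∀ v ∈ S, ((k - 1) / 2).choose (r - 1) ≤ hdeg (restrictTo H S) v)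
    (l : ℕ) (hl : Nonempty (BergePath (restrictTo H S) l))
    (hlmax : ∀ t, Nonempty (BergePath (restrictTo H S) t) → t ≤ l) :
    (∀ t, l < t → IsEmpty (BergeCycle (restrictTo H S) t)) ∧
      IsEmpty (BergeCycle (restrictTo H S) (l + 1)) := by
  set K := (k - 1) / 2 with hK
  set D := K.choose (r - 1) with hD
  set G := restrictTo H S with hG
  have hGH : G ⊆ H := restrictTo_subset
  have hGr : ∀ f ∈ G, f.card = r := fun f hf => huni f (hGH hf)
  have hGS : ∀ f ∈ G, f ⊆ S := fun f hf => subset_of_mem_restrictTo hf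
  have hr3 : 3 ≤ r := by omega
  have hrK : r + 2 ≤ K := by omega
  have hlG : ∀ t v e, IsBergeSeq G t v e → t ≤ l := fun t v e h =>
    hlmax t h.nonempty_bergePath
  have hkH : ∀ t v e, IsBergeSeq H t v e → t < k := fun t v e h => by
    by_contra! hkt
    exact hpath.false (h.take hkt).nonempty_bergePath.some
  have hlk : l < k := by
    obtain ⟨v, e, h, -⟩ := IsBergeSeq.of_bergePath hl.some
    exact hkH l v e (h.mono hGH)
  -- the deletion process leaves many vertices and many hyperedges
  have hdel := hS.card_restrictTo_le
  rw [restrictTo_univ, Finset.card_univ, Fintype.card_fin,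
    ← hG] at hdel
  have hSn : S.card ≤ n := by simpa using Finset.card_le_univ S
  have hDn : D * n ≤ D * (n - K) + D * K := by
    rw [← Nat.mul_add]
    exact Nat.mul_le_mul_left _ (by omega)
  unfold extremalCount at hcard
  unfold Nkr at hn
  rw [← hK, ← hD] at hcard hn
  have hScard : r * (k - 1) < S.card := by
    by_contra! hle
    have h1 : G.card ≤ S.card.choose r := card_restrictTo_le_choose huni
    have h2 := Nat.choose_le_choose r hle
    omega
  have hGcard : D * S.card ≤ G.card + D * K := by omega
  have hS3 : 3 * (2 * K) < S.card :=
    lt_of_le_of_lt (Nat.mul_le_mul hr3 (by omega)) hScard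
  have hSk : k < S.card := by omega
  have hKl : K + 1 ≤ l := by
    by_contra! hlt
    have h1 := card_mul_le_of_not_isBergeSeq hr3 hrK hGr hGS hterm fun v e h => by
      have := hlG _ v e h
      omega
    have h2 : K ≤ D := le_choose_of_pos_of_lt (by omega) (by omega)
    have h3 : G.card * 3 ≤ G.card * r := Nat.mul_le_mul_left _ hr3
    rw [← hD] at h1
    have h4 : S.card * (D + K) ≤ S.card * (D + D) := Nat.mul_le_mul_left _ (by omega)
    nlinarith
  suffices hmain : IsEmpty (BergeCycle G (l + 1)) by
    refine ⟨fun t ht => ⟨fun C => ?_⟩, hmain⟩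
    obtain ⟨s, rfl⟩ : ∃ s, t = s + 1 := ⟨t - 1, by omega⟩
    obtain ⟨v, e, h, -⟩ := C.exists_isBergeSeq 0
    obtain rfl : s = l := by
      have := hlG _ v e h
      omega
    exact hmain.false C
  refine ⟨fun C => ?_⟩
  have hclosed : ∀ f ∈ G, ∀ c ∈ f, ∀ x ∈ f, c ∈ Set.range C.verts → x ∈ Set.range C.verts :=
    fun f hf c hcf x hxf hc => C.subset_range_of_mem (fun v e h => by
      have := hlG _ v e h
      omega) hf hc hcf hxf
  have hCS : Set.range C.verts ⊆ S := by
    rintro _ ⟨j, rfl⟩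
    exact hGS _ (C.edges_mem j) (C.fst_mem j)
  obtain ⟨w, hwS, hwC⟩ : ∃ w ∈ S, w ∉ Set.range C.verts := by
    by_contra! hsub
    have h1 : S ⊆ Finset.univ.image C.verts := fun x hx => by
      obtain ⟨j, rfl⟩ := hsub x hx
      exact Finset.mem_image_of_mem _ (Finset.mem_univ j)
    have h2 := (Finset.card_le_card h1).trans Finset.card_image_le
    rw [Finset.card_univ, Fintype.card_fin] at h2
    omega
  obtain ⟨t, v, e, h, ht, h0, hvt, hinner⟩ := hconn.exists_isBergeSeq_between
    (A := Set.range C.verts) (B := (S : Set (Fin n)) \ Set.range C.verts)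
    Set.disjoint_sdiff_right ⟨_, ⟨0, rfl⟩⟩ ⟨w, hwS, hwC⟩
  have hinnerS : ∀ i, 0 < i → i < t → v i ∉ S := fun i hi hit hiS =>
    (hinner i hi hit).2 ⟨hiS, (hinner i hi hit).1⟩
  have heG : ∀ i < t, e i ∉ G := by
    intro i hi hiG
    have hfst : i = 0 := by
      by_contra hne
      exact hinnerS i (by omega) hi (hGS _ hiG (h.fst_mem i hi))
    have hsnd : i + 1 = t := by
      by_contra hne
      exact hinnerS (i + 1) (by omega) (by omega) (hGS _ hiG (h.snd_mem i hi))
    subst hfst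
    have := hclosed _ hiG _ (h.fst_mem 0 hi) _ (h.snd_mem 0 hi) h0
    rw [hsnd] at this
    exact hvt.2 this
  obtain ⟨j, hj⟩ := h0
  obtain ⟨v₁, e₁, h₁, hl₁, hv₁, -⟩ := C.exists_isBergeSeq j
  obtain ⟨v₂, e₂, h₂, h₂0⟩ := exists_isBergeSeq_of_le_hdeg hr3 hrK hGr hGS hterm hvt.1
  have hv₂ : ∀ i ≤ K, v₂ i ∈ S ∧ v₂ i ∉ Set.range C.verts := by
    intro i
    induction i with
    | zero => exact fun _ => h₂0 ▸ hvt
    | succ i ih =>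
      intro hi
      have hmem := h₂.edges_mem i hi
      refine ⟨hGS _ hmem (h₂.snd_mem i hi), fun hC => (ih (by omega)).2 ?_⟩
      exact hclosed _ hmem _ (h₂.snd_mem i hi) _ (h₂.fst_mem i hi) hC
  have hfront := (h₁.mono hGH).append h (hl₁.trans hj) (fun a _ b hb hb0 hab => by
      have hbC : v b ∈ Set.range C.verts := hab ▸ hv₁ a
      rcases hb.lt_or_eq with hbt | rfl
      · exact (hinner b (by omega) hbt).1 hbC
      · exact hvt.2 hbC)
    (fun a ha b hb hab => heG b hb (hab ▸ h₁.edges_mem a ha))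
  have hall := hfront.append (h₂.mono hGH) (by simp [h₂0, ht.ne']) (fun a ha b hb hb0 hab => by
      split_ifs at hab with hal
      · exact (hv₂ b hb).2 (hab ▸ hv₁ a)
      · rcases Nat.lt_or_ge (a - l) t with hlt | hge
        · exact hinnerS (a - l) (by omega) hlt (hab ▸ (hv₂ b hb).1)
        · rw [show a - l = t by omega, ← h₂0] at hab
          exact hb0 (h₂.verts_inj 0 (by omega) b hb hab).symm)
    (fun a ha b hb hab => by
      split_ifs at hab with hal
      · obtain ⟨hd₁, hd₂⟩ : e₁ a ∈ G ∧ e₂ b ∈ G := ⟨h₁.edges_mem a hal, h₂.edges_mem b hb⟩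
        have hC₁ := hv₁ a
        have hC₂ := hclosed _ hd₁ _ (h₁.fst_mem a hal) _ (hab ▸ h₂.fst_mem b hb) hC₁
        exact (hv₂ b hb.le).2 hC₂
      · exact heG (a - l) (by omega) (hab ▸ h₂.edges_mem b hb))
  have := hkH _ _ _ hall
  omega
end
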